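/- arXiv:2308.08907 — 5 statements merged into one kernel-verified Lean document; each statement's English description precedes it below -/
import Mathlib

section
/- Fix a positive integer d. Let F be a non-singular integral form of degree d in n variables such that o(F) ≥ 3, where o(F) is the order of F over ℚ. Then there exists a constant M such that for all primes p > M, R(F) is dense in ℚ_p. -/
open MvPolynomial

/-- The order of a form over a commutative ring: the smallest `m` such that after an
invertible linear change of variables the polynomial involves at most `m` variables. -/
noncomputable def formOrder {n : ℕ} {R : Type*} [CommRing R] (F : MvPolynomial (Fin n) R) : ℕ :=
  sInf { m | ∃ A : Matrix (Fin n) (Fin n) R, IsUnit A.det ∧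
    ((MvPolynomial.aeval (fun i => ∑ j, MvPolynomial.C (A i j) * MvPolynomial.X j) F).vars).card ≤ m }

/-- The ratio set of an integral form, viewed in `ℚ_[p]`. -/
def ratioSet (p : ℕ) [Fact p.Prime] {n : ℕ} (F : MvPolynomial (Fin n) ℤ) : Set ℚ_[p] :=
  { t | ∃ x y : Fin n → ℤ, MvPolynomial.eval y F ≠ 0 ∧
      t = (MvPolynomial.eval x F : ℚ_[p]) / (MvPolynomial.eval y F : ℚ_[p]) }

namespace Polynomial

section Derivation

variable {A R : Type*} [CommRing A] [CommRing R] [Algebra A R] (D : Derivation A R R)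

theorem dvd_iterate_derivation_pow_mul_sub (w : R) (e : ℕ) (g : R) :
    w ∣ D^[e] (w ^ e * g) - (e.factorial : R) * D w ^ e * g := by
  induction e generalizing g with
  | zero => simp
  | succ e ih =>
    have h1 : D (w ^ (e + 1) * g) = w ^ e * ((e + 1) * D w * g + w * D g) := by
      rw [Derivation.leibniz, Derivation.leibniz_pow]
      simp only [smul_eq_mul, nsmul_eq_mul, Nat.add_sub_cancel]
      push_cast
      ring
    rw [Function.iterate_succ_apply, h1]
    obtain ⟨r, hr⟩ := ih ((e + 1) * D w * g + w * D g)
    refine ⟨r + (e.factorial : R) * D w ^ e * D g, ?_⟩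
    rw [mul_add w, ← hr, Nat.factorial_succ]
    push_cast
    ring

theorem pow_dvd_of_forall_dvd_iterate_derivation {w g : R} (m : ℕ)
    (hw : IsCoprime w (D w)) (hm : ∀ e < m, IsUnit (e.factorial : R))
    (h : ∀ s < m, w ∣ D^[s] g) : w ^ m ∣ g := by
  induction m with
  | zero => simp
  | succ m ih =>
    obtain ⟨r, hr⟩ := ih (fun e he => hm e (by omega)) (fun s hs => h s (by omega))
    have h1 := h m (by omega)
    rw [hr] at h1
    have h2 := (dvd_sub_right h1).1 (dvd_iterate_derivation_pow_mul_sub D w m r)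
    have h3 : IsCoprime w ((m.factorial : R) * D w ^ m) :=
      (isCoprime_mul_unit_left_right (hm m (by omega)) _ _).2 hw.pow_right
    obtain ⟨q, hq⟩ := h3.dvd_of_dvd_mul_left h2
    exact ⟨q, by rw [hr, hq]; ring⟩

end Derivation

section Bivariate

variable {K : Type*} [Field K]

/-- Bivariate polynomials of total degree at most `T`. -/
def totalDegreeLE (K : Type*) [Field K] (T : ℕ) : Submodule K K[X][X] where
  carrier := {q | ∀ i j, T < i + j → (q.coeff j).coeff i = 0}
  add_mem' ha hb i j h := by simp [ha i j h, hb i j h]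
  zero_mem' := by simp
  smul_mem' c a ha i j h := by simp [ha i j h]

theorem totalDegreeLE_mono {S T : ℕ} (h : S ≤ T) : totalDegreeLE K S ≤ totalDegreeLE K T :=
  fun _ hq i j hij => hq i j (by omega)

theorem mul_mem_totalDegreeLE {S T : ℕ} {q r : K[X][X]} (hq : q ∈ totalDegreeLE K S)
    (hr : r ∈ totalDegreeLE K T) : q * r ∈ totalDegreeLE K (S + T) := by
  intro i j h
  rw [coeff_mul, finsetSum_coeff]
  refine Finset.sum_eq_zero fun a ha => ?_
  rw [coeff_mul]
  refine Finset.sum_eq_zero fun b hb => ?_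
  rw [Finset.HasAntidiagonal.mem_antidiagonal] at ha hb
  by_cases h1 : S < b.1 + a.1
  · rw [hq _ _ h1, zero_mul]
  · rw [hr _ _ (by omega), mul_zero]

theorem C_X_pow_mul_X_pow_mem_totalDegreeLE (i j : ℕ) :
    (C X ^ i * X ^ j : K[X][X]) ∈ totalDegreeLE K (i + j) := by
  intro a b h
  rw [← C_pow, coeff_C_mul, coeff_X_pow]
  split_ifs with h1
  · rw [mul_one, coeff_X_pow, if_neg (by omega)]
  · simp

theorem natDegree_coeff_le_of_mem_totalDegreeLE {T : ℕ} {q : K[X][X]}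
    (hq : q ∈ totalDegreeLE K T) (j : ℕ) : (q.coeff j).natDegree ≤ T - j :=
  natDegree_le_iff_coeff_eq_zero.2 fun i hi => hq i j (by omega)

theorem natDegree_le_of_mem_totalDegreeLE {T : ℕ} {q : K[X][X]}
    (hq : q ∈ totalDegreeLE K T) : q.natDegree ≤ T :=
  natDegree_le_iff_coeff_eq_zero.2 fun j hj => by
    ext i
    simpa using hq i j (by omega)

theorem derivative_mem_totalDegreeLE {T : ℕ} {q : K[X][X]}
    (hq : q ∈ totalDegreeLE K T) : derivative q ∈ totalDegreeLE K T := by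
  intro i j h
  have := hq i (j + 1) (by omega)
  rw [coeff_derivative]
  have h2 : ((j : K[X]) + 1) = C ((j : K) + 1) := by simp
  rw [h2, coeff_mul_C, this, zero_mul]

/-- Differentiation of bivariate polynomials with respect to the inner variable. -/
noncomputable def innerDerivative (K : Type*) [Field K] : Derivation K K[X][X] K[X][X] :=
  PolynomialModule.equivPolynomialSelf.compDer (derivative' (R := K)).mapCoeffs

theorem coeff_innerDerivative (q : K[X][X]) (j : ℕ) :
    (innerDerivative K q).coeff j = derivative (q.coeff j) := rfl

theorem innerDerivative_C (a : K[X]) : innerDerivative K (C a) = C (derivative a) := by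
  ext j i
  rw [coeff_innerDerivative, coeff_C, coeff_C]
  split_ifs <;> simp

theorem innerDerivative_mem_totalDegreeLE {T : ℕ} {q : K[X][X]}
    (hq : q ∈ totalDegreeLE K T) : innerDerivative K q ∈ totalDegreeLE K T := by
  intro i j h
  rw [coeff_innerDerivative, coeff_derivative, hq (i + 1) j (by omega), zero_mul]

theorem exists_totalDegreeLE_degree_lt {f : K[X][X]} (hf : f.Monic) {d : ℕ}
    (hd : f ∈ totalDegreeLE K d) (hfd : f.natDegree = d) (T : ℕ) (q : K[X][X])
    (hq : q ∈ totalDegreeLE K T) :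
    ∃ r ∈ totalDegreeLE K T, r.degree < d ∧ f ∣ q - r := by
  induction hn : q.natDegree using Nat.strong_induction_on generalizing q with
  | _ n ih =>
    subst hn
    by_cases h : q.degree < d
    · exact ⟨q, hq, h, by simp⟩
    have hq0 : q ≠ 0 := by
      rintro rfl
      simp at h
    have hdn : d ≤ q.natDegree := by
      rw [degree_eq_natDegree hq0] at h
      exact_mod_cast not_lt.1 h
    have hnT := natDegree_le_of_mem_totalDegreeLE hq
    set q' := q - f * monomial (q.natDegree - d) q.leadingCoeff with hq'
    have hmem : (monomial (q.natDegree - d) q.leadingCoeff : K[X][X]) ∈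
        totalDegreeLE K (T - d) := by
      intro i j hij
      rw [coeff_monomial]
      split_ifs with h1
      · exact hq i q.natDegree (by omega)
      · simp
    have hmem' : q' ∈ totalDegreeLE K T := by
      refine sub_mem hq ?_
      have := mul_mem_totalDegreeLE hd hmem
      rwa [show d + (T - d) = T by omega] at this
    have hf0 : f.degree = d := by rw [degree_eq_natDegree hf.ne_zero, hfd]
    have hlt : q'.degree < q.degree := by
      refine degree_sub_lt_left ?_ hq0 ?_
      · rw [degree_mul, hf0, degree_monomial _ (leadingCoeff_ne_zero.2 hq0),
          degree_eq_natDegree hq0]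
        norm_cast
        omega
      · rw [leadingCoeff_mul, hf.leadingCoeff, one_mul, leadingCoeff_monomial]
    by_cases hlt' : q'.degree < d
    · exact ⟨q', hmem', hlt', by simp [hq']⟩
    have hq0' : q' ≠ 0 := by
      intro h0
      simp [h0] at hlt'
    obtain ⟨r, hr, hrd, hrf⟩ := ih q'.natDegree (natDegree_lt_natDegree hq0' hlt) q' hmem' rfl
    refine ⟨r, hr, hrd, ?_⟩
    have : q - r = (q' - r) + f * monomial (q.natDegree - d) q.leadingCoeff := by
      rw [hq']; ring
    rw [this]
    exact dvd_add hrf (dvd_mul_right _ _)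

end Bivariate

section Curve

variable {K : Type*} [Field K] (f : K[X][X])

/-- The quotient map onto the coordinate ring of the curve `f = 0`. -/
noncomputable def curveMk : K[X][X] →ₐ[K] AdjoinRoot f := (AdjoinRoot.mkₐ f).restrictScalars K

@[simp] theorem curveMk_apply (q : K[X][X]) : curveMk f q = AdjoinRoot.mk f q := rfl

theorem curveMk_surjective : Function.Surjective (curveMk f) := AdjoinRoot.mk_surjective

/-- The functions on the curve `f = 0` induced by polynomials of total degree at most `T`. -/
noncomputable def curveLE (T : ℕ) : Submodule K (AdjoinRoot f) :=
  (totalDegreeLE K T).map (curveMk f).toLinearMap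

variable {f}

theorem curveLE_mono {S T : ℕ} (h : S ≤ T) : curveLE f S ≤ curveLE f T :=
  Submodule.map_mono (totalDegreeLE_mono h)

theorem mk_mem_curveLE {T : ℕ} {q : K[X][X]} (hq : q ∈ totalDegreeLE K T) :
    AdjoinRoot.mk f q ∈ curveLE f T := ⟨q, hq, rfl⟩

theorem mul_mem_curveLE {S T : ℕ} {q r : AdjoinRoot f} (hq : q ∈ curveLE f S)
    (hr : r ∈ curveLE f T) : q * r ∈ curveLE f (S + T) := by
  obtain ⟨q, hq, rfl⟩ := hq
  obtain ⟨r, hr, rfl⟩ := hr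
  exact ⟨q * r, mul_mem_totalDegreeLE hq hr, map_mul (curveMk f) q r⟩

theorem of_X_pow_mul_root_pow_mem_curveLE (i j : ℕ) :
    AdjoinRoot.of f X ^ i * AdjoinRoot.root f ^ j ∈ curveLE f (i + j) := by
  have := mk_mem_curveLE (f := f) (C_X_pow_mul_X_pow_mem_totalDegreeLE (K := K) i j)
  simpa using this

variable (f) in
/-- The derivation `f_y ∂_x - f_x ∂_y` of bivariate polynomials. -/
noncomputable def hamiltonianDerivation : Derivation K K[X][X] K[X][X] :=
  derivative f • innerDerivative K -
    innerDerivative K f • (derivative' (R := K[X])).restrictScalars K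

theorem hamiltonianDerivation_apply (q : K[X][X]) :
    hamiltonianDerivation f q =
      derivative f * innerDerivative K q - innerDerivative K f * derivative q := rfl

theorem curveMk_hamiltonianDerivation_eq_zero (q : K[X][X]) (hq : curveMk f q = 0) :
    curveMk f (hamiltonianDerivation f q) = 0 := by
  rw [curveMk_apply, AdjoinRoot.mk_eq_zero] at hq ⊢
  obtain ⟨r, rfl⟩ := hq
  rw [hamiltonianDerivation_apply]
  simp only [Derivation.leibniz, smul_eq_mul, derivative_mul]
  exact ⟨derivative f * innerDerivative K r - innerDerivative K f * derivative r, by ring⟩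

variable (f) in
/-- The derivation `f_y ∂_x - f_x ∂_y` on the coordinate ring of the curve `f = 0`. -/
noncomputable def curveDerivation : Derivation K (AdjoinRoot f) (AdjoinRoot f) :=
  Derivation.liftOfSurjective (curveMk_surjective f) curveMk_hamiltonianDerivation_eq_zero

theorem curveDerivation_mk (q : K[X][X]) :
    curveDerivation f (AdjoinRoot.mk f q) =
      AdjoinRoot.mk f (derivative f * innerDerivative K q - innerDerivative K f * derivative q) :=
  Derivation.liftOfSurjective_apply (curveMk_surjective f) curveMk_hamiltonianDerivation_eq_zero q

theorem curveDerivation_of (a : K[X]) :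
    curveDerivation f (AdjoinRoot.of f a) =
      AdjoinRoot.mk f (derivative f) * AdjoinRoot.of f (derivative a) := by
  rw [← AdjoinRoot.mk_C, curveDerivation_mk, innerDerivative_C]
  simp

theorem curveDerivation_mem_curveLE {d T : ℕ} (hd : f ∈ totalDegreeLE K d) {q : AdjoinRoot f}
    (hq : q ∈ curveLE f T) : curveDerivation f q ∈ curveLE f (T + d) := by
  obtain ⟨q, hq, rfl⟩ := hq
  change curveDerivation f (AdjoinRoot.mk f q) ∈ _
  rw [curveDerivation_mk]
  refine mk_mem_curveLE ?_
  rw [add_comm]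
  exact sub_mem
    (mul_mem_totalDegreeLE (derivative_mem_totalDegreeLE hd) (innerDerivative_mem_totalDegreeLE hq))
    (mul_mem_totalDegreeLE (innerDerivative_mem_totalDegreeLE hd) (derivative_mem_totalDegreeLE hq))

theorem iterate_curveDerivation_mem_curveLE {d T : ℕ} (hd : f ∈ totalDegreeLE K d)
    {q : AdjoinRoot f} (hq : q ∈ curveLE f T) (s : ℕ) :
    (curveDerivation f)^[s] q ∈ curveLE f (T + s * d) := by
  induction s with
  | zero => simpa using hq
  | succ s ih =>
    rw [Function.iterate_succ_apply', show T + (s + 1) * d = T + s * d + d by ring]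
    exact curveDerivation_mem_curveLE hd ih

variable (f) in
/-- The function `∑ w_j(x) y ^ j` on the curve `f = 0`. -/
noncomputable def curveSum (d T : ℕ) : (Fin d → degreeLT K T) →ₗ[K] AdjoinRoot f :=
  ∑ j : Fin d, (LinearMap.mulRight K (AdjoinRoot.root f ^ (j : ℕ))) ∘ₗ
    ((Algebra.linearMap K[X] (AdjoinRoot f)).restrictScalars K) ∘ₗ (degreeLT K T).subtype ∘ₗ
      LinearMap.proj j

theorem curveSum_apply (d T : ℕ) (w : Fin d → degreeLT K T) :
    curveSum f d T w = AdjoinRoot.mk f (∑ j : Fin d, monomial (j : ℕ) (w j : K[X])) := by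
  simp [curveSum, ← C_mul_X_pow_eq_monomial]

theorem mk_injective_of_degree_lt (hf : f.Monic) {q r : K[X][X]} (hq : q.degree < f.natDegree)
    (hr : r.degree < f.natDegree) (h : AdjoinRoot.mk f q = AdjoinRoot.mk f r) : q = r := by
  rw [AdjoinRoot.mk_eq_mk] at h
  refine sub_eq_zero.1 (eq_zero_of_dvd_of_degree_lt h ?_)
  rw [degree_eq_natDegree hf.ne_zero]
  exact (degree_sub_le _ _).trans_lt (max_lt hq hr)

theorem coeff_sum_monomial_fin {R : Type*} [CommRing R] (d : ℕ) (w : Fin d → R) (j : Fin d) :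
    (∑ j : Fin d, monomial (j : ℕ) (w j)).coeff j = w j := by
  simp [coeff_monomial, Fin.val_inj]

theorem degree_sum_monomial_fin_lt {R : Type*} [CommRing R] (d : ℕ) (w : Fin d → R) :
    (∑ j : Fin d, monomial (j : ℕ) (w j)).degree < d := by
  refine (degree_lt_iff_coeff_zero _ _).2 fun m hm => ?_
  rw [finsetSum_coeff]
  refine Finset.sum_eq_zero fun j _ => ?_
  rw [coeff_monomial, if_neg (by omega)]

theorem curveSum_injective (hf : f.Monic) (T : ℕ) :
    Function.Injective (curveSum f f.natDegree T) := by
  intro v w h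
  rw [curveSum_apply, curveSum_apply] at h
  have := mk_injective_of_degree_lt hf (degree_sum_monomial_fin_lt _ _)
    (degree_sum_monomial_fin_lt _ _) h
  ext1 j
  have h2 := congrArg (fun q => q.coeff j) this
  simp only [coeff_sum_monomial_fin] at h2
  exact Subtype.ext h2

theorem curveSum_mem_curveLE (d T : ℕ) (w : Fin d → degreeLT K T) :
    curveSum f d T w ∈ curveLE f (T + d) := by
  rw [curveSum_apply]
  refine mk_mem_curveLE (Submodule.sum_mem _ fun j _ a b hab => ?_)
  rw [coeff_monomial]
  split_ifs with h
  · have := mem_degreeLT.1 (w j).2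
    exact (degree_lt_iff_coeff_zero _ _).1 this _ (by omega)
  · simp

theorem exists_mk_eq_of_mem_curveLE (hf : f.Monic) (hd : f ∈ totalDegreeLE K f.natDegree) {T : ℕ}
    {g : AdjoinRoot f} (hg : g ∈ curveLE f T) :
    ∃ r ∈ totalDegreeLE K T, r.degree < f.natDegree ∧ AdjoinRoot.mk f r = g := by
  obtain ⟨q, hq, rfl⟩ := hg
  obtain ⟨r, hr, hr1, hr2⟩ := exists_totalDegreeLE_degree_lt hf hd rfl T q hq
  exact ⟨r, hr, hr1, (AdjoinRoot.mk_eq_mk.2 hr2).symm⟩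

theorem curveLE_le_range_curveSum (hf : f.Monic) (hd : f ∈ totalDegreeLE K f.natDegree) (T : ℕ) :
    curveLE f T ≤ LinearMap.range (curveSum f f.natDegree (T + 1)) := by
  intro g hg
  obtain ⟨r, hr, hr1, rfl⟩ := exists_mk_eq_of_mem_curveLE hf hd hg
  refine ⟨fun j => ⟨r.coeff j, mem_degreeLT.2 ?_⟩, ?_⟩
  · refine (degree_lt_iff_coeff_zero _ _).2 fun i hi => hr i j (by omega)
  · rw [curveSum_apply]
    congr 1
    ext1 m
    by_cases hm : m < f.natDegree
    · exact coeff_sum_monomial_fin (f.natDegree) (fun j => r.coeff j) ⟨m, hm⟩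
    · rw [(degree_lt_iff_coeff_zero _ _).1 hr1 m (by omega)]
      exact (degree_lt_iff_coeff_zero _ _).1 (degree_sum_monomial_fin_lt _ _) m (by omega)

instance finite_degreeLT (T : ℕ) : Module.Finite K (degreeLT K T) :=
  Module.Finite.equiv (degreeLTEquiv K T).symm

theorem finrank_degreeLT (T : ℕ) : Module.finrank K (degreeLT K T) = T := by
  rw [(degreeLTEquiv K T).finrank_eq, Module.finrank_fin_fun]

theorem finite_curveLE (hf : f.Monic) (hd : f ∈ totalDegreeLE K f.natDegree) (T : ℕ) :
    Module.Finite K (curveLE f T) :=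
  Submodule.finiteDimensional_of_le (curveLE_le_range_curveSum hf hd T)

theorem finrank_curveLE_le (hf : f.Monic) (hd : f ∈ totalDegreeLE K f.natDegree) (T : ℕ) :
    Module.finrank K (curveLE f T) ≤ f.natDegree * (T + 1) := by
  refine (Submodule.finrank_mono (curveLE_le_range_curveSum hf hd T)).trans
    ((LinearMap.finrank_range_le _).trans ?_)
  rw [Module.finrank_pi_fintype]
  simp [finrank_degreeLT]

/-- A nonzero function on the curve divides a nonzero polynomial in `x` of bounded degree. -/
theorem exists_mul_eq_of (hf : f.Monic) (hd : f ∈ totalDegreeLE K f.natDegree)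
    [IsDomain (AdjoinRoot f)] {A : ℕ} {v : AdjoinRoot f} (hv : v ∈ curveLE f A) (hv0 : v ≠ 0) :
    ∃ N : K[X], N ≠ 0 ∧ N.natDegree ≤ f.natDegree * (A + f.natDegree + 1) ∧
      ∃ w, v * w = AdjoinRoot.of f N := by
  set d := f.natDegree with hdef
  set S := d * (A + d + 1) with hS
  have := finite_curveLE hf hd (A + S + 1 + d)
  have hofmem : ∀ N ∈ degreeLT K (S + 1), AdjoinRoot.of f N ∈ curveLE f S := by
    intro N hN
    rw [← AdjoinRoot.mk_C]
    refine mk_mem_curveLE fun i j hij => ?_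
    rw [coeff_C]
    split_ifs with h
    · exact (degree_lt_iff_coeff_zero _ _).1 (mem_degreeLT.1 hN) _ (by omega)
    · simp
  let Φ : ((Fin d → degreeLT K (S + 1)) × degreeLT K (S + 1)) →ₗ[K] AdjoinRoot f :=
    (LinearMap.mulLeft K v ∘ₗ curveSum f d (S + 1)) ∘ₗ LinearMap.fst _ _ _ -
      (((Algebra.linearMap K[X] (AdjoinRoot f)).restrictScalars K) ∘ₗ
        (degreeLT K (S + 1)).subtype) ∘ₗ LinearMap.snd _ _ _
  have hΦ : ∀ w N, Φ (w, N) = v * curveSum f d (S + 1) w - AdjoinRoot.of f (N : K[X]) :=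
    fun w N => rfl
  have hmem : ∀ u, Φ u ∈ curveLE f (A + S + 1 + d) := by
    rintro ⟨w, N⟩
    rw [hΦ]
    refine sub_mem ?_ (curveLE_mono (by omega) (hofmem N N.2))
    exact curveLE_mono (by omega) (mul_mem_curveLE hv (curveSum_mem_curveLE d (S + 1) w))
  have hker := LinearMap.ker_ne_bot_of_finrank_lt (f := LinearMap.codRestrict _ Φ hmem) (by
    refine (finrank_curveLE_le hf hd _).trans_lt ?_
    rw [Module.finrank_prod, Module.finrank_pi_fintype]
    simp only [finrank_degreeLT, Finset.sum_const, Finset.card_univ, Fintype.card_fin, smul_eq_mul]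
    rw [← hdef]
    have : d * (A + S + 1 + d + 1) = d * (S + 1) + S := by rw [hS]; ring
    omega)
  obtain ⟨⟨w, N⟩, hu, hu0⟩ := Submodule.exists_mem_ne_zero_of_ne_bot hker
  rw [LinearMap.ker_codRestrict, LinearMap.mem_ker, hΦ, sub_eq_zero] at hu
  refine ⟨N, ?_, ?_, _, hu⟩
  · intro hN
    rw [hN, map_zero, mul_eq_zero, or_iff_right hv0, ← map_zero (curveSum f d (S + 1))] at hu
    exact hu0 (Prod.ext (curveSum_injective hf _ hu) (Subtype.ext hN))
  · refine natDegree_le_iff_coeff_eq_zero.2 fun i hi => ?_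
    exact (degree_lt_iff_coeff_zero _ _).1 (mem_degreeLT.1 N.2) _ (by omega)

theorem eq_zero_of_of_dvd_of_mem_curveLE (hf : f.Monic) (hd : f ∈ totalDegreeLE K f.natDegree)
    {T : ℕ} {g : AdjoinRoot f} (hg : g ∈ curveLE f T) {W : K[X]} (hW : T < W.natDegree)
    (h : AdjoinRoot.of f W ∣ g) : g = 0 := by
  obtain ⟨q, rfl⟩ := h
  obtain ⟨r, hr, hr1, hr2⟩ := exists_mk_eq_of_mem_curveLE hf hd hg
  obtain ⟨q, rfl⟩ := AdjoinRoot.mk_surjective q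
  rw [← AdjoinRoot.mk_C, ← map_mul, ← modByMonic_add_div q f, mul_add, map_add,
    mul_left_comm, map_mul (AdjoinRoot.mk f) f, AdjoinRoot.mk_self, zero_mul, add_zero] at hr2 ⊢
  have hq : (q %ₘ f).degree < f.natDegree := by
    rw [← degree_eq_natDegree hf.ne_zero]
    exact degree_modByMonic_lt q hf
  have hWq : (C W * (q %ₘ f)).degree < f.natDegree := by
    refine (degree_mul_le _ _).trans_lt ?_
    exact (add_le_add degree_C_le le_rfl).trans_lt (by simpa using hq)
  have key := mk_injective_of_degree_lt hf hr1 hWq hr2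
  have : q %ₘ f = 0 := by
    ext1 j
    by_contra hj
    have h1 : r.coeff j = W * (q %ₘ f).coeff j := by rw [key, coeff_C_mul]
    have h2 := natDegree_coeff_le_of_mem_totalDegreeLE hr j
    rw [h1, natDegree_mul (by rintro rfl; simp at hW) hj] at h2
    omega
  rw [this, mul_zero, map_zero]

end Curve

section Derivation

variable {A R : Type*} [CommRing A] [CommRing R] [Algebra A R] (D : Derivation A R R)

theorem iterate_derivation_add (s : ℕ) (a b : R) : D^[s] (a + b) = D^[s] a + D^[s] b :=
  iterate_map_add D s a b

theorem iterate_derivation_sum {ι : Type*} (t : Finset ι) (s : ℕ) (a : ι → R) :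
    D^[s] (∑ i ∈ t, a i) = ∑ i ∈ t, D^[s] (a i) := by
  induction s generalizing a with
  | zero => rfl
  | succ s ih => simp only [Function.iterate_succ_apply, map_sum, ih]

theorem iterate_derivation_mul_of_eq_zero {c : R} (hc : D c = 0) (s : ℕ) (a : R) :
    D^[s] (c * a) = c * D^[s] a := by
  induction s generalizing a with
  | zero => rfl
  | succ s ih => simp [Function.iterate_succ_apply, Derivation.leibniz, hc, ih]

theorem derivation_pow_char_eq_zero (p : ℕ) [CharP R p] (a : R) : D (a ^ p) = 0 := by
  rw [Derivation.leibniz_pow, nsmul_eq_mul, CharP.cast_eq_zero, zero_mul]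

theorem map_iterate_derivation_mul_eq_zero {B : Type*} [CommRing B] (ev : R →+* B) (s : ℕ)
    {v : R} (w : R) (hv : ∀ s, ev (D^[s] v) = 0) : ev (D^[s] (v * w)) = 0 := by
  induction s generalizing v w with
  | zero =>
    have := hv 0
    simp_all
  | succ s ih =>
    rw [Function.iterate_succ_apply, Derivation.leibniz, iterate_derivation_add, map_add,
      smul_eq_mul, smul_eq_mul, ih _ hv, mul_comm w, ih _ fun s => hv (s + 1), add_zero]

end Derivation

section Curve

variable {K : Type*} [Field K] {f : K[X][X]}

theorem isCoprime_sub_of_of_eval_ne_zero (N : K[X]) {x₀ : K} (h : N.eval x₀ ≠ 0) :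
    IsCoprime (X - C x₀) N := by
  refine (irreducible_X_sub_C x₀).coprime_iff_not_dvd.2 fun hd => h ?_
  exact dvd_iff_isRoot.1 hd

theorem mk_derivative_ne_zero (hf : f.Monic) (hd : (f.natDegree : K) ≠ 0) :
    AdjoinRoot.mk f (derivative f) ≠ 0 := by
  have hd0 : f.natDegree ≠ 0 := by
    intro h
    simp [h] at hd
  intro h
  rw [AdjoinRoot.mk_eq_zero] at h
  have h1 := eq_zero_of_dvd_of_degree_lt h (degree_derivative_lt hf.ne_zero)
  have h2 := congrArg (fun q => q.coeff (f.natDegree - 1)) h1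
  simp only [coeff_derivative, coeff_zero] at h2
  rw [Nat.sub_add_cancel (by omega), hf.coeff_natDegree, one_mul, Nat.cast_sub (by omega)] at h2
  simp only [Nat.cast_one, sub_add_cancel] at h2
  exact hd (by simpa using congrArg (eval 0) h2)

theorem exists_mem_curveLE (g : AdjoinRoot f) : ∃ T, g ∈ curveLE f T := by
  obtain ⟨q, rfl⟩ := AdjoinRoot.mk_surjective g
  refine ⟨q.natDegree + q.support.sup fun j => (q.coeff j).natDegree, mk_mem_curveLE ?_⟩
  intro i j hij
  by_cases hj : j ∈ q.support
  · have h1 := le_natDegree_of_mem_supp j hj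
    have h2 := Finset.le_sup (f := fun j => (q.coeff j).natDegree) hj
    exact coeff_eq_zero_of_natDegree_lt (by omega)
  · rw [notMem_support_iff.1 hj, coeff_zero]

theorem exists_eval_ne_zero_of_ne_zero [IsAlgClosed K] (hf : f.Monic) (hd0 : f.natDegree ≠ 0)
    (hd : f ∈ totalDegreeLE K f.natDegree) [IsDomain (AdjoinRoot f)] {v : AdjoinRoot f}
    (hv : v ≠ 0) :
    ∃ (x₀ : K) (ev : AdjoinRoot f →+* K), (∀ a : K[X], ev (AdjoinRoot.of f a) = a.eval x₀) ∧
      ev v ≠ 0 := by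
  obtain ⟨T, hT⟩ := exists_mem_curveLE v
  obtain ⟨N, hN, -, w, hw⟩ := exists_mul_eq_of hf hd hT hv
  obtain ⟨x₀, hx₀⟩ : ∃ x₀, N.eval x₀ ≠ 0 := by
    by_contra! h
    exact hN (Polynomial.funext (by simpa using h))
  have hdeg : (f.map (evalRingHom x₀)).degree ≠ 0 := by
    rw [hf.degree_map, degree_eq_natDegree hf.ne_zero]
    exact_mod_cast hd0
  obtain ⟨y₀, hy₀⟩ := IsAlgClosed.exists_root _ hdeg
  rw [IsRoot.def, eval_map] at hy₀
  refine ⟨x₀, AdjoinRoot.lift (evalRingHom x₀) y₀ hy₀, fun a => by simp, fun h => hx₀ ?_⟩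
  have := congrArg (AdjoinRoot.lift (evalRingHom x₀) y₀ hy₀) hw
  simpa [h] using this.symm

theorem natCast_factorial_ne_zero (p : ℕ) [Fact p.Prime] [CharP K p] {e : ℕ} (he : e < p) :
    (e.factorial : K) ≠ 0 := by
  rw [Ne, CharP.cast_eq_zero_iff K p, (Fact.out : p.Prime).dvd_factorial]
  omega

theorem sum_pow_char_mul_ne_zero [IsAlgClosed K] (p : ℕ) [Fact p.Prime] [CharP K p]
    (hf : f.Monic) (hdK : (f.natDegree : K) ≠ 0)
    (hd : f ∈ totalDegreeLE K f.natDegree) [IsDomain (AdjoinRoot f)] {A : ℕ}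
    (hp : f.natDegree * (A + f.natDegree + f.natDegree + 1) < p)
    (u : Fin f.natDegree → Fin A → AdjoinRoot f) (hu : u ≠ 0) :
    ∑ j, ∑ i, u j i ^ p * (AdjoinRoot.of f X ^ (i : ℕ) * AdjoinRoot.root f ^ (j : ℕ)) ≠ 0 := by
  have : CharP (AdjoinRoot f) p := charP_of_injective_algebraMap' K p
  obtain ⟨j₀, i₀, hu₀⟩ : ∃ j i, u j i ≠ 0 := by
    by_contra! h
    exact hu (by ext j i; exact h j i)
  have hd0 : f.natDegree ≠ 0 := by
    intro h
    simp [h] at hdK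
  obtain ⟨x₀, ev, hev, hv⟩ := exists_eval_ne_zero_of_ne_zero hf hd0 hd
    (mul_ne_zero hu₀ (mk_derivative_ne_zero hf hdK))
  rw [map_mul] at hv
  intro h0
  set D := curveDerivation f with hD
  let c : Fin f.natDegree → Fin A → K := fun j i => ev (u j i) ^ p
  let w : Fin f.natDegree → degreeLT K A := fun j =>
    ⟨∑ i : Fin A, monomial (i : ℕ) (c j i), mem_degreeLT.2 (degree_sum_monomial_fin_lt A (c j))⟩
  set v := curveSum f f.natDegree A w with hvdef
  have hvsum : v = ∑ j, ∑ i, c j i • (AdjoinRoot.of f X ^ (i : ℕ) * AdjoinRoot.root f ^ (j : ℕ)) := by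
    rw [hvdef, curveSum_apply, map_sum]
    refine Finset.sum_congr rfl fun j _ => ?_
    rw [← C_mul_X_pow_eq_monomial]
    rw [map_mul, map_pow, AdjoinRoot.mk_X, AdjoinRoot.mk_C, map_sum, Finset.sum_mul]
    refine Finset.sum_congr rfl fun i _ => ?_
    rw [← C_mul_X_pow_eq_monomial, Algebra.smul_def, ← mul_assoc, map_mul,
      map_pow (AdjoinRoot.of f) X]
    rfl
  have hv0 : v ≠ 0 := by
    intro h
    rw [hvdef, ← map_zero (curveSum f f.natDegree A)] at h
    have h1 := congrFun (curveSum_injective hf _ h) j₀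
    have h2 := congrArg (fun q : degreeLT K A => (q : K[X]).coeff i₀) h1
    simp only [w, coeff_sum_monomial_fin] at h2
    refine hv ?_
    rw [eq_zero_of_pow_eq_zero (show ev (u j₀ i₀) ^ p = 0 from h2), zero_mul]
  have hevK : ∀ k : K, ev (algebraMap K _ k) = k := fun k => by
    have := hev (C k)
    rwa [eval_C] at this
  have hDv : ∀ s, ev (D^[s] v) = 0 := by
    intro s
    have h1 := congrArg (fun r => ev (D^[s] r)) h0
    simp only [iterate_derivation_sum, iterate_map_zero, map_zero, map_sum,
      iterate_derivation_mul_of_eq_zero D (derivation_pow_char_eq_zero D p _), map_mul,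
      map_pow] at h1
    rw [hvsum]
    simp only [iterate_derivation_sum, map_sum, Algebra.smul_def,
      iterate_derivation_mul_of_eq_zero D (D.map_algebraMap _), map_mul, hevK]
    exact h1
  obtain ⟨N, hN0, hNdeg, w', hw'⟩ := exists_mul_eq_of hf hd (curveSum_mem_curveLE _ _ w) hv0
  obtain ⟨N', hN', hN'd⟩ := exists_eq_pow_rootMultiplicity_mul_and_not_dvd N hN0 x₀
  set e := N.rootMultiplicity x₀
  have he : e < p := (by
    simpa using natDegree_le_of_dvd (pow_rootMultiplicity_dvd N x₀) hN0 :
      e ≤ N.natDegree).trans_lt (hNdeg.trans_lt hp)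
  have h1 := map_iterate_derivation_mul_eq_zero D ev e w' hDv
  rw [hw', hN', map_mul, map_pow] at h1
  have h2 := dvd_iterate_derivation_pow_mul_sub D (AdjoinRoot.of f (X - C x₀)) e
    (AdjoinRoot.of f N')
  have h3 := _root_.map_dvd ev h2
  have hDw : D (AdjoinRoot.of f (X - C x₀)) = AdjoinRoot.mk f (derivative f) := by
    rw [hD, curveDerivation_of]
    simp
  rw [hDw, map_sub ev, h1, hev, eval_sub, eval_X, eval_C, sub_self, zero_dvd_iff,
    zero_sub, neg_eq_zero] at h3
  simp only [map_mul, map_pow, map_natCast, hev] at h3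
  refine mul_ne_zero (mul_ne_zero (natCast_factorial_ne_zero p he)
    (pow_ne_zero _ (right_ne_zero_of_mul hv))) ?_ h3
  intro h
  exact hN'd (dvd_iff_isRoot.2 h)

end Curve

section FrobeniusPoint

variable {p : ℕ} [Fact p.Prime]

theorem isCoprime_X_pow_card_sub_X {q : (ZMod p)[X]} (hq : ∀ a, q.eval a ≠ 0) :
    IsCoprime (X ^ p - X) q := by
  have h1 : (X ^ p - X : (ZMod p)[X]).Splits := by
    simpa using FiniteField.splits_X_pow_card_sub_X p (K := ZMod p)
  have h2 : (X ^ p - X : (ZMod p)[X]).Monic := by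
    refine (monic_X_pow p).sub_of_left ?_
    rw [degree_X_pow, degree_X]
    exact_mod_cast (Fact.out : p.Prime).one_lt
  rw [h1.eq_prod_roots_of_monic h2]
  generalize (X ^ p - X : (ZMod p)[X]).roots = s
  induction s using Multiset.induction with
  | empty => simpa using isCoprime_one_left
  | cons a s ih =>
    rw [Multiset.map_cons, Multiset.prod_cons]
    refine IsCoprime.mul_left ((irreducible_X_sub_C a).coprime_iff_not_dvd.2 fun h => ?_) ih
    exact hq a (dvd_iff_isRoot.1 h)

theorem isUnit_pow_char_sub_self {S : Type*} [CommRing S] [Algebra (ZMod p) S] {q : (ZMod p)[X]}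
    (hq : ∀ a, q.eval a ≠ 0) {η : S} (hη : aeval η q = 0) : IsUnit (η ^ p - η) := by
  have h := (isCoprime_X_pow_card_sub_X hq).map (aeval η).toRingHom
  simp only [AlgHom.toRingHom_eq_coe, RingHom.coe_coe, hη, isCoprime_zero_right] at h
  simpa using h

theorem aeval_pow_char_eq_zero {S : Type*} [CommRing S] [Algebra (ZMod p) S] {q : (ZMod p)[X]}
    {η : S} (hη : aeval η q = 0) : aeval (η ^ p) q = 0 := by
  rw [← expand_aeval, ZMod.expand_card, map_pow, hη, zero_pow (Fact.out : p.Prime).ne_zero]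

end FrobeniusPoint

section Curve

variable {K : Type*} [Field K]

/-- The quotient of `f` by `Y - y` over the coordinate ring of the curve `f = 0`. -/
noncomputable def curveQuotient (f : K[X][X]) : (AdjoinRoot f)[X] :=
  f.map (AdjoinRoot.of f) /ₘ (X - C (AdjoinRoot.root f))

variable {f : K[X][X]}

theorem mul_curveQuotient :
    (X - C (AdjoinRoot.root f)) * curveQuotient f = f.map (AdjoinRoot.of f) := by
  rw [curveQuotient, mul_divByMonic_eq_iff_isRoot, IsRoot.def, eval_map, AdjoinRoot.eval₂_root]

theorem monic_curveQuotient (hf : f.Monic) : (curveQuotient f).Monic := by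
  refine (monic_X_sub_C (AdjoinRoot.root f)).of_mul_monic_left ?_
  rw [mul_curveQuotient]
  exact hf.map _

theorem natDegree_curveQuotient (hf : f.Monic) [Nontrivial (AdjoinRoot f)] :
    (curveQuotient f).natDegree = f.natDegree - 1 := by
  rw [curveQuotient, natDegree_divByMonic _ (monic_X_sub_C _), natDegree_X_sub_C, hf.natDegree_map]

theorem coeff_curveQuotient_mem (hd : f ∈ totalDegreeLE K f.natDegree) (n : ℕ) :
    (curveQuotient f).coeff n ∈ curveLE f f.natDegree := by
  rw [curveQuotient, coeff_divByMonic_X_sub_C]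
  refine Submodule.sum_mem _ fun i _ => ?_
  rw [coeff_map]
  by_cases hi : i ≤ f.natDegree
  · have : AdjoinRoot.root f ^ (i - (n + 1)) * AdjoinRoot.of f (f.coeff i) =
        AdjoinRoot.mk f (C (f.coeff i) * X ^ (i - (n + 1))) := by
      rw [map_mul, map_pow, AdjoinRoot.mk_C, AdjoinRoot.mk_X, mul_comm]
    rw [this]
    refine mk_mem_curveLE fun a b hab => ?_
    rw [coeff_C_mul, coeff_X_pow]
    split_ifs with h
    · rw [mul_one]
      exact hd a i (by omega)
    · simp
  · rw [coeff_eq_zero_of_natDegree_lt (by omega), map_zero, mul_zero]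
    exact zero_mem _

theorem of_X_sub_C_dvd_eval_curveQuotient (p : ℕ) [Fact p.Prime] [Algebra (ZMod p) K]
    {f₀ : (ZMod p)[X][X]} (hf₀ : f = f₀.map (mapRingHom (algebraMap (ZMod p) K))) {x₀ : ZMod p}
    (hx₀ : ∀ y₀, (f₀.map (evalRingHom x₀)).eval y₀ ≠ 0) :
    AdjoinRoot.of f (X - C (algebraMap (ZMod p) K x₀)) ∣
      (curveQuotient f).eval (AdjoinRoot.root f ^ p) := by
  set w := AdjoinRoot.of f (X - C (algebraMap (ZMod p) K x₀)) with hw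
  rw [← Ideal.mem_span_singleton, ← Ideal.Quotient.eq_zero_iff_mem]
  let π := Ideal.Quotient.mk (Ideal.span {w})
  let φ : (ZMod p) →+* AdjoinRoot f ⧸ Ideal.span {w} :=
    (π.comp (AdjoinRoot.of f)).comp (C.comp (algebraMap (ZMod p) K))
  let _ : Algebra (ZMod p) (AdjoinRoot f ⧸ Ideal.span {w}) := φ.toAlgebra
  have hX : π (AdjoinRoot.of f X) = φ x₀ := by
    have : π w = 0 := Ideal.Quotient.eq_zero_iff_mem.2 (Ideal.mem_span_singleton_self w)
    refine sub_eq_zero.1 (Eq.trans ?_ this)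
    simp only [hw, map_sub]
    rfl
  have gen : ∀ (ψ : K[X] →+* AdjoinRoot f ⧸ Ideal.span {w}) (η : AdjoinRoot f ⧸ Ideal.span {w}),
      f.eval₂ ψ η = f₀.eval₂ (ψ.comp (mapRingHom (algebraMap (ZMod p) K))) η :=
    fun ψ η => (congrArg (eval₂ ψ η) hf₀).trans (eval₂_map _ _ _)
  have key : ∀ η : AdjoinRoot f, π ((f.map (AdjoinRoot.of f)).eval η) =
      aeval (π η) (f₀.map (evalRingHom x₀)) := by
    intro η
    rw [eval_map, hom_eval₂, aeval_def, eval₂_map, gen]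
    congr 1
    ext
    · exact RingHom.congr_fun (RingHom.ext_zmod _ _) _
    · simp only [RingHom.comp_apply, coe_mapRingHom, map_X, coe_evalRingHom, eval_X]
      exact hX
  have h0 : aeval (π (AdjoinRoot.root f)) (f₀.map (evalRingHom x₀)) = 0 := by
    rw [← key, eval_map, AdjoinRoot.eval₂_root, map_zero]
  have h1 := key (AdjoinRoot.root f ^ p)
  rw [map_pow, aeval_pow_char_eq_zero h0, ← mul_curveQuotient, eval_mul, map_mul] at h1
  have h2 := isUnit_pow_char_sub_self hx₀ h0
  simp only [eval_sub, eval_X, eval_C, map_sub, map_pow] at h1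
  exact h2.mul_right_eq_zero.1 h1

end Curve

section Stepanov

variable {K : Type*} [Field K] (f : K[X][X])

/-- The coefficient of `y ^ (p * l)` in the `s`-th derivative of `stepanovSum`, after replacing
`x ^ p` by `x`. -/
noncomputable def stepanovPart (A B s : ℕ) (l : Fin f.natDegree) :
    ((Fin f.natDegree × Fin A × Fin B) × Fin f.natDegree → K) →ₗ[K] AdjoinRoot f :=
  ∑ t : Fin f.natDegree × Fin A × Fin B, (LinearMap.proj (φ := fun _ => K) (t, l)).smulRight
    ((curveDerivation f)^[s] (AdjoinRoot.of f X ^ (t.2.1 : ℕ) * AdjoinRoot.root f ^ (t.1 : ℕ)) *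
      AdjoinRoot.of f X ^ (t.2.2 : ℕ))

theorem stepanovPart_apply (A B s : ℕ) (l : Fin f.natDegree)
    (c : (Fin f.natDegree × Fin A × Fin B) × Fin f.natDegree → K) :
    stepanovPart f A B s l c = ∑ t : Fin f.natDegree × Fin A × Fin B, c (t, l) •
      ((curveDerivation f)^[s] (AdjoinRoot.of f X ^ (t.2.1 : ℕ) * AdjoinRoot.root f ^ (t.1 : ℕ)) *
        AdjoinRoot.of f X ^ (t.2.2 : ℕ)) := by
  simp [stepanovPart]

/-- Stepanov's auxiliary function `∑ c x ^ i y ^ j x ^ (p * k) y ^ (p * l)`. -/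
noncomputable def stepanovSum (p A B : ℕ)
    (c : (Fin f.natDegree × Fin A × Fin B) × Fin f.natDegree → K) : AdjoinRoot f :=
  ∑ t : Fin f.natDegree × Fin A × Fin B, ∑ l : Fin f.natDegree, c (t, l) •
    ((AdjoinRoot.of f X ^ (t.2.2 : ℕ) * AdjoinRoot.root f ^ (l : ℕ)) ^ p *
      (AdjoinRoot.of f X ^ (t.2.1 : ℕ) * AdjoinRoot.root f ^ (t.1 : ℕ)))

variable {f}

theorem stepanovPart_mem_curveLE (hd : f ∈ totalDegreeLE K f.natDegree) (A B s : ℕ)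
    (l : Fin f.natDegree) (c : (Fin f.natDegree × Fin A × Fin B) × Fin f.natDegree → K) :
    stepanovPart f A B s l c ∈ curveLE f (A + f.natDegree + s * f.natDegree + B) := by
  rw [stepanovPart_apply]
  refine Submodule.sum_mem _ fun t _ => Submodule.smul_mem _ _ (mul_mem_curveLE ?_ ?_)
  · refine iterate_curveDerivation_mem_curveLE hd ?_ s
    exact curveLE_mono (by omega) (of_X_pow_mul_root_pow_mem_curveLE t.2.1 t.1)
  · have := of_X_pow_mul_root_pow_mem_curveLE (f := f) t.2.2 0
    rw [pow_zero, mul_one] at this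
    exact curveLE_mono (by omega) this

theorem exists_forall_stepanovPart_eq (hf : f.Monic) (hd : f ∈ totalDegreeLE K f.natDegree)
    [IsDomain (AdjoinRoot f)] (hd0 : 0 < f.natDegree) {m A B : ℕ}
    (h : m * (f.natDegree - 1) * (f.natDegree * (A + B + (m + 2) * f.natDegree + 1)) <
      f.natDegree * (A * B) * f.natDegree) :
    ∃ c : (Fin f.natDegree × Fin A × Fin B) × Fin f.natDegree → K, c ≠ 0 ∧
      ∀ s < m, ∀ l : Fin f.natDegree, stepanovPart f A B s l c =
        (curveQuotient f).coeff l * stepanovPart f A B s ⟨f.natDegree - 1, by omega⟩ c := by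
  set T := A + B + (m + 2) * f.natDegree with hT
  have := finite_curveLE hf hd T
  let Ψ : Fin m → Fin (f.natDegree - 1) →
      ((Fin f.natDegree × Fin A × Fin B) × Fin f.natDegree → K) →ₗ[K] AdjoinRoot f := fun s l =>
    stepanovPart f A B s ⟨l, by omega⟩ - LinearMap.mulLeft K ((curveQuotient f).coeff l) ∘ₗ
      stepanovPart f A B s ⟨f.natDegree - 1, by omega⟩
  have hΨ : ∀ s l c, Ψ s l c ∈ curveLE f T := by
    intro s l c
    have hle : A + f.natDegree + s * f.natDegree + B ≤ A + f.natDegree + m * f.natDegree + B := by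
      gcongr
      exact s.2.le
    refine sub_mem (curveLE_mono ?_ (stepanovPart_mem_curveLE hd A B s _ c))
      (curveLE_mono ?_ (mul_mem_curveLE (coeff_curveQuotient_mem hd l)
        (stepanovPart_mem_curveLE hd A B s _ c)))
    · rw [hT, add_mul]
      omega
    · rw [hT, add_mul]
      omega
  have hker := LinearMap.ker_ne_bot_of_finrank_lt
    (f := LinearMap.pi fun q : Fin m × Fin (f.natDegree - 1) =>
      LinearMap.codRestrict _ (Ψ q.1 q.2) (hΨ q.1 q.2)) (by
    rw [Module.finrank_pi_fintype, Module.finrank_fintype_fun_eq_card]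
    simp only [Finset.sum_const, Finset.card_univ, Fintype.card_prod, Fintype.card_fin, smul_eq_mul]
    exact (Nat.mul_le_mul_left _ (finrank_curveLE_le hf hd T)).trans_lt h)
  obtain ⟨c, hc, hc0⟩ := Submodule.exists_mem_ne_zero_of_ne_bot hker
  refine ⟨c, hc0, fun s hs l => ?_⟩
  rw [LinearMap.ker_pi, Submodule.mem_iInf] at hc
  rcases lt_or_ge (l : ℕ) (f.natDegree - 1) with hl | hl
  · have h1 := hc (⟨s, hs⟩, ⟨l, hl⟩)
    rw [LinearMap.ker_codRestrict, LinearMap.mem_ker] at h1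
    exact sub_eq_zero.1 h1
  · have hl' : l = ⟨f.natDegree - 1, by omega⟩ := Fin.ext (by dsimp only; omega)
    have := (monic_curveQuotient hf).coeff_natDegree
    rw [natDegree_curveQuotient hf] at this
    rw [hl', this, one_mul]

theorem stepanovSum_mem_curveLE (p A B : ℕ)
    (c : (Fin f.natDegree × Fin A × Fin B) × Fin f.natDegree → K) :
    stepanovSum f p A B c ∈ curveLE f (A + f.natDegree + p * (B + f.natDegree)) := by
  refine Submodule.sum_mem _ fun t _ => Submodule.sum_mem _ fun l _ => Submodule.smul_mem _ _ ?_
  have h1 := of_X_pow_mul_root_pow_mem_curveLE (f := f) (t.2.2 * p) (l * p)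
  have h2 := of_X_pow_mul_root_pow_mem_curveLE (f := f) t.2.1 t.1
  rw [mul_pow, ← pow_mul, ← pow_mul]
  refine curveLE_mono ?_ (mul_mem_curveLE h1 h2)
  have h3 : (t.2.2 : ℕ) * p ≤ B * p := by
    gcongr
    exact t.2.2.2.le
  have h4 : (l : ℕ) * p ≤ f.natDegree * p := by
    gcongr
    exact l.2.le
  rw [mul_comm p, add_mul]
  omega

theorem stepanovSum_ne_zero [IsAlgClosed K] (p : ℕ) [Fact p.Prime] [CharP K p]
    (hf : f.Monic) (hdK : (f.natDegree : K) ≠ 0)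
    (hd : f ∈ totalDegreeLE K f.natDegree) [IsDomain (AdjoinRoot f)] {A B : ℕ}
    (hp : f.natDegree * (A + f.natDegree + f.natDegree + 1) < p)
    {c : (Fin f.natDegree × Fin A × Fin B) × Fin f.natDegree → K} (hc : c ≠ 0) :
    stepanovSum f p A B c ≠ 0 := by
  have : CharP (AdjoinRoot f) p := charP_of_injective_algebraMap' K p
  choose γ hγ using fun t => IsAlgClosed.exists_pow_nat_eq (c t) (Fact.out : p.Prime).pos
  obtain ⟨⟨⟨j₀, i₀, k₀⟩, l₀⟩, h₀⟩ := Function.ne_iff.1 hc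
  let w : Fin f.natDegree → Fin A → Fin f.natDegree → degreeLT K B := fun j i l =>
    ⟨∑ k : Fin B, monomial (k : ℕ) (γ ((j, i, k), l)), mem_degreeLT.2 (degree_sum_monomial_fin_lt B _)⟩
  let u : Fin f.natDegree → Fin A → AdjoinRoot f := fun j i => curveSum f f.natDegree B (w j i)
  have hu : u ≠ 0 := by
    intro h
    have h1 : curveSum f f.natDegree B (w j₀ i₀) = 0 := congrFun (congrFun h j₀) i₀
    rw [← map_zero (curveSum f f.natDegree B)] at h1
    have h2 := congrFun (curveSum_injective hf _ h1) l₀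
    have h3 := congrArg (fun q : degreeLT K B => (q : K[X]).coeff k₀) h2
    simp only [w, coeff_sum_monomial_fin] at h3
    refine h₀ ?_
    rw [← hγ, show γ ((j₀, i₀, k₀), l₀) = 0 from h3, zero_pow (Fact.out : p.Prime).ne_zero]
    rfl
  have key := sum_pow_char_mul_ne_zero p hf hdK hd hp u hu
  convert key using 1
  rw [stepanovSum, Fintype.sum_prod_type]
  refine Finset.sum_congr rfl fun j _ => ?_
  rw [Fintype.sum_prod_type]
  refine Finset.sum_congr rfl fun i _ => ?_
  have h1 : u j i = ∑ l : Fin f.natDegree, ∑ k : Fin B, γ ((j, i, k), l) •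
      (AdjoinRoot.of f X ^ (k : ℕ) * AdjoinRoot.root f ^ (l : ℕ)) := by
    simp only [u]
    rw [curveSum_apply, map_sum]
    refine Finset.sum_congr rfl fun l _ => ?_
    rw [← C_mul_X_pow_eq_monomial, map_mul, map_pow, AdjoinRoot.mk_X, AdjoinRoot.mk_C, map_sum,
      Finset.sum_mul]
    refine Finset.sum_congr rfl fun k _ => ?_
    rw [← C_mul_X_pow_eq_monomial, Algebra.smul_def, ← mul_assoc, map_mul,
      map_pow (AdjoinRoot.of f) X]
    rfl
  rw [h1, sum_pow_char, Finset.sum_mul, Finset.sum_comm]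
  refine Finset.sum_congr rfl fun l _ => ?_
  rw [sum_pow_char, Finset.sum_mul]
  refine Finset.sum_congr rfl fun k _ => ?_
  rw [_root_.smul_pow, hγ, smul_mul_assoc]

theorem dvd_iterate_curveDerivation_stepanovSum_sub (p : ℕ) [Fact p.Prime] [CharP K p] {x₀ : K}
    (hx₀ : x₀ ^ p = x₀) (A B s : ℕ)
    (c : (Fin f.natDegree × Fin A × Fin B) × Fin f.natDegree → K) [IsDomain (AdjoinRoot f)] :
    AdjoinRoot.of f (X - C x₀) ∣ (curveDerivation f)^[s] (stepanovSum f p A B c) -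
      ∑ l : Fin f.natDegree, stepanovPart f A B s l c * (AdjoinRoot.root f ^ p) ^ (l : ℕ) := by
  have : CharP (AdjoinRoot f) p := charP_of_injective_algebraMap' K p
  have h1 : (curveDerivation f)^[s] (stepanovSum f p A B c) =
      ∑ l : Fin f.natDegree, ∑ t : Fin f.natDegree × Fin A × Fin B,
        c (t, l) • ((AdjoinRoot.of f X ^ (t.2.2 : ℕ) * AdjoinRoot.root f ^ (l : ℕ)) ^ p *
          (curveDerivation f)^[s]
            (AdjoinRoot.of f X ^ (t.2.1 : ℕ) * AdjoinRoot.root f ^ (t.1 : ℕ))) := by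
    rw [stepanovSum, Finset.sum_comm]
    simp only [iterate_derivation_sum, Algebra.smul_def,
      iterate_derivation_mul_of_eq_zero _ ((curveDerivation f).map_algebraMap _),
      iterate_derivation_mul_of_eq_zero _ (derivation_pow_char_eq_zero _ p _)]
  have h2 : AdjoinRoot.of f (X - C x₀) ∣ AdjoinRoot.of f X ^ p - AdjoinRoot.of f X := by
    rw [← map_pow, ← map_sub]
    refine _root_.map_dvd (AdjoinRoot.of f) (dvd_iff_isRoot.2 ?_)
    simp [hx₀]
  rw [h1, ← Finset.sum_sub_distrib]
  refine Finset.dvd_sum fun l _ => ?_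
  rw [stepanovPart_apply, Finset.sum_mul, ← Finset.sum_sub_distrib]
  refine Finset.dvd_sum fun t _ => ?_
  rw [smul_mul_assoc, ← smul_sub, Algebra.smul_def]
  refine Dvd.dvd.mul_left ?_ _
  have h3 := (h2.trans (sub_dvd_pow_sub_pow _ _ (t.2.2 : ℕ))).mul_right
    ((AdjoinRoot.root f ^ p) ^ (l : ℕ) * (curveDerivation f)^[s]
            (AdjoinRoot.of f X ^ (t.2.1 : ℕ) * AdjoinRoot.root f ^ (t.1 : ℕ)))
  convert h3 using 1
  rw [mul_pow, ← pow_mul, ← pow_mul, ← pow_mul, ← pow_mul, mul_comm p, mul_comm p]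
  ring

end Stepanov

section Stepanov

variable {K : Type*} [Field K]

theorem stepanov_parameter_lt {d : ℕ} (hd : 0 < d) :
    (d ^ 2 + d + 1) * (d - 1) *
        (d * (d ^ 3 * (d ^ 2 + (d ^ 2 + d + 1 + 2) * d + 1) + d ^ 2 + (d ^ 2 + d + 1 + 2) * d + 1)) <
      d * (d ^ 3 * (d ^ 2 + (d ^ 2 + d + 1 + 2) * d + 1) * d ^ 2) * d := by
  obtain ⟨e, rfl⟩ : ∃ e, d = e + 1 := ⟨d - 1, by omega⟩
  rw [Nat.add_sub_cancel]
  set d := e + 1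
  set Q := d ^ 2 + (d ^ 2 + d + 1 + 2) * d + 1 with hQ
  have h1 : (d ^ 2 + d + 1) * e + 1 = d ^ 3 := by
    simp only [d]
    ring
  have h2 : d ^ 3 * Q + d ^ 2 + (d ^ 2 + d + 1 + 2) * d + 1 = d ^ 3 * Q + Q := by
    rw [hQ]
    ring
  rw [h2]
  have h3 : (d ^ 2 + d + 1) * e * (d * (d ^ 3 * Q + Q)) =
      ((d ^ 2 + d + 1) * e) * ((d ^ 2 + d + 1) * e + 2) * (d * Q) := by
    rw [← h1]
    ring
  have h4 : d * (d ^ 3 * Q * d ^ 2) * d = ((d ^ 2 + d + 1) * e + 1) ^ 2 * (d * Q) := by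
    rw [h1]
    ring
  rw [h3, h4]
  have : 0 < d * Q := by positivity
  gcongr
  nlinarith

/-- A bound beyond which plane curves of degree `d` over `𝔽_p` have rational points. -/
def stepanovBound (d : ℕ) : ℕ :=
  let A := d ^ 3 * (d ^ 2 + (d ^ 2 + d + 1 + 2) * d + 1)
  d * (A + d + d + 1) + A + d + (d ^ 2 + d + 1) * (d * (d + d + 1)) + (d ^ 2 + d + 1)

theorem exists_eval_eq_zero_of_stepanovBound_lt [IsAlgClosed K] (p : ℕ) [Fact p.Prime]
    [Algebra (ZMod p) K] {f : K[X][X]} {f₀ : (ZMod p)[X][X]}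
    (hf₀ : f = f₀.map (mapRingHom (algebraMap (ZMod p) K))) (hf : f.Monic)
    (hd : f ∈ totalDegreeLE K f.natDegree) [IsDomain (AdjoinRoot f)] (hd0 : 0 < f.natDegree)
    (hp : stepanovBound f.natDegree < p) :
    ∃ x₀ y₀ : ZMod p, (f₀.map (evalRingHom x₀)).eval y₀ = 0 := by
  by_contra! hno
  have : CharP K p := charP_of_injective_algebraMap' (ZMod p) p
  set d := f.natDegree with hdd
  set B := d ^ 2 with hB
  set m := B + d + 1 with hm
  set A := d ^ 3 * (B + (m + 2) * d + 1) with hA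
  have hp' : d * (A + d + d + 1) + A + d + m * (d * (d + d + 1)) + m < p := hp
  have hmp : m < p := by omega
  have hdK : (d : K) ≠ 0 := by
    rw [Ne, CharP.cast_eq_zero_iff K p]
    exact fun h => absurd (Nat.le_of_dvd hd0 h) (by omega)
  obtain ⟨c, hc0, hc⟩ := exists_forall_stepanovPart_eq (m := m) (A := A) (B := B) hf hd hd0
    (stepanov_parameter_lt hd0)
  have hg0 := stepanovSum_ne_zero p hf hdK hd (A := A) (B := B)
    (show d * (A + d + d + 1) < p by omega) hc0
  obtain ⟨N, hN0, hNdeg, w, hw⟩ := exists_mul_eq_of hf hd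
    (mk_mem_curveLE (derivative_mem_totalDegreeLE hd)) (mk_derivative_ne_zero hf hdK)
  classical
  let α : ZMod p → K := algebraMap (ZMod p) K
  have hα : Function.Injective α := (algebraMap (ZMod p) K).injective
  let S : Finset (ZMod p) := Finset.univ.filter fun a => N.eval (α a) ≠ 0
  have hS : p ≤ S.card + d * (d + d + 1) := by
    have h1 : (Finset.univ.filter fun a => ¬ N.eval (α a) ≠ 0).card ≤ d * (d + d + 1) := by
      have hNdeg' : N.natDegree ≤ d * (d + d + 1) := hNdeg
      refine le_trans ?_ ((card_roots' N).trans hNdeg')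
      refine le_trans ?_ (Multiset.toFinset_card_le _)
      refine Finset.card_le_card_of_injOn α (fun a ha => ?_) hα.injOn
      simp only [ne_eq, not_not, Finset.coe_filter, Finset.mem_univ, true_and,
        Set.mem_ofPred_eq] at ha
      simp [hN0, ha]
    have h2 := Finset.card_filter_add_card_filter_not (s := (Finset.univ : Finset (ZMod p)))
      fun a => N.eval (α a) ≠ 0
    rw [Finset.card_univ, ZMod.card] at h2
    change S.card + _ = p at h2
    omega
  have hfac : ∀ e < m, IsUnit (e.factorial : AdjoinRoot f) := by
    intro e he
    have := (natCast_factorial_ne_zero (K := K) p (he.trans hmp)).isUnit.map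
      (algebraMap K (AdjoinRoot f))
    simpa using this
  have hdvd : ∀ a ∈ S, AdjoinRoot.of f (X - C (α a)) ^ m ∣ stepanovSum f p A B c := by
    intro a ha
    refine pow_dvd_of_forall_dvd_iterate_derivation (curveDerivation f) m ?_ hfac fun s hs => ?_
    · rw [curveDerivation_of]
      have h1 := (isCoprime_sub_of_of_eval_ne_zero N (Finset.mem_filter.1 ha).2).map
        (AdjoinRoot.of f)
      rw [← hw] at h1
      simpa using h1.of_mul_right_left
    · refine (dvd_sub_comm.trans (dvd_sub_right ?_)).1
        (dvd_iterate_curveDerivation_stepanovSum_sub p (x₀ := α a) ?_ A B s c)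
      · have h1 := of_X_sub_C_dvd_eval_curveQuotient p hf₀ (hno a)
        have h2 : (curveQuotient f).natDegree < f.natDegree := by
          rw [natDegree_curveQuotient hf]
          omega
        rw [eval_eq_sum_range' h2, ← Fin.sum_univ_eq_sum_range
          (fun l => (curveQuotient f).coeff l * (AdjoinRoot.root f ^ p) ^ l)] at h1
        refine (h1.mul_right (stepanovPart f A B s ⟨d - 1, by omega⟩ c)).trans (dvd_of_eq ?_)
        rw [Finset.sum_mul]
        refine Finset.sum_congr rfl fun l _ => ?_
        rw [hc s hs l]
        ring
      · rw [← map_pow, ZMod.pow_card]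
  have hW : AdjoinRoot.of f (∏ a ∈ S, (X - C (α a)) ^ m) ∣ stepanovSum f p A B c := by
    rw [map_prod]
    refine Finset.prod_dvd_of_coprime (fun a _ b _ hab => ?_) fun a ha => ?_
    · exact ((isCoprime_X_sub_C_of_isUnit_sub
        (sub_ne_zero.2 (hα.ne hab)).isUnit).pow).map (AdjoinRoot.of f)
    · rw [map_pow]
      exact hdvd a ha
  refine hg0 (eq_zero_of_of_dvd_of_mem_curveLE hf hd (stepanovSum_mem_curveLE p A B c) ?_ hW)
  rw [natDegree_prod_of_monic _ _ fun a _ => (monic_X_sub_C _).pow m]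
  simp only [natDegree_pow, natDegree_X_sub_C, mul_one, Finset.sum_const, smul_eq_mul]
  rw [← hdd]
  nlinarith

end Stepanov

end Polynomial

namespace MvPolynomial

/-- The partial derivatives of `F` have no common zero other than the origin. -/
def IsNonsingular {σ K : Type*} [CommRing K] (F : MvPolynomial σ K) : Prop :=
  ∀ x : σ → K, (∀ i, eval x (pderiv i F) = 0) → x = 0

theorem IsHomogeneous.eval_mul {σ R : Type*} [CommRing R] {F : MvPolynomial σ R} {d : ℕ}
    (hF : F.IsHomogeneous d) (c : R) (x : σ → R) :
    eval (fun i => c * x i) F = c ^ d * eval x F := by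
  rw [eval_eq, eval_eq, Finset.mul_sum]
  refine Finset.sum_congr rfl fun m hm => ?_
  rw [hF.degree_eq_sum_deg_support hm, ← Finset.prod_pow_eq_pow_sum, mul_left_comm,
    ← Finset.prod_mul_distrib]
  simp only [mul_pow]

theorem IsHomogeneous.eval_zero_eq_zero {σ R : Type*} [CommRing R] {F : MvPolynomial σ R} {d : ℕ}
    (hF : F.IsHomogeneous d) (hd : d ≠ 0) : eval 0 F = 0 := by
  have := hF.eval_mul 0 0
  rw [zero_pow hd, zero_mul] at this
  rw [← this]
  congr
  ext
  simp

theorem homogeneousComponent_add_mul {σ R : Type*} [CommRing R] {G H : MvPolynomial σ R}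
    {a b : ℕ} (hG : G.totalDegree ≤ a) (hH : H.totalDegree ≤ b) :
    homogeneousComponent (a + b) (G * H) = homogeneousComponent a G * homogeneousComponent b H := by
  classical
  ext m
  by_cases hm : m.degree = a + b
  · rw [coeff_homogeneousComponent, if_pos hm, coeff_mul, coeff_mul]
    refine Finset.sum_congr rfl fun t ht => ?_
    rw [Finset.HasAntidiagonal.mem_antidiagonal] at ht
    have hdeg : t.1.degree + t.2.degree = a + b := by rw [← map_add, ht, hm]
    rw [coeff_homogeneousComponent, coeff_homogeneousComponent]
    have hlt : ∀ {P : MvPolynomial σ R} {n : ℕ} (u : σ →₀ ℕ), P.totalDegree ≤ n → n < u.degree →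
        coeff u P = 0 := fun u h1 h2 => coeff_eq_zero_of_totalDegree_lt (h1.trans_lt h2)
    rcases lt_trichotomy t.1.degree a with h | h | h
    · rw [hlt t.2 hH (by omega), mul_zero, if_neg h.ne, zero_mul]
    · rw [if_pos h, if_pos (by omega)]
    · rw [hlt t.1 hG h, zero_mul, if_neg h.ne', zero_mul]
  · rw [coeff_homogeneousComponent, if_neg hm]
    have h := (homogeneousComponent_isHomogeneous a G).mul (homogeneousComponent_isHomogeneous b H)
    refine (h.coeff_eq_zero ?_).symm
    exact hm

section Field

variable {K : Type*} [Field K]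

theorem three_le_height_vanishingIdeal_zero :
    3 ≤ (vanishingIdeal K ({0} : Set (Fin 3 → K))).height := by
  let ψ : (Fin 3 → MvPolynomial (Fin 3) K) → (MvPolynomial (Fin 3) K →ₐ[K] MvPolynomial (Fin 3) K) :=
    aeval
  let P₁ := RingHom.ker (ψ ![0, X 1, X 2])
  let P₂ := RingHom.ker (ψ ![0, 0, X 2])
  let P₃ := RingHom.ker (ψ ![0, 0, 0])
  have : P₁.IsPrime := RingHom.ker_isPrime _
  have : P₂.IsPrime := RingHom.ker_isPrime _
  have : P₃.IsPrime := RingHom.ker_isPrime _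
  have hP₃ : vanishingIdeal K ({0} : Set (Fin 3 → K)) = P₃ := by
    ext q
    rw [mem_vanishingIdeal_singleton_iff, RingHom.mem_ker]
    have : ψ ![0, 0, 0] q = C (aeval 0 q) := by
      have : ψ ![0, 0, 0] = (Algebra.ofId K (MvPolynomial (Fin 3) K)).comp (aeval (0 : Fin 3 → K)) := by
        ext i
        fin_cases i <;> simp [ψ]
      rw [this]
      rfl
    rw [this, C_eq_zero]
  have h01 : (⊥ : Ideal (MvPolynomial (Fin 3) K)) < P₁ := by
    refine bot_lt_iff_ne_bot.2 fun h => X_ne_zero (R := K) (0 : Fin 3) ?_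
    rw [← Ideal.mem_bot, ← h, RingHom.mem_ker]
    simp [ψ]
  have h12 : P₁ < P₂ := by
    refine lt_of_le_of_ne (fun q hq => ?_) fun h => ?_
    · rw [RingHom.mem_ker] at hq ⊢
      have : ψ ![0, 0, X 2] = (ψ ![0, 0, X 2]).comp (ψ ![0, X 1, X 2]) := by
        ext i
        fin_cases i <;> simp [ψ]
      rw [this, AlgHom.comp_apply, hq, map_zero]
    · have h1 : (X 1 : MvPolynomial (Fin 3) K) ∈ P₂ := by
        rw [RingHom.mem_ker]
        simp [ψ]
      rw [← h, RingHom.mem_ker] at h1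
      simp [ψ] at h1
  have h23 : P₂ < P₃ := by
    refine lt_of_le_of_ne (fun q hq => ?_) fun h => ?_
    · rw [RingHom.mem_ker] at hq ⊢
      have : ψ ![0, 0, 0] = (ψ ![0, 0, 0]).comp (ψ ![0, 0, X 2]) := by
        ext i
        fin_cases i <;> simp [ψ]
      rw [this, AlgHom.comp_apply, hq, map_zero]
    · have h1 : (X 2 : MvPolynomial (Fin 3) K) ∈ P₃ := by
        rw [RingHom.mem_ker]
        simp [ψ]
      rw [← h, RingHom.mem_ker] at h1
      simp [ψ] at h1
  have a1 := Order.add_one_le_of_lt (Ideal.height_strict_mono_of_isPrime_of_isPrime h01)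
  have a2 := Order.add_one_le_of_lt (Ideal.height_strict_mono_of_isPrime_of_isPrime h12)
  have a3 := Order.add_one_le_of_lt (Ideal.height_strict_mono_of_isPrime_of_isPrime h23)
  rw [hP₃]
  calc (3 : ℕ∞) = 0 + 1 + 1 + 1 := by norm_num
    _ ≤ (⊥ : Ideal (MvPolynomial (Fin 3) K)).height + 1 + 1 + 1 := by gcongr; exact zero_le
    _ ≤ P₁.height + 1 + 1 := by gcongr
    _ ≤ P₂.height + 1 := by gcongr
    _ ≤ P₃.height := a3

variable [IsAlgClosed K]

theorem exists_ne_zero_common_zero {G H : MvPolynomial (Fin 3) K} (hG : eval 0 G = 0)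
    (hH : eval 0 H = 0) : ∃ x ≠ 0, eval x G = 0 ∧ eval x H = 0 := by
  classical
  by_contra! h
  let P₃ := vanishingIdeal K ({0} : Set (Fin 3 → K))
  have hle : Ideal.span {G, H} ≤ P₃ := by
    rw [Ideal.span_le, Set.pair_subset_iff]
    exact ⟨(mem_vanishingIdeal_singleton_iff _ _).2 hG, (mem_vanishingIdeal_singleton_iff _ _).2 hH⟩
  have : P₃.IsPrime := (isMaximal_iff_eq_vanishingIdeal_singleton.2 ⟨0, rfl⟩).isPrime
  obtain ⟨P, hP, hPP⟩ := Ideal.exists_minimalPrimes_le hle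
  have hPprime : P.IsPrime := hP.1.1
  have hP3 : P₃ ≤ P := by
    rw [← IsPrime.vanishingIdeal_zeroLocus (K := K) P]
    refine vanishingIdeal_anti_mono fun x hx => ?_
    by_contra hx0
    refine h x hx0 ?_ ?_
    · exact hx _ (hP.1.2 (Ideal.subset_span (by simp)))
    · exact hx _ (hP.1.2 (Ideal.subset_span (by simp)))
  have h2 := Ideal.height_le_card_of_mem_minimalPrimes_span (Set.toFinite _) hP
  have h3 := (three_le_height_vanishingIdeal_zero (K := K)).trans ((Ideal.height_mono hP3).trans h2)
  have h4 : ({G, H} : Set (MvPolynomial (Fin 3) K)).ncard ≤ 2 :=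
    (Set.ncard_insert_le G {H}).trans (by simp)
  have h5 : 3 ≤ ({G, H} : Set (MvPolynomial (Fin 3) K)).ncard := by exact_mod_cast h3
  omega

theorem IsNonsingular.irreducible {F : MvPolynomial (Fin 3) K} {d : ℕ} (hd : d ≠ 0)
    (hF : F.IsHomogeneous d) (hs : F.IsNonsingular) : Irreducible F := by
  have hF0 : F ≠ 0 := by
    rintro rfl
    exact one_ne_zero (hs 1 (by simp))
  refine ⟨fun hu => ?_, fun G H hGH => ?_⟩
  · have := hu.map (eval (0 : Fin 3 → K))
    rw [hF.eval_zero_eq_zero hd] at this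
    exact not_isUnit_zero this
  by_contra! hu
  have hne : G ≠ 0 ∧ H ≠ 0 := mul_ne_zero_iff.1 (hGH ▸ hF0)
  have htop := homogeneousComponent_add_mul (G := G) (H := H) le_rfl le_rfl
  have hdeg : d = G.totalDegree + H.totalDegree := by
    rw [← totalDegree_mul_of_isDomain hne.1 hne.2, ← hGH, hF.totalDegree hF0]
  have hpos : ∀ {P : MvPolynomial (Fin 3) K}, P ≠ 0 → ¬ IsUnit P → P.totalDegree ≠ 0 := by
    intro P hP0 hP h
    rw [totalDegree_eq_zero_iff_eq_C] at h
    rw [h] at hP hP0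
    refine hP (IsUnit.map C (isUnit_iff_ne_zero.2 fun h0 => hP0 (by rw [h0, map_zero])))
  rw [← hdeg, ← hGH, homogeneousComponent_eq_self hF] at htop
  obtain ⟨x, hx0, hxG, hxH⟩ := exists_ne_zero_common_zero
    ((homogeneousComponent_isHomogeneous G.totalDegree G).eval_zero_eq_zero (hpos hne.1 hu.1))
    ((homogeneousComponent_isHomogeneous H.totalDegree H).eval_zero_eq_zero (hpos hne.2 hu.2))
  refine hx0 (hs x fun i => ?_)
  rw [htop, pderiv_mul, map_add, map_mul, map_mul, hxG, hxH, mul_zero, zero_mul, add_zero]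

end Field

section CommRing

variable {R : Type*} [CommRing R]

/-- Dehomogenization of a ternary form with respect to its first variable. -/
noncomputable def dehomogenize (R : Type*) [CommRing R] :
    MvPolynomial (Fin 3) R →ₐ[R] Polynomial (Polynomial R) :=
  aeval ![1, Polynomial.C Polynomial.X, Polynomial.X]

theorem dehomogenize_X (i : Fin 3) :
    dehomogenize R (X i) = ![1, Polynomial.C Polynomial.X, Polynomial.X] i :=
  aeval_X _ _

theorem dehomogenize_C (c : R) : dehomogenize R (C c) = Polynomial.C (Polynomial.C c) :=
  aeval_C _ _

theorem dehomogenize_map {S : Type*} [CommRing S] (φ : R →+* S) (F : MvPolynomial (Fin 3) R) :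
    dehomogenize S (map φ F) =
      (dehomogenize R F).map (Polynomial.mapRingHom φ) := by
  induction F using MvPolynomial.induction_on with
  | C a => simp
  | add p q hp hq => simp [hp, hq]
  | mul_X p i hp =>
    rw [map_mul, map_mul, hp, map_mul, Polynomial.map_mul, map_X, dehomogenize_X, dehomogenize_X]
    fin_cases i <;> simp

theorem evalEval_dehomogenize (a b : R) (F : MvPolynomial (Fin 3) R) :
    (dehomogenize R F).evalEval a b = eval ![1, a, b] F := by
  induction F using MvPolynomial.induction_on with
  | C c => simp [Polynomial.evalEval]
  | add p q hp hq => simp [hp, hq, Polynomial.evalEval_add]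
  | mul_X p i hp =>
    rw [map_mul, map_mul, Polynomial.evalEval_mul, hp, dehomogenize_X, eval_X]
    fin_cases i <;> simp [Polynomial.evalEval]

theorem dehomogenize_monomial (m : Fin 3 →₀ ℕ) (c : R) :
    dehomogenize R (monomial m c) = Polynomial.monomial (m 2) (Polynomial.monomial (m 1) c) := by
  rw [monomial_eq, map_mul, dehomogenize_C, Finsupp.prod_fintype _ _ (by simp), map_prod]
  simp only [map_pow, dehomogenize_X, Fin.prod_univ_three]
  simp [← Polynomial.C_mul_X_pow_eq_monomial, mul_assoc]

theorem coeff_coeff_dehomogenize_monomial (m : Fin 3 →₀ ℕ) (c : R) (i j : ℕ) :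
    ((dehomogenize R (monomial m c)).coeff j).coeff i = if m 1 = i ∧ m 2 = j then c else 0 := by
  rw [dehomogenize_monomial, Polynomial.coeff_monomial]
  by_cases h : m 2 = j
  · simp [h, Polynomial.coeff_monomial]
  · simp [h]

variable {F : MvPolynomial (Fin 3) R} {d : ℕ}

theorem IsHomogeneous.add_add_of_mem_support (hF : F.IsHomogeneous d) {m : Fin 3 →₀ ℕ}
    (hm : m ∈ F.support) : m 0 + m 1 + m 2 = d := by
  have := hF.degree_eq_sum_deg_support hm
  rw [← Finsupp.degree_apply, Finsupp.degree_eq_sum, Fin.sum_univ_three] at this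
  exact this.symm

theorem IsHomogeneous.coeff_coeff_dehomogenize (hF : F.IsHomogeneous d) {i j : ℕ} (h : d < i + j) :
    ((dehomogenize R F).coeff j).coeff i = 0 := by
  rw [F.as_sum, map_sum, Polynomial.finsetSum_coeff, Polynomial.finsetSum_coeff]
  refine Finset.sum_eq_zero fun m hm => ?_
  rw [coeff_coeff_dehomogenize_monomial, if_neg]
  have := hF.add_add_of_mem_support hm
  omega

theorem IsHomogeneous.coeff_dehomogenize_self (hF : F.IsHomogeneous d) :
    (dehomogenize R F).coeff d = Polynomial.C (eval ![0, 0, 1] F) := by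
  ext i
  rcases i with _ | i
  · rw [Polynomial.coeff_C_zero]
    conv_lhs => rw [F.as_sum]
    rw [map_sum, Polynomial.finsetSum_coeff, Polynomial.finsetSum_coeff, eval_eq']
    refine Finset.sum_congr rfl fun m hm => ?_
    rw [coeff_coeff_dehomogenize_monomial, Fin.prod_univ_three]
    have := hF.add_add_of_mem_support hm
    split_ifs with h
    · have h0 : m 0 = 0 := by omega
      simp [h0, h.1]
    · have h0 : m 0 ≠ 0 ∨ m 1 ≠ 0 := by omega
      rcases h0 with h0 | h0 <;> simp [h0]
  · rw [hF.coeff_coeff_dehomogenize (by omega), Polynomial.coeff_C_succ]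

theorem exists_dehomogenize_eq (g : Polynomial (Polynomial R)) :
    ∃ (N : ℕ) (G : MvPolynomial (Fin 3) R), G.IsHomogeneous N ∧ dehomogenize R G = g := by
  have hadd : ∀ g h : Polynomial (Polynomial R),
      (∃ (N : ℕ) (G : MvPolynomial (Fin 3) R), G.IsHomogeneous N ∧ dehomogenize R G = g) →
      (∃ (N : ℕ) (G : MvPolynomial (Fin 3) R), G.IsHomogeneous N ∧ dehomogenize R G = h) →
      ∃ (N : ℕ) (G : MvPolynomial (Fin 3) R), G.IsHomogeneous N ∧ dehomogenize R G = g + h := by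
    rintro _ _ ⟨N, G, hG, rfl⟩ ⟨M, H, hH, rfl⟩
    refine ⟨N + M, X 0 ^ M * G + X 0 ^ N * H, ?_, ?_⟩
    · refine IsHomogeneous.add ?_ ?_
      · rw [add_comm]
        exact (isHomogeneous_X_pow 0 M).mul hG
      · exact (isHomogeneous_X_pow 0 N).mul hH
    · simp [dehomogenize_X]
  induction g using Polynomial.induction_on' with
  | add g h hg hh => exact hadd g h hg hh
  | monomial j q =>
    induction q using Polynomial.induction_on' with
    | add g h hg hh =>
      rw [map_add]
      exact hadd _ _ hg hh
    | monomial i c =>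
      refine ⟨i + j, C c * (X 1 ^ i * X 2 ^ j), ?_, ?_⟩
      · rw [← zero_add (i + j)]
        exact (isHomogeneous_C _ c).mul ((isHomogeneous_X_pow 1 i).mul (isHomogeneous_X_pow 2 j))
      · simp [dehomogenize_X, ← Polynomial.C_mul_X_pow_eq_monomial, mul_assoc]

end CommRing

section Field

variable {K : Type*} [Field K] {F : MvPolynomial (Fin 3) K} {d : ℕ}

theorem IsHomogeneous.eval_eq_pow_mul_evalEval (hF : F.IsHomogeneous d) {x : Fin 3 → K}
    (hx : x 0 ≠ 0) :
    eval x F = x 0 ^ d * (dehomogenize K F).evalEval (x 1 / x 0) (x 2 / x 0) := by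
  rw [evalEval_dehomogenize, ← hF.eval_mul]
  congr 2
  ext i
  fin_cases i <;> simp [mul_div_cancel₀, hx]

theorem IsHomogeneous.eq_of_dehomogenize_eq [Infinite K] {G : MvPolynomial (Fin 3) K}
    (hF : F.IsHomogeneous d) (hG : G.IsHomogeneous d)
    (h : dehomogenize K F = dehomogenize K G) : F = G := by
  refine mul_left_cancel₀ (X_ne_zero (0 : Fin 3)) (MvPolynomial.funext fun x => ?_)
  rw [map_mul, map_mul, eval_X]
  by_cases hx : x 0 = 0
  · rw [hx, zero_mul, zero_mul]
  · rw [hF.eval_eq_pow_mul_evalEval hx, hG.eval_eq_pow_mul_evalEval hx, h]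

theorem IsHomogeneous.irreducible_dehomogenize [Infinite K] (hF : F.IsHomogeneous d)
    (hirr : Irreducible F) (hu : ¬ IsUnit (dehomogenize K F)) :
    Irreducible (dehomogenize K F) := by
  have hF0 : dehomogenize K F ≠ 0 := fun h =>
    hirr.ne_zero (hF.eq_of_dehomogenize_eq (isHomogeneous_zero _ _ d) (by rw [h, map_zero]))
  refine ⟨hu, fun g h hgh => ?_⟩
  obtain ⟨N, G, hG, rfl⟩ := exists_dehomogenize_eq g
  obtain ⟨M, H, hH, rfl⟩ := exists_dehomogenize_eq h
  have key : X 0 ^ d * (G * H) = X 0 ^ (N + M) * F := by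
    refine IsHomogeneous.eq_of_dehomogenize_eq (d := d + (N + M))
      ((isHomogeneous_X_pow 0 d).mul (hG.mul hH)) ?_ ?_
    · rw [add_comm d]
      exact (isHomogeneous_X_pow 0 (N + M)).mul hF
    · simp [dehomogenize_X, hgh]
  have hprime : Prime F := irreducible_iff_prime.1 hirr
  have hcase : ∀ {P Q : MvPolynomial (Fin 3) K},
      dehomogenize K F = dehomogenize K P * dehomogenize K Q → F ∣ P →
      IsUnit (dehomogenize K Q) := by
    rintro P Q hPQ ⟨T, rfl⟩
    rw [map_mul, mul_assoc] at hPQ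
    exact IsUnit.of_mul_eq_one_right _ (mul_left_cancel₀ hF0 (hPQ.symm.trans (mul_one _).symm))
  rcases hprime.dvd_or_dvd (Dvd.intro_left _ key.symm) with h | h
  · have := map_dvd (dehomogenize K) (hprime.dvd_of_dvd_pow h)
    rw [dehomogenize_X] at this
    exact absurd (isUnit_of_dvd_one this) hu
  rcases hprime.dvd_or_dvd h with h | h
  · exact Or.inr (hcase hgh h)
  · exact Or.inl (hcase (hgh.trans (mul_comm _ _)) h)

theorem IsHomogeneous.monic_dehomogenize (hF : F.IsHomogeneous d) (h1 : eval ![0, 0, 1] F = 1) :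
    (dehomogenize K F).Monic ∧ (dehomogenize K F).natDegree = d := by
  have hc := hF.coeff_dehomogenize_self
  rw [h1, map_one] at hc
  have hdeg : (dehomogenize K F).natDegree ≤ d := by
    rw [Polynomial.natDegree_le_iff_coeff_eq_zero]
    intro j hj
    ext i
    exact hF.coeff_coeff_dehomogenize (by omega)
  exact ⟨Polynomial.monic_of_natDegree_le_of_coeff_eq_one d hdeg hc,
    le_antisymm hdeg (Polynomial.le_natDegree_of_ne_zero (by simp [hc]))⟩

end Field

theorem exists_ne_zero_eval_eq_zero_of_stepanovBound_lt {p d : ℕ} [Fact p.Prime] (hd : 0 < d)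
    (hp : Polynomial.stepanovBound d < p) {F : MvPolynomial (Fin 3) (ZMod p)}
    (hF : F.IsHomogeneous d)
    (hs : (map (algebraMap (ZMod p) (AlgebraicClosure (ZMod p))) F).IsNonsingular) :
    ∃ x ≠ 0, eval x F = 0 := by
  by_cases h0 : eval ![0, 0, 1] F = 0
  · exact ⟨_, fun h => one_ne_zero (α := ZMod p) (congrFun h 2), h0⟩
  let φ := algebraMap (ZMod p) (AlgebraicClosure (ZMod p))
  let a := (eval ![0, 0, 1] F)⁻¹
  let G := C a * F
  have ha : a ≠ 0 := inv_ne_zero h0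
  have hG : G.IsHomogeneous d := by
    rw [← zero_add d]
    exact (isHomogeneous_C _ a).mul hF
  have hG' : (map φ G).IsHomogeneous d := hG.map φ
  have hGs : (map φ G).IsNonsingular := by
    refine fun x hx => hs x fun i => ?_
    have := hx i
    simp only [G, map_mul, map_C, pderiv_C_mul, eval_C] at this
    exact (mul_eq_zero.1 this).resolve_left (by simpa using ha)
  have hG1 : eval ![0, 0, 1] (map φ G) = 1 := by
    have : (![0, 0, 1] : Fin 3 → AlgebraicClosure (ZMod p)) = φ ∘ ![0, 0, 1] := by
      ext i
      fin_cases i <;> simp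
    rw [this, eval_map, ← eval₂_comp]
    simp [G, a, h0]
  obtain ⟨hm, hdeg⟩ := hG'.monic_dehomogenize hG1
  have hirr := hG'.irreducible_dehomogenize (hGs.irreducible hd.ne' hG')
    (fun h => by rw [hm.eq_one_of_isUnit h, Polynomial.natDegree_one] at hdeg; omega)
  have := AdjoinRoot.isDomain_of_prime hirr.prime
  obtain ⟨x₀, y₀, h⟩ := Polynomial.exists_eval_eq_zero_of_stepanovBound_lt p
    (dehomogenize_map φ G) hm
    (by
      rw [hdeg]
      exact fun i j h => hG'.coeff_coeff_dehomogenize h)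
    (by omega) (by rwa [hdeg])
  refine ⟨![1, x₀, y₀], fun h => one_ne_zero (α := ZMod p) (congrFun h 0), ?_⟩
  have h2 : eval ![1, x₀, y₀] G = 0 := by
    rw [← evalEval_dehomogenize, ← h, Polynomial.map_evalRingHom_eval]
  rw [map_mul, eval_C] at h2
  exact (mul_eq_zero.1 h2).resolve_left ha

theorem IsNonsingular.exists_C_mul_X_pow_mem {σ : Type*} [Finite σ] {F : MvPolynomial σ ℤ}
    (hs : (map (Int.castRingHom ℂ) F).IsNonsingular) (i : σ) :
    ∃ D : ℤ, D ≠ 0 ∧ ∃ N : ℕ, C D * X i ^ N ∈ Ideal.span (Set.range fun j => pderiv j F) := by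
  let _ : Algebra (MvPolynomial σ ℤ) (MvPolynomial σ ℚ) := algebraMvPolynomial
  let I := Ideal.span (Set.range fun j => pderiv j F)
  have hX : (X i : MvPolynomial σ ℚ) ∈ (I.map (algebraMap _ (MvPolynomial σ ℚ))).radical := by
    rw [← vanishingIdeal_zeroLocus_eq_radical (K := ℂ), mem_vanishingIdeal_iff]
    intro x hx
    have hx0 : x = 0 := by
      refine hs x fun j => ?_
      have := mem_zeroLocus_iff.1 hx _
        (Ideal.mem_map_of_mem _ (Ideal.subset_span (Set.mem_range_self j)))
      rw [algebraMap_def, aeval_def, eval₂_map] at this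
      rw [pderiv_map, eval_map, ← this]
      congr 1
    rw [aeval_X, hx0, Pi.zero_apply]
  obtain ⟨N, hN⟩ := hX
  rw [IsLocalization.mem_map_algebraMap_iff ((nonZeroDivisors ℤ).map C)] at hN
  obtain ⟨⟨⟨G, hG⟩, ⟨_, D, hD, rfl⟩⟩, h⟩ := hN
  refine ⟨D, nonZeroDivisors.ne_zero hD, N, ?_⟩
  have h2 : C D * X i ^ N = G := by
    refine map_injective (algebraMap ℤ ℚ) (FaithfulSMul.algebraMap_injective ℤ ℚ) ?_
    simp only [algebraMap_def] at h
    rw [← h, mul_comm, map_mul, map_pow, map_X]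
  rwa [h2]

theorem IsNonsingular.exists_forall_charP {n : ℕ} {F : MvPolynomial (Fin n) ℤ}
    (hs : (map (Int.castRingHom ℂ) F).IsNonsingular) :
    ∃ M : ℕ, ∀ p : ℕ, M < p → ∀ (K : Type) [Field K] [CharP K p],
      (map (Int.castRingHom K) F).IsNonsingular := by
  choose D hD N hN using hs.exists_C_mul_X_pow_mem
  refine ⟨∏ i, (D i).natAbs, fun p hp K _ _ x hx => _root_.funext fun i => ?_⟩
  have hDp : (D i : K) ≠ 0 := by
    rw [Ne, CharP.intCast_eq_zero_iff K p, Int.natCast_dvd]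
    have h0 : ∀ j, 0 < (D j).natAbs := fun j => Int.natAbs_pos.2 (hD j)
    refine fun h => hp.not_ge ((Nat.le_of_dvd (h0 i) h).trans ?_)
    exact Nat.le_of_dvd (Finset.prod_pos fun j _ => h0 j) (Finset.dvd_prod_of_mem _ (Finset.mem_univ i))
  have h1 : Ideal.span (Set.range fun j => pderiv j F) ≤
      RingHom.ker (eval₂Hom (Int.castRingHom K) x) := by
    rw [Ideal.span_le]
    rintro _ ⟨j, rfl⟩
    have := hx j
    rwa [pderiv_map, eval_map] at this
  have h2 := h1 (hN i)
  rw [RingHom.mem_ker, map_mul, map_pow, coe_eval₂Hom, eval₂_C, eval₂_X, eq_intCast] at h2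
  exact eq_zero_of_pow_eq_zero ((mul_eq_zero.1 h2).resolve_left hDp)

theorem derivative_aeval_of_derivative_eq_single {σ R S : Type*} [CommRing R] [CommRing S]
    [Algebra R S] [DecidableEq σ] {i : σ} {g : σ → Polynomial S}
    (hg : ∀ j, Polynomial.derivative (g j) = (Pi.single i 1 : σ → Polynomial S) j)
    (F : MvPolynomial σ R) :
    Polynomial.derivative (aeval g F) = aeval g (pderiv i F) := by
  induction F using MvPolynomial.induction_on with
  | C a => simp [IsScalarTower.algebraMap_apply R S (Polynomial S)]
  | add p q hp hq => simp [hp, hq]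
  | mul_X p j hp =>
    rw [map_mul, Polynomial.derivative_mul, hp, pderiv_mul, map_add, map_mul, map_mul, aeval_X,
      hg, pderiv_X, Pi.single_apply, Pi.single_apply]
    split_ifs <;> simp

variable {p : ℕ} [Fact p.Prime] {σ : Type*} {F : MvPolynomial σ ℤ}

theorem exists_aeval_padicInt_eq {P : σ → ℤ} {i : σ} (h0 : (p : ℤ) ∣ eval P F)
    (h1 : ¬ (p : ℤ) ∣ eval P (pderiv i F)) {c : ℤ_[p]} (hc : ‖c‖ < 1) :
    ∃ z : σ → ℤ_[p], aeval z F = c := by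
  classical
  let g : σ → Polynomial ℤ_[p] := fun j =>
    Polynomial.C (P j : ℤ_[p]) + (Pi.single i Polynomial.X : σ → Polynomial ℤ_[p]) j
  have hg : ∀ (a : ℤ_[p]) (G : MvPolynomial σ ℤ), (aeval g G).eval a =
      aeval (fun j => (P j : ℤ_[p]) + (Pi.single i a : σ → ℤ_[p]) j) G := by
    intro a G
    rw [← Polynomial.coe_evalRingHom, aeval_def, aeval_def, hom_eval₂]
    congr 1
    · exact RingHom.ext_int _ _
    · ext j
      simp only [g, Pi.single_apply]
      split_ifs <;> simp
  have hint : ∀ G : MvPolynomial σ ℤ, (aeval g G).eval 0 = (eval P G : ℤ_[p]) := by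
    intro G
    rw [hg, ← eq_intCast (Int.castRingHom ℤ_[p]), ← eval₂_id, hom_eval₂, aeval_def]
    congr 1
    ext j
    simp
  have hd : Polynomial.derivative (aeval g F) = aeval g (pderiv i F) := by
    refine derivative_aeval_of_derivative_eq_single (fun j => ?_) F
    simp only [g, Pi.single_apply]
    split_ifs <;> simp
  have hd1 : ‖(Polynomial.derivative (aeval g F - Polynomial.C c)).eval 0‖ = 1 := by
    rw [Polynomial.derivative_sub, Polynomial.derivative_C, sub_zero, hd, hint]
    exact le_antisymm (PadicInt.norm_le_one _) (not_lt.1 fun h =>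
      h1 ((PadicInt.norm_int_lt_one_iff_dvd _).1 h))
  have hz := hensels_lemma (F := aeval g F - Polynomial.C c) (a := (0 : ℤ_[p])) (by
    rw [Polynomial.coe_aeval_eq_eval, hd1, one_pow, Polynomial.eval_sub, hint, Polynomial.eval_C,
      sub_eq_add_neg]
    exact (PadicInt.nonarchimedean _ _).trans_lt
      (max_lt ((PadicInt.norm_int_lt_one_iff_dvd _).2 h0) (by rwa [norm_neg])))
  obtain ⟨z, hz, -⟩ := hz
  rw [Polynomial.coe_aeval_eq_eval, Polynomial.eval_sub, Polynomial.eval_C, hg, sub_eq_zero] at hz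
  exact ⟨_, hz⟩

theorem exists_aeval_div_aeval_eq {P : σ → ℤ} {i : σ} (h0 : (p : ℤ) ∣ eval P F)
    (h1 : ¬ (p : ℤ) ∣ eval P (pderiv i F)) (a : ℚ_[p]) :
    ∃ x y : σ → ℤ_[p], aeval y F ≠ 0 ∧ ((aeval x F : ℤ_[p]) : ℚ_[p]) / (aeval y F : ℤ_[p]) = a := by
  obtain ⟨u, v, hv, rfl⟩ := IsFractionRing.div_surjective (A := ℤ_[p]) a
  have hp : ∀ u : ℤ_[p], ‖p * u‖ < 1 := fun u =>
    (PadicInt.norm_lt_one_iff_dvd _).2 (dvd_mul_right _ _)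
  obtain ⟨x, hx⟩ := exists_aeval_padicInt_eq h0 h1 (hp u)
  obtain ⟨y, hy⟩ := exists_aeval_padicInt_eq h0 h1 (hp v)
  have hp0 : (p : ℤ_[p]) ≠ 0 := Nat.cast_ne_zero.2 (Fact.out : p.Prime).ne_zero
  refine ⟨x, y, ?_, ?_⟩
  · rw [hy]
    exact mul_ne_zero hp0 (nonZeroDivisors.ne_zero hv)
  · rw [hx, hy, PadicInt.coe_mul, PadicInt.coe_mul,
      mul_div_mul_left _ _ (PadicInt.coe_ne_zero.2 hp0)]
    rfl

end MvPolynomial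

theorem dense_ratioSet {p : ℕ} [Fact p.Prime] {n : ℕ} {F : MvPolynomial (Fin n) ℤ}
    {P : Fin n → ℤ} {i : Fin n} (h0 : (p : ℤ) ∣ eval P F)
    (h1 : ¬ (p : ℤ) ∣ eval P (pderiv i F)) : Dense (ratioSet p F) := by
  intro a
  rw [mem_closure_iff_nhds]
  intro U hU
  obtain ⟨x, y, hy, rfl⟩ := exists_aeval_div_aeval_eq h0 h1 a
  have hcont : Continuous fun z : Fin n → ℤ_[p] => aeval z F := by
    simpa only [aeval_def, ← eval_map] using continuous_eval (map (algebraMap ℤ ℤ_[p]) F)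
  have h1 : Continuous fun z : (Fin n → ℤ_[p]) × (Fin n → ℤ_[p]) => aeval z.1 F :=
    hcont.comp continuous_fst
  have h2 : Continuous fun z : (Fin n → ℤ_[p]) × (Fin n → ℤ_[p]) => aeval z.2 F :=
    hcont.comp continuous_snd
  have h3 : ContinuousAt (fun z : (Fin n → ℤ_[p]) × (Fin n → ℤ_[p]) =>
      ((aeval z.1 F : ℤ_[p]) : ℚ_[p]) / (aeval z.2 F : ℤ_[p])) (x, y) :=
    (continuous_subtype_val.comp h1).continuousAt.div
      (continuous_subtype_val.comp h2).continuousAt (PadicInt.coe_ne_zero.2 hy)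
  have hev := (h2.continuousAt.eventually_ne (x := (x, y)) hy).and (h3.eventually_mem hU)
  have hdense : DenseRange (Pi.map fun _ : Fin n => (Int.cast : ℤ → ℤ_[p])) :=
    DenseRange.piMap fun _ => PadicInt.denseRange_intCast
  obtain ⟨O, hO, hOo, hxy⟩ := eventually_nhds_iff.1 hev
  obtain ⟨⟨u, v⟩, huv⟩ := (hdense.prodMap hdense).exists_mem_open hOo ⟨_, hxy⟩
  obtain ⟨hv, hU⟩ := hO _ huv
  have hint : ∀ w : Fin n → ℤ, aeval (Pi.map (fun _ => (Int.cast : ℤ → ℤ_[p])) w) F =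
      (eval w F : ℤ_[p]) := by
    intro w
    rw [← eq_intCast (Int.castRingHom ℤ_[p]), ← eval₂_id, hom_eval₂, aeval_def]
    rfl
  simp only [Prod.map_fst, Prod.map_snd, hint] at hv hU
  exact ⟨_, hU, u, v, fun h => hv (by rw [h, Int.cast_zero]), by simp⟩

namespace MvPolynomial

theorem exists_ne_zero_dvd_aeval {R : Type*} [CommRing R] [IsDomain R] {n : ℕ}
    {F : MvPolynomial (Fin n) R} (hF : F ≠ 0) (v : Fin n → MvPolynomial (Fin n) R) :
    ∃ Φ : MvPolynomial (Fin n) R, Φ ≠ 0 ∧ F ∣ aeval v Φ := by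
  have hdep : ¬ AlgebraicIndependent R (fun o : Option (Fin n) => o.elim F v) := by
    intro h
    have := h.lift_cardinalMk_le_trdeg
    rw [trdeg_of_isDomain] at this
    simp only [Cardinal.mk_fintype, Cardinal.lift_natCast, Fintype.card_option,
      Fintype.card_fin, Nat.cast_le] at this
    omega
  rw [algebraicIndependent_iff] at hdep
  push Not at hdep
  obtain ⟨Ψ, hΨ, hΨ0⟩ := hdep
  obtain ⟨Q, rfl⟩ := (optionEquivLeft R (Fin n)).symm.surjective Ψ
  have hev : ∀ P : Polynomial (MvPolynomial (Fin n) R),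
      aeval (fun o : Option (Fin n) => o.elim F v) ((optionEquivLeft R (Fin n)).symm P) =
        P.eval₂ (aeval v : MvPolynomial (Fin n) R →ₐ[R] MvPolynomial (Fin n) R).toRingHom F := by
    intro P
    induction P using Polynomial.induction_on' with
    | add p q hp hq => rw [map_add, map_add, hp, hq, Polynomial.eval₂_add]
    | monomial k a =>
      rw [optionEquivLeft_symm_apply, ← Polynomial.C_mul_X_pow_eq_monomial, map_mul, map_mul,
        map_pow, map_pow]
      rw [Polynomial.aevalTower_C, Polynomial.aevalTower_X, aeval_rename, aeval_X,
        Polynomial.eval₂_mul, Polynomial.eval₂_C, Polynomial.eval₂_X_pow]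
      rfl
  obtain ⟨q, hq, hdvd⟩ := Polynomial.exists_eq_pow_rootMultiplicity_mul_and_not_dvd Q
    (by rintro rfl; exact hΨ0 (map_zero _)) 0
  rw [hev, hq, Polynomial.eval₂_mul, Polynomial.eval₂_pow, Polynomial.C_0, sub_zero,
    Polynomial.eval₂_X] at hΨ
  rw [Polynomial.C_0, sub_zero, Polynomial.X_dvd_iff] at hdvd
  refine ⟨_, hdvd, ?_⟩
  have h0 := (mul_eq_zero.1 hΨ).resolve_left (pow_ne_zero _ hF)
  rw [← q.divX_mul_X_add, Polynomial.eval₂_add, Polynomial.eval₂_mul, Polynomial.eval₂_X,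
    Polynomial.eval₂_C] at h0
  exact (dvd_add_right (dvd_mul_left F _)).1 (h0 ▸ dvd_zero F)

theorem pderiv_aeval {σ τ R : Type*} [CommRing R] [Fintype σ] (L : σ → MvPolynomial τ R) (k : τ)
    (F : MvPolynomial σ R) :
    pderiv k (aeval L F) = ∑ j, aeval L (pderiv j F) * pderiv k (L j) := by
  classical
  induction F using MvPolynomial.induction_on with
  | C a => simp
  | add p q hp hq => simp only [map_add, hp, hq, add_mul, Finset.sum_add_distrib]
  | mul_X p i hp =>
    simp only [map_mul, aeval_X, pderiv_mul, hp, map_add, add_mul, Finset.sum_add_distrib,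
      Finset.sum_mul, pderiv_X, Pi.single_apply]
    congr 1
    · exact Finset.sum_congr rfl fun j _ => by ring
    · rw [Finset.sum_eq_single i] <;> simp +contextual [eq_comm]

theorem IsHomogeneous.aeval_mul {σ R S : Type*} [CommRing R] [CommRing S] [Algebra R S]
    {F : MvPolynomial σ R} {d : ℕ} (hF : F.IsHomogeneous d) (c : S) (x : σ → S) :
    MvPolynomial.aeval (fun i => c * x i) F = c ^ d * MvPolynomial.aeval x F := by
  simpa only [eval_map, ← aeval_def] using (hF.map (algebraMap R S)).eval_mul c x

theorem isNonsingular_map_intCast_iff {σ K : Type*} [Field K] {F : MvPolynomial σ ℤ} :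
    (map (Int.castRingHom K) F).IsNonsingular ↔
      ∀ x : σ → K, (∀ i, aeval x (pderiv i F) = 0) → x = 0 := by
  simp only [IsNonsingular, pderiv_map, eval_map, aeval_def, algebraMap_int_eq]

/-- A nonsingular integral form has a nonsingular integral hyperplane section. -/
theorem IsNonsingular.exists_hyperplane_section {n d : ℕ} (hd : 2 ≤ d)
    {F : MvPolynomial (Fin (n + 1)) ℤ} (hF : F.IsHomogeneous d)
    (hs : (map (Int.castRingHom ℂ) F).IsNonsingular) :
    ∃ G : MvPolynomial (Fin n) ℤ, G.IsHomogeneous d ∧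
      (map (Int.castRingHom ℂ) G).IsNonsingular ∧ ∀ x, ∃ y, eval x G = eval y F := by
  rw [isNonsingular_map_intCast_iff] at hs
  have hF0 : F ≠ 0 := by
    rintro rfl
    exact one_ne_zero (hs 1 (by simp))
  obtain ⟨Φ, hΦ, hdvd⟩ := exists_ne_zero_dvd_aeval hF0 fun i => pderiv i F
  obtain ⟨l, hl⟩ : ∃ l, eval l (Φ * X (Fin.last n)) ≠ 0 := by
    by_contra! h
    exact mul_ne_zero hΦ (X_ne_zero _) (MvPolynomial.funext fun x => by rw [h, map_zero])
  rw [map_mul, eval_X] at hl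
  obtain ⟨hlΦ, hl0⟩ := mul_ne_zero_iff.1 hl
  set m := l (Fin.last n)
  let L : Fin (n + 1) → MvPolynomial (Fin n) ℤ :=
    Fin.lastCases (-∑ i : Fin n, C (l i.castSucc) * X i) fun i => C m * X i
  have hLlast : L (Fin.last n) = -∑ i : Fin n, C (l i.castSucc) * X i := Fin.lastCases_last
  have hLc : ∀ i : Fin n, L i.castSucc = C m * X i := fun i => Fin.lastCases_castSucc _
  have hLsum : ∑ j, C (l j) * L j = 0 := by
    rw [Fin.sum_univ_castSucc, hLlast, mul_neg, Finset.mul_sum, ← sub_eq_add_neg, sub_eq_zero]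
    refine Finset.sum_congr rfl fun i _ => ?_
    rw [hLc]
    ring
  refine ⟨aeval L F, ?_, ?_, fun x => ⟨fun j => eval x (L j), ?_⟩⟩
  · rw [← one_mul d]
    refine hF.aeval L fun j => ?_
    induction j using Fin.lastCases with
    | last =>
      rw [hLlast]
      exact (IsHomogeneous.sum _ _ _ fun i _ => isHomogeneous_C_mul_X _ _).neg
    | cast i =>
      rw [hLc]
      exact isHomogeneous_C_mul_X _ _
  · rw [isNonsingular_map_intCast_iff]
    intro x hx
    let y : Fin (n + 1) → ℂ := fun j => aeval x (L j)
    have hy : ∀ G : MvPolynomial (Fin (n + 1)) ℤ, aeval x (aeval L G) = aeval y G := by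
      intro G
      rw [← AlgHom.comp_apply, comp_aeval]
    have hm : (m : ℂ) ≠ 0 := Int.cast_ne_zero.2 hl0
    obtain ⟨c, hpar⟩ : ∃ c, ∀ j, aeval y (pderiv j F) = c * l j := by
      refine ⟨aeval y (pderiv (Fin.last n) F) / m, fun j => ?_⟩
      induction j using Fin.lastCases with
      | last => rw [div_mul_cancel₀ _ hm]
      | cast k =>
        have h := hx k
        rw [pderiv_aeval, Fin.sum_univ_castSucc, hLlast] at h
        simp only [hLc, map_neg, map_sum, map_add, map_mul, hy, pderiv_C_mul, pderiv_X] at h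
        simp only [Pi.single_apply, mul_ite, mul_zero, apply_ite (aeval x), map_zero,
          map_one, mul_one, Finset.sum_ite_eq', Finset.mem_univ, if_true, aeval_C] at h
        rw [div_mul_eq_mul_div, eq_div_iff hm]
        linear_combination h
    by_cases h0 : c = 0
    · have hy0 := hs y fun j => by rw [hpar, h0, zero_mul]
      refine _root_.funext fun i => ?_
      have := congrFun hy0 i.castSucc
      simp only [y, hLc, map_mul, aeval_X, aeval_C] at this
      exact (mul_eq_zero.1 this).resolve_left hm
    exfalso
    have hFy : aeval y F = 0 := by
      have h1 := congrArg (aeval y) hF.sum_X_mul_pderiv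
      have h2 := congrArg (aeval x) hLsum
      simp only [map_sum, map_mul, aeval_X, aeval_C, map_nsmul, map_zero] at h1 h2
      have h3 : ∑ j, y j * (c * l j) = c * ∑ j, (l j : ℂ) * y j := by
        rw [Finset.mul_sum]
        exact Finset.sum_congr rfl fun j _ => by ring
      have h4 : ∑ j, (l j : ℂ) * y j = 0 := h2
      simp only [hpar] at h1
      rw [h3, h4, mul_zero, eq_comm, smul_eq_zero] at h1
      exact h1.resolve_left (by omega)
    obtain ⟨t, ht⟩ := IsAlgClosed.exists_pow_nat_eq c⁻¹
      (show 0 < d - 1 by omega)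
    obtain ⟨S, hS⟩ := hdvd
    have h1 : ∀ j, aeval (fun i => t * y i) (pderiv j F) = l j := by
      intro j
      rw [hF.pderiv.aeval_mul, ht, hpar, ← mul_assoc, inv_mul_cancel₀ h0, one_mul]
    have h2 : aeval (fun i => t * y i) F = 0 := by
      rw [hF.aeval_mul, hFy, mul_zero]
    have h3 := congrArg (aeval fun i => t * y i) hS
    rw [map_mul, h2, zero_mul, ← AlgHom.comp_apply, comp_aeval] at h3
    simp only [h1] at h3
    have h4 : aeval (fun j => (l j : ℂ)) Φ = (eval l Φ : ℂ) := by
      rw [← eq_intCast (Int.castRingHom ℂ), ← eval₂_id, hom_eval₂, aeval_def]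
      rfl
    rw [h4, Int.cast_eq_zero] at h3
    exact hlΦ h3
  · rw [← coe_aeval_eq_eval, ← coe_aeval_eq_eval, RingHom.coe_coe, RingHom.coe_coe,
      ← AlgHom.comp_apply, comp_aeval]

theorem formOrder_le {n : ℕ} {R : Type*} [CommRing R] (F : MvPolynomial (Fin n) R) :
    formOrder F ≤ n := by
  refine Nat.sInf_le ⟨1, by simp, ?_⟩
  exact (Finset.card_le_univ _).trans (by simp)

theorem ratioSet_subset {n m p : ℕ} [Fact p.Prime] {G : MvPolynomial (Fin m) ℤ}
    {F : MvPolynomial (Fin n) ℤ} (h : ∀ x, ∃ y, eval x G = eval y F) :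
    ratioSet p G ⊆ ratioSet p F := by
  rintro _ ⟨x, y, hy, rfl⟩
  obtain ⟨x', hx⟩ := h x
  obtain ⟨y', hy'⟩ := h y
  exact ⟨x', y', hy' ▸ hy, by rw [hx, hy']⟩

theorem eval_zmod_map {σ : Type*} {p : ℕ} (F : MvPolynomial σ ℤ) (P : σ → ℤ) :
    eval (fun j => (P j : ZMod p)) (map (Int.castRingHom (ZMod p)) F) = (eval P F : ZMod p) := by
  rw [eval_map, ← eq_intCast (Int.castRingHom (ZMod p)) (eval P F), ← eval₂_id, hom_eval₂]
  rfl

theorem dense_ratioSet_of_isNonsingular_zmod {n p : ℕ} [Fact p.Prime] {F : MvPolynomial (Fin n) ℤ}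
    (hs : (map (Int.castRingHom (ZMod p)) F).IsNonsingular) {x : Fin n → ZMod p} (hx : x ≠ 0)
    (h0 : eval x (map (Int.castRingHom (ZMod p)) F) = 0) : Dense (ratioSet p F) := by
  obtain ⟨P, rfl⟩ : ∃ P : Fin n → ℤ, x = fun j => (P j : ZMod p) :=
    ⟨fun j => (x j).cast, by simp⟩
  have h1 : ∃ i, eval (fun j => (P j : ZMod p))
      (pderiv i (map (Int.castRingHom (ZMod p)) F)) ≠ 0 := by
    by_contra! h
    exact hx (hs _ h)
  obtain ⟨i, hi⟩ := h1
  rw [pderiv_map, eval_zmod_map, Ne, ZMod.intCast_zmod_eq_zero_iff_dvd] at hi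
  rw [eval_zmod_map, ZMod.intCast_zmod_eq_zero_iff_dvd] at h0
  exact dense_ratioSet h0 hi

theorem exists_forall_dense_ratioSet_fin_three {d : ℕ} (hd : 0 < d) {F : MvPolynomial (Fin 3) ℤ}
    (hF : F.IsHomogeneous d) (hs : (map (Int.castRingHom ℂ) F).IsNonsingular) :
    ∃ M : ℕ, ∀ p : ℕ, ∀ _ : Fact p.Prime, M < p → Dense (ratioSet p F) := by
  obtain ⟨M, hM⟩ := hs.exists_forall_charP
  refine ⟨max M (Polynomial.stepanovBound d), fun p _ hp => ?_⟩
  have hK := hM p (by omega) (ZMod p)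
  have hL := hM p (by omega) (AlgebraicClosure (ZMod p))
  obtain ⟨x, hx, h0⟩ := exists_ne_zero_eval_eq_zero_of_stepanovBound_lt hd (p := p) (by omega)
    (hF.map (Int.castRingHom (ZMod p))) (by
      rwa [map_map, RingHom.ext_int ((algebraMap (ZMod p) _).comp _) (Int.castRingHom _)])
  exact dense_ratioSet_of_isNonsingular_zmod hK hx h0

theorem exists_forall_dense_ratioSet {d : ℕ} (hd : 2 ≤ d) (n : ℕ)
    {F : MvPolynomial (Fin (n + 3)) ℤ} (hF : F.IsHomogeneous d)
    (hs : (map (Int.castRingHom ℂ) F).IsNonsingular) :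
    ∃ M : ℕ, ∀ p : ℕ, ∀ _ : Fact p.Prime, M < p → Dense (ratioSet p F) := by
  induction n with
  | zero => exact exists_forall_dense_ratioSet_fin_three (by omega) hF hs
  | succ n ih =>
    obtain ⟨G, hG, hGs, hGF⟩ := hs.exists_hyperplane_section hd hF
    obtain ⟨M, hM⟩ := ih hG hGs
    exact ⟨M, fun p hp hMp => (hM p hp hMp).mono (ratioSet_subset hGF)⟩

theorem exists_forall_dense_ratioSet_of_linear {n : ℕ} [NeZero n] {F : MvPolynomial (Fin n) ℤ}
    (hF : F.IsHomogeneous 1) (hs : (map (Int.castRingHom ℂ) F).IsNonsingular) :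
    ∃ M : ℕ, ∀ p : ℕ, ∀ _ : Fact p.Prime, M < p → Dense (ratioSet p F) := by
  obtain ⟨M, hM⟩ := hs.exists_forall_charP
  refine ⟨M, fun p _ hp => ?_⟩
  have hK := hM p hp (ZMod p)
  obtain ⟨i, hi⟩ : ∃ i, eval 1 (pderiv i (map (Int.castRingHom (ZMod p)) F)) ≠ 0 := by
    by_contra! h
    exact one_ne_zero (hK 1 h)
  have h1 := (hF.map (Int.castRingHom (ZMod p))).pderiv (i := i) |>.eval_mul 0 1
  simp only [zero_mul, tsub_self, pow_zero, one_mul] at h1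
  refine dense_ratioSet (P := 0) (i := i) ?_ ?_
  · rw [hF.eval_zero_eq_zero one_ne_zero]
    exact dvd_zero _
  · rw [← ZMod.intCast_zmod_eq_zero_iff_dvd, ← eval_zmod_map, ← pderiv_map]
    simp only [Pi.zero_apply, Int.cast_zero]
    rwa [h1]

end MvPolynomial

/-- A non-singular integral form of degree `d` (no common nontrivial zero of the partial
derivatives over an algebraic closure of `ℚ`) and of order at least `3` has `R(F)` dense in
`ℚ_p` for all sufficiently large primes `p`. -/
theorem stmt1 {n : ℕ} (d : ℕ) (hd : 0 < d) (F : MvPolynomial (Fin n) ℤ)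
    (hF : F.IsHomogeneous d)
    (hsmooth : ∀ x : Fin n → ℂ,
      (∀ i : Fin n,
        MvPolynomial.eval x (MvPolynomial.pderiv i (F.map (Int.castRingHom ℂ))) = 0) → x = 0)
    (horder : 3 ≤ formOrder (F.map (Int.castRingHom ℚ))) :
    ∃ M : ℕ, ∀ p : ℕ, ∀ _ : Fact p.Prime, M < p → Dense (ratioSet p F) := by
  have hn := horder.trans (formOrder_le _)
  obtain ⟨m, rfl⟩ := Nat.exists_eq_add_of_le' hn
  obtain rfl | hd2 : d = 1 ∨ 2 ≤ d := by omega
  · exact exists_forall_dense_ratioSet_of_linear hF hsmooth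
  · exact exists_forall_dense_ratioSet hd2 m hF hsmooth
end

section
/- Let n be a composite number, written as n = qk where q is a prime divisor of n (so k ≥ 2), and let m be a positive integer. Define the integral form F(x_0,…,x_m) = x_0^{kq} + 2(x_1^k + ⋯ + x_m^k)^q of degree n. Then o(F) = m + 1 (order over ℚ), and the set of primes p such that R(F) is NOT dense in ℚ_p is infinite. -/
open MvPolynomial

section Order

lemma exists_eval_line_const_of_card_vars_lt {n : ℕ} {R : Type*} [Field R]
    (F : MvPolynomial (Fin n) R) (A : Matrix (Fin n) (Fin n) R) (hA : IsUnit A.det)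
    (h : ((aeval (fun i => ∑ j, C (A i j) * X j) F : MvPolynomial (Fin n) R).vars).card < n) :
    ∃ v : Fin n → R, v ≠ 0 ∧ ∀ x : Fin n → R,
      aeval (fun i => Polynomial.C (x i) + Polynomial.C (v i) * Polynomial.X) F =
        Polynomial.C (eval x F) := by
  obtain ⟨j, hj⟩ : ∃ j, j ∉ (aeval (fun i => ∑ j, C (A i j) * X j) F :
      MvPolynomial (Fin n) R).vars := by
    by_contra! hall
    rw [Finset.eq_univ_iff_forall.2 hall] at h
    simp at h
  set G : MvPolynomial (Fin n) R := aeval (fun i => ∑ j, C (A i j) * X j) F with hG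
  refine ⟨A.col j, fun h0 => ?_, fun x => ?_⟩
  · exact hA.ne_zero (Matrix.det_eq_zero_of_column_eq_zero j fun i => congrFun h0 i)
  · set y := A⁻¹.mulVec x with hy
    have hAy : A.mulVec y = x := by
      rw [hy, Matrix.mulVec_mulVec, Matrix.mul_nonsing_inv A hA, Matrix.one_mulVec]
    have key : aeval (fun i => Polynomial.C (y i) +
        (if i = j then Polynomial.X else 0 : Polynomial R)) G =
        aeval (fun i => Polynomial.C (y i)) G := by
      refine eval₂Hom_congr' rfl (fun i hi _ => ?_) rfl
      have : i ≠ j := by rintro rfl; exact hj hi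
      simp [this]
    have e1 : aeval (fun i => Polynomial.C (y i)) G = Polynomial.C (eval x F) := by
      rw [hG, ← AlgHom.comp_apply, comp_aeval]
      have : ∀ i, (aeval fun i => Polynomial.C (y i)) (∑ j, C (A i j) * X j) =
          Polynomial.C (x i) := by
        intro i
        rw [← hAy]
        simp [Matrix.mulVec, dotProduct, MvPolynomial.algHom_C]
      simp_rw [this]
      exact (aeval_algebraMap_apply (B := Polynomial R) x F)
    rw [← e1, ← key, hG, ← AlgHom.comp_apply, comp_aeval]
    congr 2
    funext i
    rw [← hAy]
    simp [Matrix.mulVec, dotProduct, MvPolynomial.algHom_C, mul_add, Finset.sum_add_distrib]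

lemma formOrder_eq_of_forall_line {n : ℕ} {R : Type*} [Field R] (F : MvPolynomial (Fin n) R)
    (h : ∀ v : Fin n → R, (∀ x : Fin n → R,
      aeval (fun i => Polynomial.C (x i) + Polynomial.C (v i) * Polynomial.X) F =
        Polynomial.C (eval x F)) → v = 0) :
    formOrder F = n := by
  unfold formOrder
  have hmem : n ∈ { m | ∃ A : Matrix (Fin n) (Fin n) R, IsUnit A.det ∧
    ((MvPolynomial.aeval (fun i => ∑ j, MvPolynomial.C (A i j) * MvPolynomial.X j) F :
      MvPolynomial (Fin n) R).vars).card ≤ m } :=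
    ⟨1, by simp, (Finset.card_le_univ _).trans_eq (by simp)⟩
  refine le_antisymm (Nat.sInf_le hmem) (le_csInf ⟨n, hmem⟩ ?_)
  rintro m ⟨A, hA, hm⟩
  by_contra! hlt
  obtain ⟨v, hv, hx⟩ := exists_eval_line_const_of_card_vars_lt F A hA (hm.trans_lt hlt)
  exact hv (h v hx)

lemma formOrder_X_pow_add_two_mul_sum_pow (q k m : ℕ) (hq : q.Prime) (hk : 2 ≤ k)
    (F : MvPolynomial (Fin (m + 1)) ℤ)
    (hFdef : F = MvPolynomial.X 0 ^ (k * q) +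
      MvPolynomial.C 2 *
        (∑ i ∈ Finset.univ.filter (fun i : Fin (m + 1) => i ≠ 0),
          MvPolynomial.X i ^ k) ^ q) :
    formOrder (F.map (Int.castRingHom ℚ)) = m + 1 := by
  apply formOrder_eq_of_forall_line
  intro v hv
  have hq0 := hq.ne_zero
  have hk0 : k ≠ 0 := by omega
  have hkk : k * q - 1 ≠ 0 := by
    have := Nat.mul_le_mul hk hq.one_lt.le
    omega
  have hk1 : k - 1 ≠ 0 := by omega
  have key (x : Fin (m + 1) → ℚ) :
      k * q * x 0 ^ (k * q - 1) * v 0 +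
        2 * (q * (∑ i with i ≠ 0, x i ^ k) ^ (q - 1) *
          ∑ i with i ≠ 0, k * x i ^ (k - 1) * v i) = 0 := by
    have h := congrArg (fun P => (Polynomial.derivative P).eval 0) (hv x)
    subst hFdef
    simpa [Polynomial.derivative_pow, Polynomial.eval_finsetSum] using h
  funext j
  have h := key (Pi.single j 1)
  by_cases hj : j = 0
  · subst hj
    rw [Finset.sum_eq_zero (s := Finset.univ.filter (· ≠ 0))
      (f := fun i => (k : ℚ) * _ ^ (k - 1) * v i)] at h
    · simpa [hk0, hq0] using h
    · intro i hi
      simp [(Finset.mem_filter.1 hi).2, hk1]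
  · have hmem : j ∈ Finset.univ.filter (fun i : Fin (m + 1) => i ≠ 0) := by simp [hj]
    rw [Finset.sum_eq_single_of_mem j hmem, Finset.sum_eq_single_of_mem j hmem] at h
    · simpa [hk0, hq0, hkk, Ne.symm hj] using h
    · intro i _ hi
      simp [hi, hk1]
    · intro i _ hi
      simp [hi, hk0]

end Order

lemma exists_pow_valuation {p q : ℕ} [Fact p.Prime] (hq : 0 < q)
    (hp : ∀ x : ZMod p, x ^ q ≠ -2) (a b : ℤ) (h : a ^ q + 2 * b ^ q ≠ 0) :
    ∃ e : ℕ, ∃ u : ℤ, a ^ q + 2 * b ^ q = (p : ℤ) ^ (q * e) * u ∧ ¬ (p : ℤ) ∣ u := by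
  induction hN : a.natAbs + b.natAbs using Nat.strong_induction_on generalizing a b with
  | _ N ih =>
  by_cases hdvd : (p : ℤ) ∣ a ^ q + 2 * b ^ q
  · have h1 : (a : ZMod p) ^ q + 2 * (b : ZMod p) ^ q = 0 := by
      exact_mod_cast (ZMod.intCast_zmod_eq_zero_iff_dvd _ p).2 hdvd
    have hb : (b : ZMod p) = 0 := by
      by_contra hb
      apply hp (a / b)
      rw [div_pow, div_eq_iff (pow_ne_zero _ hb)]
      linear_combination h1
    have ha : (a : ZMod p) = 0 := by
      rw [hb, zero_pow hq.ne', mul_zero, add_zero] at h1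
      exact pow_eq_zero_iff hq.ne' |>.1 h1
    obtain ⟨a', rfl⟩ := (ZMod.intCast_zmod_eq_zero_iff_dvd _ p).1 ha
    obtain ⟨b', rfl⟩ := (ZMod.intCast_zmod_eq_zero_iff_dvd _ p).1 hb
    have e : ((p : ℤ) * a') ^ q + 2 * (p * b') ^ q = (p : ℤ) ^ q * (a' ^ q + 2 * b' ^ q) := by ring
    rw [e] at h
    have h' := right_ne_zero_of_mul h
    have hp2 := (Fact.out : p.Prime).two_le
    have hlt : a'.natAbs + b'.natAbs < N := by
      rw [← hN, Int.natAbs_mul, Int.natAbs_mul, Int.natAbs_natCast, ← mul_add]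
      have : 0 < a'.natAbs + b'.natAbs := by
        by_contra h0
        have h1 : a' = 0 := by omega
        have h2 : b' = 0 := by omega
        exact h' (by simp [h1, h2, hq.ne'])
      nlinarith
    obtain ⟨f, u, hu, hnu⟩ := ih _ hlt a' b' h' rfl
    exact ⟨f + 1, u, by rw [e, hu]; ring, hnu⟩
  · exact ⟨0, _, by simp, hdvd⟩

lemma not_dense_ratioSet {p q n : ℕ} [Fact p.Prime] (hq : 2 ≤ q)
    (hp : ∀ x : ZMod p, x ^ q ≠ -2) (F : MvPolynomial (Fin n) ℤ)
    (hF : ∀ x : Fin n → ℤ, ∃ a b : ℤ, eval x F = a ^ q + 2 * b ^ q) :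
    ¬ Dense (ratioSet p F) := by
  have hp1 : (1 : ℝ) < p := by exact_mod_cast (Fact.out : p.Prime).one_lt
  have hp0 : (0 : ℝ) < p := by linarith
  have hnorm : ∀ x, eval x F ≠ 0 →
      ∃ e : ℕ, ‖((eval x F : ℤ) : ℚ_[p])‖ = (p : ℝ) ^ (-(q * e : ℤ)) := by
    intro x hx
    obtain ⟨a, b, hab⟩ := hF x
    rw [hab] at hx ⊢
    obtain ⟨e, u, hu, hnu⟩ := exists_pow_valuation (by omega) hp a b hx
    refine ⟨e, ?_⟩
    rw [hu]
    have : ‖((u : ℤ) : ℚ_[p])‖ = 1 := by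
      refine le_antisymm (Padic.norm_int_le_one u) (not_lt.1 fun h => hnu ?_)
      exact Padic.norm_intCast_lt_one_iff.1 h
    push_cast
    rw [norm_mul, this, mul_one, norm_pow, Padic.norm_p, zpow_neg, inv_pow]
    norm_cast
  intro hd
  obtain ⟨t, ht, hball⟩ := hd.exists_dist_lt (p : ℚ_[p]) (ε := ‖(p : ℚ_[p])‖)
    (by rw [Padic.norm_p]; positivity)
  have ht' : ‖t‖ = ‖(p : ℚ_[p])‖ := by
    rw [dist_eq_norm] at hball
    have := Padic.norm_eq_of_norm_sub_lt_left hball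
    exact this.symm
  obtain ⟨x, y, hy, rfl⟩ := ht
  have hx : eval x F ≠ 0 := by
    intro h0
    rw [h0, Padic.norm_p] at ht'
    simp at ht'
    exact hp0.ne ht'
  obtain ⟨e, he⟩ := hnorm x hx
  obtain ⟨f, hf⟩ := hnorm y hy
  rw [norm_div, he, hf, Padic.norm_p, ← zpow_neg_one, ← zpow_sub₀ hp0.ne'] at ht'
  have := zpow_right_injective₀ hp0 hp1.ne' ht'
  have h2 : (q : ℤ) * (e - f) = 1 := by linarith
  have := Int.eq_one_or_neg_one_of_mul_eq_one h2
  omega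

section PrimesInAP
open ArithmeticFunction vonMangoldt Filter Topology

lemma not_summable_inv_primes_residueClass {q : ℕ} [NeZero q] {a : ZMod q} (ha : IsUnit a) :
    ¬ Summable (fun n : ℕ => if n.Prime ∧ (n : ZMod q) = a then (n : ℝ)⁻¹ else 0) := by
  intro hs
  set g : ℕ → ℝ := fun n => if n.Prime ∧ (n : ZMod q) = a then (n : ℝ)⁻¹ else 0 with hg
  have hg0 : ∀ n, 0 ≤ g n := fun n => by simp only [hg]; split_ifs <;> positivity
  set w : ℝ → ℕ → ℝ := fun ε n => ε * Real.log n * (n : ℝ) ^ (-ε) with hw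
  have hw0 : ∀ ε > 0, ∀ n, 0 ≤ w ε n := fun ε hε n => by
    have := Real.log_natCast_nonneg n
    positivity
  have hw1 : ∀ ε > 0, ∀ n, 0 < n → w ε n ≤ 1 := fun ε hε n hn => by
    have hn' : (0 : ℝ) < n := by exact_mod_cast hn
    simp only [hw]
    rw [Real.rpow_neg hn'.le, ← div_eq_mul_inv, div_le_one (by positivity),
      Real.rpow_def_of_pos hn']
    have := Real.add_one_le_exp (Real.log n * ε)
    linarith
  set h : ℕ → ℝ := fun n => (if n.Prime then 0 else residueClass a n) / n with hh
  have hh0 : ∀ n, 0 ≤ h n := fun n => by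
    have := residueClass_nonneg a n
    simp only [hh]; split_ifs <;> positivity
  have hhs : Summable h := summable_residueClass_non_primes_div a
  have hgw0 : ∀ ε > 0, ∀ n, 0 ≤ g n * w ε n := fun ε hε n => mul_nonneg (hg0 n) (hw0 ε hε n)
  have hgw : ∀ ε > 0, ∀ n, g n * w ε n ≤ g n := fun ε hε n => by
    rcases n.eq_zero_or_pos with rfl | hn
    · simp [hg]
    · exact mul_le_of_le_one_right (hg0 n) (hw1 ε hε n hn)
  have hgws : ∀ ε > 0, Summable fun n => g n * w ε n := fun ε hε =>
    hs.of_nonneg_of_le (hgw0 ε hε) (hgw ε hε)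
  have hterm : ∀ ε > 0, ∀ n : ℕ, residueClass a n / (n : ℝ) ^ (1 + ε) ≤
      ε⁻¹ * (g n * w ε n) + h n := fun ε hε n => by
    rcases n.eq_zero_or_pos with rfl | hn
    · simp [hg, hh]
    have hn' : (0 : ℝ) < n := by exact_mod_cast hn
    have hn1 : (1 : ℝ) ≤ n := by exact_mod_cast hn
    by_cases hp : n.Prime
    · by_cases hna : (n : ZMod q) = a
      · have : residueClass a n = Real.log n := by
          rw [residueClass, Set.indicator_of_mem (by exact hna), vonMangoldt_apply_prime hp]
        rw [this]
        simp only [hg, hw, hh, hp, hna, and_self, if_true, zero_div, add_zero]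
        rw [Real.rpow_add hn', Real.rpow_one, Real.rpow_neg hn'.le]
        apply le_of_eq
        field_simp
      · have : residueClass a n = 0 := Set.indicator_of_notMem (by exact hna) _
        rw [this, zero_div]
        have := hgw0 ε hε n
        have := hh0 n
        positivity
    · have h1 : residueClass a n / (n : ℝ) ^ (1 + ε) ≤ h n := by
        simp only [hh, hp, if_false]
        gcongr
        · exact residueClass_nonneg a n
        · exact Real.self_le_rpow_of_one_le hn1 (by linarith)
      have := hgw0 ε hε n
      have : 0 ≤ ε⁻¹ * (g n * w ε n) := by positivity
      linarith
  obtain ⟨C, hC⟩ := LSeries_residueClass_lower_bound ha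
  have hbound : ∀ᶠ ε in 𝓝[>] (0 : ℝ), (q.totient : ℝ)⁻¹ ≤
      (∑' n, g n * w ε n) + ε * (∑' n, h n + C) := by
    filter_upwards [Ioc_mem_nhdsGT (zero_lt_one (α := ℝ))] with ε hε
    have hε0 : 0 < ε := hε.1
    have h1 := hC (x := 1 + ε) ⟨by linarith, by linarith [hε.2]⟩
    have hsum := ((hgws ε hε0).mul_left ε⁻¹).add hhs
    have h2 : ∑' n, residueClass a n / (n : ℝ) ^ (1 + ε) ≤
        ∑' n, (ε⁻¹ * (g n * w ε n) + h n) := by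
      refine Summable.tsum_le_tsum (hterm ε hε0) ?_ hsum
      refine hsum.of_nonneg_of_le (fun n => ?_) (hterm ε hε0)
      exact div_nonneg (residueClass_nonneg a n) (by positivity)
    rw [((hgws ε hε0).mul_left ε⁻¹).tsum_add hhs, tsum_mul_left] at h2
    have h3 := h1.trans h2
    rw [add_sub_cancel_left] at h3
    have h4 := mul_le_mul_of_nonneg_left h3 hε0.le
    have e1 : ε * ((q.totient : ℝ)⁻¹ / ε - C) = (q.totient : ℝ)⁻¹ - ε * C := by field_simp
    have e2 : ε * (ε⁻¹ * ∑' n, g n * w ε n + ∑' n, h n) =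
        ∑' n, g n * w ε n + ε * ∑' n, h n := by field_simp
    rw [e1, e2] at h4
    linarith
  have hlim1 : Tendsto (fun ε => ∑' n, g n * w ε n) (𝓝[>] 0) (𝓝 (∑' _ : ℕ, (0 : ℝ))) := by
    refine tendsto_tsum_of_dominated_convergence hs (fun n => ?_) ?_
    · rcases n.eq_zero_or_pos with rfl | hn
      · simp [hg]
      have hn' : (n : ℝ) ≠ 0 := by exact_mod_cast hn.ne'
      have : ContinuousAt (fun ε => g n * w ε n) 0 := by
        simp only [hw]
        have : ContinuousAt (fun ε : ℝ => (n : ℝ) ^ (-ε)) 0 :=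
          ContinuousAt.rpow continuousAt_const continuousAt_neg (Or.inl hn')
        fun_prop
      have := this.tendsto.mono_left (nhdsWithin_le_nhds (s := Set.Ioi 0))
      simpa [hw] using this
    · filter_upwards [self_mem_nhdsWithin] with ε hε n
      rw [Real.norm_of_nonneg (hgw0 ε hε n)]
      exact hgw ε hε n
  have hlim2 : Tendsto (fun ε : ℝ => ε * (∑' n, h n + C)) (𝓝[>] 0) (𝓝 0) := by
    have : Tendsto (fun ε : ℝ => ε * (∑' n, h n + C)) (𝓝 0) (𝓝 (0 * (∑' n, h n + C))) :=
      (tendsto_id).mul_const _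
    rw [zero_mul] at this
    exact this.mono_left nhdsWithin_le_nhds
  have hle := le_of_tendsto_of_tendsto tendsto_const_nhds (hlim1.add hlim2) hbound
  simp only [tsum_zero, add_zero] at hle
  have : 0 < (q.totient : ℝ)⁻¹ := inv_pos.mpr (mod_cast q.totient.pos_of_neZero)
  linarith

end PrimesInAP

section NumberField
open NumberField Ideal

lemma exists_card_absNorm_le (K : Type*) [Field K] [NumberField K] :
    ∃ C : ℝ, ∀ s : Finset (Ideal (𝓞 K)), ∀ n : ℕ, 0 < n →
      (∀ I ∈ s, absNorm I ≤ n) → (s.card : ℝ) ≤ C * n := by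
  obtain ⟨C, hC⟩ := ((NumberField.Ideal.tendsto_norm_le_div_atTop K).comp
    tendsto_natCast_atTop_atTop).bddAbove_range
  refine ⟨C, fun s n hn hs => ?_⟩
  have h := hC ⟨n, rfl⟩
  simp only [Function.comp_apply, Nat.cast_le] at h
  rw [div_le_iff₀ (by exact_mod_cast hn)] at h
  refine le_trans ?_ h
  have hfin : {I : Ideal (𝓞 K) | absNorm I ≤ n}.Finite := finite_setOfPred_absNorm_le n
  have := Set.ncard_le_ncard (s := (s : Set (Ideal (𝓞 K)))) (t := {I | absNorm I ≤ n}) hs hfin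
  rw [Set.ncard_coe_finset] at this
  exact_mod_cast this

lemma summable_inv_of_exists_two_ideals {K : Type*} [Field K] [NumberField K] {M : ℕ} (hM : 0 < M)
    (Q Q' : ℕ → Ideal (𝓞 K)) (hQ : ∀ p : ℕ, p.Prime → ¬ p ∣ M → absNorm (Q p) = p) (S : Set ℕ)
    (hS : ∀ p ∈ S, p.Prime ∧ ¬ p ∣ M ∧ absNorm (Q' p) = p ∧ Q' p ≠ Q p) :
    Summable (S.indicator fun p : ℕ => (p : ℝ)⁻¹) := by
  classical
  obtain ⟨C, hC⟩ := exists_card_absNorm_le K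
  have hpr : ∀ I : Ideal (𝓞 K), (absNorm I).Prime → Prime I := fun I hI =>
    (irreducible_of_irreducible_absNorm hI).prime
  set D : ℕ → Ideal (𝓞 K) := fun n => (n.primeFactorsList.map Q).prod with hD
  have hDn : ∀ n : ℕ, n ≠ 0 → n.Coprime M → absNorm (D n) = n := by
    intro n hn hnM
    conv_rhs => rw [← Nat.prod_primeFactorsList hn]
    rw [hD, map_list_prod, List.map_map]
    congr 1
    conv_rhs => rw [← List.map_id n.primeFactorsList]
    refine List.map_congr_left fun p hp => ?_
    have hpp := Nat.prime_of_mem_primeFactorsList hp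
    refine hQ p hpp fun hpM => ?_
    exact hpp.one_lt.ne' (Nat.dvd_one.1
      (hnM ▸ Nat.dvd_gcd (Nat.dvd_of_mem_primeFactorsList hp) hpM))
  have hnd : ∀ p ∈ S, ∀ n : ℕ, n.Coprime M → ¬ Q' p ∣ D n := by
    intro p hp n hnM hdvd
    obtain ⟨hpp, hpM, hQp, hne⟩ := hS p hp
    obtain ⟨I, hI, hdI⟩ := (hpr (Q' p) (by rwa [hQp])).dvd_prod_iff.1 hdvd
    obtain ⟨l, hl, rfl⟩ := List.mem_map.1 hI
    have hlp := Nat.prime_of_mem_primeFactorsList hl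
    have hlM : ¬ l ∣ M := fun h => hlp.one_lt.ne' (Nat.dvd_one.1
      (hnM ▸ Nat.dvd_gcd (Nat.dvd_of_mem_primeFactorsList hl) h))
    have hQl := hQ l hlp hlM
    have hass := (hpr (Q' p) (by rwa [hQp])).associated_of_dvd (hpr (Q l) (by rwa [hQl])) hdI
    have heq := associated_iff_eq.1 hass
    have : p = l := by rw [← hQp, ← hQl, heq]
    subst this
    exact hne heq
  have hcop : ∀ j : ℕ, (1 + j * M).Coprime M := fun j => by simp
  refine summable_of_sum_le (c := C * M) (fun n => Set.indicator_nonneg (by intros; positivity) n) ?_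
  intro U
  set T := U.filter (· ∈ S) with hT
  have hTS : ∀ p ∈ T, p ∈ S := fun p hp => (Finset.mem_filter.1 hp).2
  set N := ∏ p ∈ T, p with hN
  have hNpos : 0 < N := Finset.prod_pos fun p hp => (hS p (hTS p hp)).1.pos
  have hdvd : ∀ p ∈ T, p ∣ N := fun p hp => Finset.dvd_prod_of_mem _ hp
  let f : (_ : ℕ) × ℕ → Ideal (𝓞 K) := fun x => Q' x.1 * D (1 + x.2 * M)
  let P : Finset ((_ : ℕ) × ℕ) := T.sigma fun p => Finset.range (N / p)
  have hnorm : ∀ x ∈ P, absNorm (f x) = x.1 * (1 + x.2 * M) := by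
    intro x hx
    obtain ⟨h1, -⟩ := Finset.mem_sigma.1 hx
    simp only [f]
    rw [map_mul, (hS _ (hTS _ h1)).2.2.1, hDn _ (by omega) (hcop _)]
  have hinj : Set.InjOn f P := by
    rintro ⟨p, i⟩ hx ⟨r, j⟩ hy hxy
    have h1 := hTS p (Finset.mem_sigma.1 hx).1
    have h2 := hTS r (Finset.mem_sigma.1 hy).1
    obtain ⟨hpp, hpM, hQp, hne⟩ := hS p h1
    obtain ⟨hrp, hrM, hQr, hner⟩ := hS r h2
    have hpr' : p = r := by
      have : Q' p ∣ Q' r * D (1 + j * M) := ⟨_, hxy.symm⟩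
      rcases (hpr (Q' p) (by rwa [hQp])).dvd_or_dvd this with h | h
      · have := map_dvd (absNorm (S := 𝓞 K)) h
        rw [hQp, hQr] at this
        exact (Nat.prime_dvd_prime_iff_eq hpp hrp).1 this
      · exact absurd h (hnd p h1 _ (hcop j))
    subst hpr'
    have hnn := hnorm _ hx
    rw [hxy, hnorm _ hy] at hnn
    have h3 := Nat.eq_of_mul_eq_mul_left hpp.pos hnn
    have h4 : j * M = i * M := by simpa using h3
    have := Nat.eq_of_mul_eq_mul_right hM h4
    subst this; rfl
  have hle := hC (P.image f) (N * M) (by positivity) (by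
    intro I hI
    obtain ⟨x, hx, rfl⟩ := Finset.mem_image.1 hI
    rw [hnorm x hx]
    obtain ⟨h1, h2⟩ := Finset.mem_sigma.1 hx
    rw [Finset.mem_range] at h2
    calc x.1 * (1 + x.2 * M) ≤ x.1 * ((x.2 + 1) * M) := by gcongr; nlinarith
      _ ≤ x.1 * (N / x.1 * M) := by gcongr; omega
      _ = N * M := by rw [← mul_assoc, Nat.mul_div_cancel' (hdvd _ h1)])
  rw [Finset.card_image_of_injOn hinj, Finset.card_sigma] at hle
  simp only [Finset.card_range] at hle
  have hNr : (0 : ℝ) < N := by exact_mod_cast hNpos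
  have hsum : ((∑ p ∈ T, N / p : ℕ) : ℝ) = N * ∑ p ∈ T, (p : ℝ)⁻¹ := by
    push_cast
    rw [Finset.mul_sum]
    refine Finset.sum_congr rfl fun p hp => ?_
    rw [Nat.cast_div (hdvd p hp) (by exact_mod_cast (hS p (hTS p hp)).1.ne_zero), div_eq_mul_inv]
  rw [hsum] at hle
  push_cast at hle
  have : ∑ p ∈ U, S.indicator (fun p : ℕ => (p : ℝ)⁻¹) p = ∑ p ∈ T, (p : ℝ)⁻¹ := by
    rw [hT, Finset.sum_filter]
    rfl
  rw [this]
  refine le_of_mul_le_mul_left ?_ hNr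
  linarith

lemma exponent_ne_zero_of_powerBasis {K : Type*} [Field K] [NumberField K] (B : PowerBasis ℚ K)
    (θ : 𝓞 K) (hθ : (θ : K) = B.gen) : RingOfIntegers.exponent θ ≠ 0 := by
  have hint : IsIntegral ℤ B.gen := hθ ▸ θ.isIntegral_coe
  obtain ⟨d, hd⟩ : ∃ d : ℤ, (d : ℚ) = Algebra.discr ℚ B.basis := by
    refine IsIntegrallyClosed.isIntegral_iff.1 (Algebra.discr_isIntegral ℚ fun i => ?_)
    rw [B.basis_eq_pow]
    exact hint.pow _
  have hd0 : d ≠ 0 := by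
    rintro rfl
    exact Algebra.discr_not_zero_of_basis ℚ B.basis (by rw [← hd]; simp)
  rw [RingOfIntegers.exponent, Ne, absNorm_eq_zero_iff]
  intro h
  refine hd0 ?_
  have : d ∈ under ℤ (conductor ℤ θ) := by
    rw [under_def, mem_comap, mem_conductor_iff]
    intro b
    have hb := Algebra.discr_mul_isIntegral_mem_adjoin ℚ hint b.isIntegral_coe
    rw [← hd, ← hθ] at hb
    have e : (Algebra.adjoin ℤ {θ}).map (IsScalarTower.toAlgHom ℤ (𝓞 K) K) =
        Algebra.adjoin ℤ {(θ : K)} := by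
      rw [AlgHom.map_adjoin]
      simp
    rw [← e] at hb
    obtain ⟨c, hc, hcb⟩ := hb
    have : c = algebraMap ℤ (𝓞 K) d * b := by
      apply RingOfIntegers.coe_injective
      refine hcb.trans ?_
      rw [map_mul, ← IsScalarTower.algebraMap_apply ℤ (𝓞 K) K]
      simp [Algebra.smul_def]
    rw [← this]
    exact hc
  rw [h] at this
  exact this

lemma exists_ringHom_zmod {K : Type*} [Field K] [NumberField K] {θ : 𝓞 K} {p : ℕ} [Fact p.Prime]
    (hp : ¬ p ∣ RingOfIntegers.exponent θ) (r : ZMod p)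
    (hr : (minpoly ℤ θ).eval₂ (Int.castRingHom (ZMod p)) r = 0) :
    ∃ ψ : 𝓞 K →+* ZMod p, ψ θ = r := by
  let e := RingOfIntegers.ZModXQuotSpanEquivQuotSpan hp
  let ev : Polynomial (ZMod p) ⧸ span {(minpoly ℤ θ).map (Int.castRingHom (ZMod p))} →+* ZMod p :=
    Ideal.Quotient.lift _ (Polynomial.evalRingHom r) (by
      intro a ha
      obtain ⟨b, rfl⟩ := mem_span_singleton.1 ha
      rw [map_mul, Polynomial.coe_evalRingHom, Polynomial.eval_map, hr, zero_mul])
  refine ⟨ev.comp (e.symm.toRingHom.comp (Ideal.Quotient.mk _)), ?_⟩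
  have h := RingOfIntegers.ZModXQuotSpanEquivQuotSpan_mk_apply hp Polynomial.X
  rw [Polynomial.aeval_X, Polynomial.map_X] at h
  change ev (e.symm (Ideal.Quotient.mk _ θ)) = r
  rw [← h, RingEquiv.symm_apply_apply]
  simp [ev]

lemma absNorm_ker_ringHom_zmod {K : Type*} [Field K] [NumberField K] {p : ℕ}
    (ψ : 𝓞 K →+* ZMod p) : absNorm (RingHom.ker ψ) = p := by
  have := Nat.card_congr (RingHom.quotientKerEquivOfSurjective
    (ZMod.ringHom_surjective ψ)).toEquiv
  rw [absNorm_apply, Submodule.cardQuot_apply]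
  exact this.trans (Nat.card_zmod p)

lemma ker_ne_ker_of_apply_ne {R : Type*} [CommRing R] {p : ℕ} {ψ φ : R →+* ZMod p} {x : R}
    (h : ψ x ≠ φ x) : RingHom.ker ψ ≠ RingHom.ker φ := by
  intro hk
  obtain ⟨n, hn⟩ := ZMod.intCast_surjective (ψ x)
  have : x - (n : R) ∈ RingHom.ker ψ := by simp [RingHom.mem_ker, hn]
  rw [hk, RingHom.mem_ker, map_sub, map_intCast, hn, sub_eq_zero] at this
  exact h this.symm

end NumberField

section PowerResidue
open NumberField Polynomial

lemma rat_pow_ne_neg_two {q : ℕ} (hq : q.Prime) (b : ℚ) : b ^ q ≠ -2 := by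
  intro h
  have h1 := congrArg (padicValRat 2) h
  have hb : b ≠ 0 := by
    rintro rfl
    simp [hq.ne_zero] at h
  have h2 : padicValRat 2 (2 : ℚ) = 1 := by
    exact_mod_cast padicValRat.self (p := 2) one_lt_two
  rw [padicValRat.pow, padicValRat.neg, h2] at h1
  have := Int.eq_one_or_neg_one_of_mul_eq_one h1
  have := hq.two_le
  omega

lemma exists_numberField_minpoly {q : ℕ} (hq : q.Prime) :
    ∃ (K : Type) (_ : Field K) (_ : NumberField K) (θ : 𝓞 K),
      minpoly ℤ θ = Polynomial.X ^ q + Polynomial.C 2 ∧ RingOfIntegers.exponent θ ≠ 0 := by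
  have hirr : Irreducible (Polynomial.X ^ q - Polynomial.C (-2) : ℚ[X]) :=
    X_pow_sub_C_irreducible_of_prime hq (rat_pow_ne_neg_two hq)
  have hmon : (Polynomial.X ^ q - Polynomial.C (-2) : ℚ[X]).Monic := monic_X_pow_sub_C _ hq.ne_zero
  have := Fact.mk hirr
  let K := AdjoinRoot (Polynomial.X ^ q - Polynomial.C (-2) : ℚ[X])
  let B := AdjoinRoot.powerBasis hirr.ne_zero
  have : FiniteDimensional ℚ K := B.finite
  have : CharZero K := algebraRat.charZero K
  have : NumberField K := ⟨⟩
  have hroot : (AdjoinRoot.root (Polynomial.X ^ q - Polynomial.C (-2) : ℚ[X])) ^ q = -2 := by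
    have := AdjoinRoot.eval₂_root (Polynomial.X ^ q - Polynomial.C (-2) : ℚ[X])
    rw [Polynomial.eval₂_sub, Polynomial.eval₂_X_pow, Polynomial.eval₂_C] at this
    exact (sub_eq_zero.1 this).trans ((map_neg _ _).trans (congrArg _ (map_ofNat _ 2)))
  have hint : IsIntegral ℤ (AdjoinRoot.root (Polynomial.X ^ q - Polynomial.C (-2) : ℚ[X]) : K) := by
    refine IsIntegral.of_pow hq.pos ?_
    rw [hroot]
    exact_mod_cast isIntegral_algebraMap (R := ℤ) (A := K) (x := -2)
  refine ⟨K, inferInstance, inferInstance, ⟨_, hint⟩, ?_, ?_⟩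
  · apply Polynomial.map_injective (algebraMap ℤ ℚ) Int.cast_injective
    refine (minpoly.isIntegrallyClosed_eq_field_fractions ℚ K
      (RingOfIntegers.isIntegral (K := K) ⟨_, hint⟩)).symm.trans ?_
    refine (minpoly.eq_of_irreducible_of_monic hirr ?_ hmon).symm.trans ?_
    · simp only [map_sub, map_pow, Polynomial.aeval_X, Polynomial.aeval_C]
      exact sub_eq_zero.2 (hroot.trans (by simp))
    · simp only [map_neg, sub_neg_eq_add, Polynomial.map_add, Polynomial.map_pow,
        Polynomial.map_X, map_ofNat, Polynomial.map_ofNat]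
  · exact exponent_ne_zero_of_powerBasis B _ rfl

/-- For a prime `q`, the integer `-2` fails to be a `q`-th power modulo infinitely many primes. -/
theorem infinite_setOf_prime_forall_pow_ne_neg_two {q : ℕ} (hq : q.Prime) :
    {p : ℕ | p.Prime ∧ ∀ x : ZMod p, x ^ q ≠ -2}.Infinite := by
  intro hfin
  have : NeZero q := ⟨hq.ne_zero⟩
  obtain ⟨K, _, _, θ, hmin, hexp⟩ := exists_numberField_minpoly hq
  set M := 2 * RingOfIntegers.exponent θ * ∏ p ∈ hfin.toFinset, p with hMdef
  have hM : 0 < M := by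
    have : 0 < ∏ p ∈ hfin.toFinset, p :=
      Finset.prod_pos fun p hp => ((hfin.mem_toFinset).1 hp).1.pos
    positivity
  have hroot : ∀ p : ℕ, p.Prime → ¬ p ∣ M → ∃ r : ZMod p, r ^ q = -2 := by
    intro p hp hpM
    by_contra! hno
    exact hpM (Dvd.dvd.mul_left (Finset.dvd_prod_of_mem _ (hfin.mem_toFinset.2 ⟨hp, hno⟩)) _)
  have hhom : ∀ p : ℕ, p.Prime → ¬ p ∣ M → ∀ r : ZMod p, r ^ q = -2 →
      ∃ ψ : 𝓞 K →+* ZMod p, ψ θ = r := by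
    intro p hp hpM r hr
    have := Fact.mk hp
    refine exists_ringHom_zmod
      (fun h => hpM (Dvd.dvd.mul_right (Dvd.dvd.mul_left h _) _)) r ?_
    rw [hmin]
    simp [hr]
  have hQ : ∀ p : ℕ, ∃ I : Ideal (𝓞 K), ∃ J : Ideal (𝓞 K), p.Prime → ¬ p ∣ M →
      Ideal.absNorm I = p ∧ ((p : ZMod q) = 1 → Ideal.absNorm J = p ∧ J ≠ I) := by
    intro p
    by_cases hp : p.Prime
    swap
    · exact ⟨⊤, ⊤, fun h => absurd h hp⟩
    by_cases hpM : p ∣ M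
    · exact ⟨⊤, ⊤, fun _ h => absurd hpM h⟩
    have := Fact.mk hp
    obtain ⟨r, hr⟩ := hroot p hp hpM
    obtain ⟨ψ, hψ⟩ := hhom p hp hpM r hr
    by_cases hp1 : (p : ZMod q) = 1
    swap
    · exact ⟨RingHom.ker ψ, ⊤, fun _ _ => ⟨absNorm_ker_ringHom_zmod ψ, fun h => absurd h hp1⟩⟩
    have hdvd : q ∣ Nat.card (ZMod p)ˣ := by
      rw [Nat.card_eq_fintype_card, ZMod.card_units]
      rw [← ZMod.natCast_eq_zero_iff, Nat.cast_sub hp.one_lt.le, hp1]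
      simp
    have := Fact.mk hq
    obtain ⟨ζ, hζ⟩ := exists_prime_orderOf_dvd_card' q hdvd
    have hζq : ((ζ : (ZMod p)ˣ) : ZMod p) ^ q = 1 := by
      rw [← Units.val_pow_eq_pow_val, ← hζ, pow_orderOf_eq_one, Units.val_one]
    have hζ1 : (ζ : ZMod p) ≠ 1 := by
      intro h
      rw [Units.val_eq_one.1 h, orderOf_one] at hζ
      exact hq.one_lt.ne hζ
    obtain ⟨φ, hφ⟩ := hhom p hp hpM (ζ * r) (by rw [mul_pow, hζq, hr, one_mul])
    have hr0 : r ≠ 0 := by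
      rintro rfl
      rw [zero_pow hq.ne_zero, eq_comm, neg_eq_zero] at hr
      have : p ∣ 2 := (ZMod.natCast_eq_zero_iff 2 p).1 (by exact_mod_cast hr)
      exact hpM ((this.mul_right _).mul_right _)
    refine ⟨RingHom.ker ψ, RingHom.ker φ, fun _ _ => ⟨absNorm_ker_ringHom_zmod ψ, fun _ =>
      ⟨absNorm_ker_ringHom_zmod φ, ker_ne_ker_of_apply_ne (x := θ) ?_⟩⟩⟩
    rw [hψ, hφ]
    intro h
    exact hζ1 (mul_right_cancel₀ hr0 (h.trans (one_mul r).symm))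
  choose Q Q' hQQ' using hQ
  have hsum := summable_inv_of_exists_two_ideals hM Q Q' (fun p hp hpM => (hQQ' p hp hpM).1)
    {p | p.Prime ∧ ¬ p ∣ M ∧ (p : ZMod q) = 1}
    (fun p ⟨hp, hpM, hp1⟩ => ⟨hp, hpM, (hQQ' p hp hpM).2 hp1⟩)
  refine not_summable_inv_primes_residueClass (q := q) isUnit_one ?_
  have hfin2 : Summable fun n : ℕ => if n ∈ M.divisors then (n : ℝ)⁻¹ else 0 :=
    summable_of_ne_finset_zero (s := M.divisors) fun n hn => if_neg hn
  refine (hsum.add hfin2).of_nonneg_of_le (fun n => by positivity) fun n => ?_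
  by_cases h : n.Prime ∧ (n : ZMod q) = 1
  · rw [if_pos h]
    by_cases hnM : n ∣ M
    · rw [if_pos (Nat.mem_divisors.2 ⟨hnM, hM.ne'⟩)]
      exact le_add_of_nonneg_left (Set.indicator_nonneg (by intros; positivity) n)
    · rw [Set.indicator_of_mem (by exact ⟨h.1, hnM, h.2⟩)]
      exact le_add_of_nonneg_right (by positivity)
  · rw [if_neg h]
    exact add_nonneg (Set.indicator_nonneg (by intros; positivity) n) (by positivity)

end PowerResidue

/-- For a composite number `n = qk` with `q` prime and `k ≥ 2`, and any `m ≥ 1`, the form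
`F(x_0,…,x_m) = x_0^{kq} + 2(x_1^k + ⋯ + x_m^k)^q` has order `m + 1` over `ℚ`, and `R(F)`
is not dense in `ℚ_p` for infinitely many primes `p`. -/
theorem stmt4 (q k m : ℕ) (hq : q.Prime) (hk : 2 ≤ k) (hm : 0 < m)
    (F : MvPolynomial (Fin (m + 1)) ℤ)
    (hFdef : F = MvPolynomial.X 0 ^ (k * q) +
      MvPolynomial.C 2 *
        (∑ i ∈ Finset.univ.filter (fun i : Fin (m + 1) => i ≠ 0),
          MvPolynomial.X i ^ k) ^ q) :
    formOrder (F.map (Int.castRingHom ℚ)) = m + 1 ∧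
    {p : ℕ | ∃ _ : Fact p.Prime, ¬ Dense (ratioSet p F)}.Infinite := by
  refine ⟨formOrder_X_pow_add_two_mul_sum_pow q k m hq hk F hFdef, ?_⟩
  refine (infinite_setOf_prime_forall_pow_ne_neg_two hq).mono ?_
  rintro p ⟨hp, hpow⟩
  have := Fact.mk hp
  refine ⟨this, not_dense_ratioSet hq.two_le hpow F fun x => ⟨x 0 ^ k, ∑ i with i ≠ 0, x i ^ k, ?_⟩⟩
  subst hFdef
  simp [pow_mul]
end

section
/- Let p be a prime and let q_1 < q_2 < q_3 be primes such that q_1 q_2 q_3 is coprime to p(p−1). Define the polynomial f(x) = x^{q_1 q_2} · ∏_{i=1}^{q_1} (x + p^i)^{q_1 q_3} · (x + p^{q_1+1})^{q_2 q_3} ∈ ℤ[x]. Then R(f) is dense in ℚ_p. -/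
/-- The ratio set of an integral polynomial, viewed in `ℚ_[p]`. -/
def ratioSetPoly (p : ℕ) [Fact p.Prime] (f : Polynomial ℤ) : Set ℚ_[p] :=
  { t | ∃ a b : ℤ, f.eval b ≠ 0 ∧ t = ((f.eval a : ℤ) : ℚ_[p]) / ((f.eval b : ℤ) : ℚ_[p]) }

open Filter Topology in
/-- The value of a ratio at `p`-adic integers lies in the closure of the ratio set. -/
lemma aeval_div_aeval_mem_closure_ratioSetPoly {p : ℕ} [Fact p.Prime] (f : Polynomial ℤ)
    (a b : ℤ_[p]) (hb : Polynomial.aeval (b : ℚ_[p]) f ≠ 0) :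
    Polynomial.aeval (a : ℚ_[p]) f / Polynomial.aeval (b : ℚ_[p]) f ∈
      closure (ratioSetPoly p f) := by
  have heval : ∀ n : ℤ, Polynomial.aeval (n : ℚ_[p]) f = ((f.eval n : ℤ) : ℚ_[p]) := by
    intro n
    have h := Polynomial.aeval_algebraMap_apply_eq_algebraMap_eval (A := ℚ_[p]) n f
    simpa using h
  have hcont : Continuous fun x : ℤ_[p] => Polynomial.aeval (x : ℚ_[p]) f :=
    f.continuous_aeval.comp continuous_subtype_val
  rw [mem_closure_iff_nhds]
  intro V hV
  have hdiv : Tendsto (fun z : ℤ_[p] × ℤ_[p] =>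
      Polynomial.aeval (z.1 : ℚ_[p]) f / Polynomial.aeval (z.2 : ℚ_[p]) f) (𝓝 (a, b))
      (𝓝 (Polynomial.aeval (a : ℚ_[p]) f / Polynomial.aeval (b : ℚ_[p]) f)) :=
    ((hcont.comp continuous_fst).tendsto (a, b)).div ((hcont.comp continuous_snd).tendsto (a, b)) hb
  have hne : ∀ᶠ z : ℤ_[p] × ℤ_[p] in 𝓝 (a, b), Polynomial.aeval (z.2 : ℚ_[p]) f ≠ 0 :=
    ((hcont.comp continuous_snd).tendsto (a, b)).eventually_ne hb
  have hdense : DenseRange (Prod.map (Int.cast : ℤ → ℤ_[p]) (Int.cast : ℤ → ℤ_[p])) :=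
    PadicInt.denseRange_intCast.prodMap PadicInt.denseRange_intCast
  obtain ⟨z, ⟨hzV, hz0⟩, ⟨⟨m, n⟩, rfl⟩⟩ :=
    mem_closure_iff_nhds.1 (hdense (a, b)) _ (inter_mem (hdiv hV) hne)
  simp only [Set.mem_preimage, Set.mem_ofPred_eq, Prod.map_fst, Prod.map_snd,
    PadicInt.coe_intCast, heval] at hzV hz0
  exact ⟨_, hzV, m, n, fun h => hz0 (by simp [h]), rfl⟩

/-- Every `p`-adic unit is an `e`-th power when `e` is coprime to `p * (p - 1)`. -/
lemma PadicInt.exists_pow_eq_of_norm_eq_one {p : ℕ} [Fact p.Prime] {e : ℕ}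
    (he : e.Coprime (p * (p - 1))) (w : ℤ_[p]) (hw : ‖w‖ = 1) : ∃ u : ℤ_[p], u ^ e = w := by
  have hep : e.Coprime p := he.coprime_mul_right_right
  have hcard : (Nat.card (ZMod p)ˣ).Coprime e := by
    rw [Nat.card_eq_fintype_card, ZMod.card_units]
    exact he.coprime_mul_left_right.symm
  obtain ⟨v, hv⟩ := (powCoprime hcard).surjective
    (Units.map (PadicInt.toZMod (p := p)).toMonoidHom (PadicInt.isUnit_iff.2 hw).unit)
  obtain ⟨a, ha⟩ := ZMod.ringHom_surjective (PadicInt.toZMod (p := p)) (v : ZMod p)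
  have hva : PadicInt.toZMod (a ^ e) = PadicInt.toZMod w := by
    have := congrArg Units.val hv
    simpa [← ha] using this
  have hnorm_of_ker : ∀ x : ℤ_[p], PadicInt.toZMod x = 0 ↔ ‖x‖ < 1 := by
    intro x
    rw [← RingHom.mem_ker, PadicInt.ker_toZMod, IsLocalRing.mem_maximalIdeal,
      PadicInt.mem_nonunits]
  have hlt : ‖a ^ e - w‖ < 1 := by
    rw [← hnorm_of_ker, map_sub, hva, sub_self]
  have hanorm : ‖a‖ = 1 := by
    refine le_antisymm (PadicInt.norm_le_one a) (not_lt.1 fun h => v.ne_zero ?_)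
    rw [← ha, (hnorm_of_ker a).2 h]
  have henorm : ‖(e : ℤ_[p])‖ = 1 := by
    refine le_antisymm (PadicInt.norm_le_one _) (not_lt.1 fun h => ?_)
    have h' : p ∣ e := by
      have := (PadicInt.norm_int_lt_one_iff_dvd (p := p) (e : ℤ)).1 (by simpa using h)
      exact_mod_cast this
    have hp : p.Prime := Fact.out
    exact hp.one_lt.ne' (Nat.eq_one_of_dvd_coprimes hep h' dvd_rfl)
  obtain ⟨z, hz, -⟩ := hensels_lemma (p := p)
    (F := (Polynomial.X ^ e - Polynomial.C w : Polynomial ℤ_[p])) (a := a) (by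
      simpa [Polynomial.derivative_X_pow, hanorm, henorm] using hlt)
  exact ⟨z, by simpa [sub_eq_zero] using hz⟩

open Filter Topology in
/-- If `f` has integral roots `α` and `β` of multiplicities `m` and `n`, with `m` coprime to
`p * (p - 1)`, then ratios of values near `α` and near `β` approximate every `t ≠ 0` whose
valuation is a valuation of such ratios. -/
lemma mem_closure_ratioSetPoly_of_roots {p : ℕ} [Fact p.Prime] {f g h : Polynomial ℤ} {α β : ℤ}
    {m n : ℕ} (hm : 0 < m) (hn : 0 < n)
    (hg : f = (Polynomial.X - Polynomial.C α) ^ m * g)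
    (hh : f = (Polynomial.X - Polynomial.C β) ^ n * h)
    (hgα : g.eval α ≠ 0) (hhβ : h.eval β ≠ 0) (hcop : m.Coprime (p * (p - 1)))
    {t : ℚ_[p]} (ht : t ≠ 0) (k l : ℤ)
    (hkl : t.valuation = k * m + ((g.eval α : ℤ) : ℚ_[p]).valuation
      - (l * n + ((h.eval β : ℤ) : ℚ_[p]).valuation)) :
    t ∈ closure (ratioSetPoly p f) := by
  obtain ⟨K, L, hKL⟩ : ∃ K L : ℕ, (K * m - L * n : ℤ) = k * m - l * n := by
    have hm' : (1 : ℤ) ≤ m := by exact_mod_cast hm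
    have hn' : (1 : ℤ) ≤ n := by exact_mod_cast hn
    have hK : 0 ≤ k + (|k| + |l|) * n := by nlinarith [neg_abs_le k, abs_nonneg k, abs_nonneg l]
    have hL : 0 ≤ l + (|k| + |l|) * m := by nlinarith [neg_abs_le l, abs_nonneg k, abs_nonneg l]
    refine ⟨(k + (|k| + |l|) * n).toNat, (l + (|k| + |l|) * m).toNat, ?_⟩
    rw [Int.toNat_of_nonneg hK, Int.toNat_of_nonneg hL]
    ring
  set G : ℚ_[p] := ((g.eval α : ℤ) : ℚ_[p]) with hG
  set H : ℚ_[p] := ((h.eval β : ℤ) : ℚ_[p]) with hH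
  have hG0 : G ≠ 0 := by rw [hG]; exact_mod_cast hgα
  have hH0 : H ≠ 0 := by rw [hH]; exact_mod_cast hhβ
  have hp : p.Prime := Fact.out
  have hp0 : (p : ℚ_[p]) ≠ 0 := by exact_mod_cast hp.ne_zero
  have hw : ‖t * (p ^ (L * n) * H) / (p ^ (K * m) * G)‖ = 1 := by
    have hpL : (p : ℚ_[p]) ^ (L * n) ≠ 0 := pow_ne_zero _ hp0
    have hpK : (p : ℚ_[p]) ^ (K * m) ≠ 0 := pow_ne_zero _ hp0
    have hden := mul_ne_zero hpK hG0
    have hnum := mul_ne_zero ht (mul_ne_zero hpL hH0)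
    rw [Padic.norm_eq_zpow_neg_valuation (div_ne_zero hnum hden), div_eq_mul_inv,
      Padic.valuation_mul hnum (inv_ne_zero hden), Padic.valuation_inv,
      Padic.valuation_mul ht (mul_ne_zero hpL hH0), Padic.valuation_mul hpL hH0,
      Padic.valuation_mul hpK hG0, Padic.valuation_pow, Padic.valuation_pow, Padic.valuation_p,
      hkl]
    push_cast
    convert zpow_zero _ using 2
    linarith
  obtain ⟨u, hu⟩ := PadicInt.exists_pow_eq_of_norm_eq_one hcop ⟨_, hw.le⟩ hw
  have hu' : (u : ℚ_[p]) ^ m = t * (p ^ (L * n) * H) / (p ^ (K * m) * G) := by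
    exact_mod_cast congrArg Subtype.val hu
  have hGα : Polynomial.aeval (α : ℚ_[p]) g = G := by
    simpa using Polynomial.aeval_algebraMap_apply_eq_algebraMap_eval (A := ℚ_[p]) α g
  have hHβ : Polynomial.aeval (β : ℚ_[p]) h = H := by
    simpa using Polynomial.aeval_algebraMap_apply_eq_algebraMap_eval (A := ℚ_[p]) β h
  have hpow : ∀ c d : ℕ, 0 < d → Tendsto (fun s : ℕ => (p : ℚ_[p]) ^ (c + s * d)) atTop (𝓝 0) :=
    fun c d hd => (tendsto_pow_atTop_nhds_zero_of_norm_lt_one Padic.norm_p_lt_one).comp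
      (tendsto_atTop_mono (fun s => (Nat.le_mul_of_pos_right s hd).trans (Nat.le_add_left _ c))
        tendsto_id)
  let a : ℕ → ℤ_[p] := fun s => α + p ^ (K + s * n) * u
  let b : ℕ → ℤ_[p] := fun s => β + p ^ (L + s * m)
  have ha : ∀ s, ((a s : ℤ_[p]) : ℚ_[p]) = α + p ^ (K + s * n) * u := fun s => by simp [a]
  have hb : ∀ s, ((b s : ℤ_[p]) : ℚ_[p]) = β + p ^ (L + s * m) := fun s => by simp [b]
  have hga : Tendsto (fun s => Polynomial.aeval (a s : ℚ_[p]) g) atTop (𝓝 G) := by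
    rw [← hGα]
    refine (g.continuous_aeval.tendsto _).comp ?_
    simp only [ha]
    simpa using ((hpow K n hn).mul_const (u : ℚ_[p])).const_add (α : ℚ_[p])
  have hhb : Tendsto (fun s => Polynomial.aeval (b s : ℚ_[p]) h) atTop (𝓝 H) := by
    rw [← hHβ]
    refine (h.continuous_aeval.tendsto _).comp ?_
    simp only [hb]
    simpa using (hpow L m hm).const_add (β : ℚ_[p])
  have hfa : ∀ s, Polynomial.aeval (a s : ℚ_[p]) f =
      (p ^ (s * (m * n)) * (p ^ (K * m) * u ^ m)) * Polynomial.aeval (a s : ℚ_[p]) g := by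
    intro s
    rw [hg, map_mul, ha]
    simp only [map_pow, map_sub, Polynomial.aeval_X, Polynomial.aeval_C]
    rw [eq_intCast, add_sub_cancel_left]
    ring
  have hfb : ∀ s, Polynomial.aeval (b s : ℚ_[p]) f =
      (p ^ (s * (m * n)) * p ^ (L * n)) * Polynomial.aeval (b s : ℚ_[p]) h := by
    intro s
    rw [hh, map_mul, hb]
    simp only [map_pow, map_sub, Polynomial.aeval_X, Polynomial.aeval_C]
    rw [eq_intCast, add_sub_cancel_left]
    ring
  have hlim : Tendsto (fun s => Polynomial.aeval (a s : ℚ_[p]) f / Polynomial.aeval (b s : ℚ_[p]) f)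
      atTop (𝓝 t) := by
    have h1 := ((hga.const_mul ((p : ℚ_[p]) ^ (K * m) * (u : ℚ_[p]) ^ m)).div
      (hhb.const_mul ((p : ℚ_[p]) ^ (L * n))) (mul_ne_zero (pow_ne_zero _ hp0) hH0))
    have h2 : (p : ℚ_[p]) ^ (K * m) * (u : ℚ_[p]) ^ m * G / (p ^ (L * n) * H) = t := by
      rw [hu']
      field_simp
    rw [h2] at h1
    refine h1.congr fun s => ?_
    rw [hfa, hfb, mul_assoc (_ ^ (s * _)), mul_assoc (_ ^ (s * _)),
      mul_div_mul_left _ _ (pow_ne_zero _ hp0)]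
    rfl
  refine isClosed_closure.mem_of_tendsto hlim ?_
  filter_upwards [hhb.eventually_ne hH0] with s hs
  refine aeval_div_aeval_mem_closure_ratioSetPoly f (a s) (b s) ?_
  rw [hfb]
  exact mul_ne_zero (mul_ne_zero (pow_ne_zero _ hp0) (pow_ne_zero _ hp0)) hs

/-- Let `p` be a prime and `q₁ < q₂ < q₃` primes with `q₁q₂q₃` coprime to `p(p-1)`. For
`f(x) = x^{q₁q₂} ∏_{i=1}^{q₁} (x + p^i)^{q₁q₃} · (x + p^{q₁+1})^{q₂q₃}`, the ratio set
`R(f)` is dense in `ℚ_p`. -/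
theorem stmt5 (p q1 q2 q3 : ℕ) [Fact p.Prime]
    (h1 : q1.Prime) (h2 : q2.Prime) (h3 : q3.Prime)
    (h12 : q1 < q2) (h23 : q2 < q3)
    (hcop : Nat.Coprime (q1 * q2 * q3) (p * (p - 1)))
    (f : Polynomial ℤ)
    (hf : f = Polynomial.X ^ (q1 * q2) *
      (∏ i ∈ Finset.Icc 1 q1, (Polynomial.X + Polynomial.C ((p : ℤ) ^ i)) ^ (q1 * q3)) *
      (Polynomial.X + Polynomial.C ((p : ℤ) ^ (q1 + 1))) ^ (q2 * q3)) :
    Dense (ratioSetPoly p f) := by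
  have hp : p.Prime := Fact.out
  have hpZ : (p : ℤ) ≠ 0 := by exact_mod_cast hp.ne_zero
  have hpQ : (p : ℚ_[p]) ≠ 0 := by exact_mod_cast hp.ne_zero
  have hinj : ∀ {i j : ℕ}, i ≠ j → (p : ℤ) ^ i ≠ (p : ℤ) ^ j := fun hij h =>
    hij (Nat.pow_right_injective hp.two_le (by exact_mod_cast h))
  have hbez : IsCoprime ((q2 * q3 : ℕ) : ℤ) (q1 : ℤ) := by
    rw [Nat.isCoprime_iff_coprime]
    exact Nat.Coprime.mul_left ((Nat.coprime_primes h2 h1).2 h12.ne')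
      ((Nat.coprime_primes h3 h1).2 (h12.trans h23).ne')
  obtain ⟨x, y, hxy⟩ := hbez
  have hbez23 : IsCoprime (q2 : ℤ) (q3 : ℤ) := by
    rw [Nat.isCoprime_iff_coprime]
    exact (Nat.coprime_primes h2 h3).2 h23.ne
  obtain ⟨z, w, hzw⟩ := hbez23
  have hmain : ∀ t : ℚ_[p], t ≠ 0 → t ∈ closure (ratioSetPoly p f) := by
    intro t ht
    set v := t.valuation with hv
    obtain ⟨i, hi1, hi2, d, hid⟩ : ∃ i : ℕ, 1 ≤ i ∧ i ≤ q1 ∧ ∃ d : ℤ, (i : ℤ) = 1 - x * v + q1 * d := by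
      have hq : (0 : ℤ) < q1 := by exact_mod_cast h1.pos
      have hr0 := Int.emod_nonneg (-(x * v)) hq.ne'
      have hr1 := Int.emod_lt_of_pos (-(x * v)) hq
      have hr2 := Int.mul_ediv_add_emod (-(x * v)) q1
      exact ⟨((-(x * v)) % q1 + 1).toNat, by omega, by omega, -((-(x * v)) / q1), by
        rw [Int.toNat_of_nonneg (by omega)]; linarith⟩
    have hi : i ∈ Finset.Icc 1 q1 := Finset.mem_Icc.2 ⟨hi1, hi2⟩
    set T : Polynomial ℤ := (Polynomial.X + Polynomial.C ((p : ℤ) ^ (q1 + 1))) ^ (q2 * q3) with hT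
    set A : Polynomial ℤ :=
      ∏ j ∈ Finset.Icc 1 q1, (Polynomial.X + Polynomial.C ((p : ℤ) ^ j)) ^ q3 with hA
    set B : Polynomial ℤ := Polynomial.X ^ q2 *
      ∏ j ∈ (Finset.Icc 1 q1).erase i, (Polynomial.X + Polynomial.C ((p : ℤ) ^ j)) ^ q3 with hB
    have hfA : f = (Polynomial.X - Polynomial.C 0) ^ (q1 * q2) * (A ^ q1 * T) := by
      rw [hf, hA, ← Finset.prod_pow]
      simp only [← pow_mul, mul_comm q3 q1, map_zero, sub_zero, mul_assoc]
    have hfB : f = (Polynomial.X - Polynomial.C (-(p : ℤ) ^ i)) ^ (q1 * q3) * (B ^ q1 * T) := by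
      rw [hf, hB, mul_pow, ← Finset.prod_pow, ← Finset.mul_prod_erase _ _ hi]
      simp only [← pow_mul, mul_comm q3 q1, mul_comm q2 q1, map_neg, sub_neg_eq_add]
      ring
    have hA0 : A.eval 0 ≠ 0 := by
      simp [hA, Polynomial.eval_prod, Finset.prod_ne_zero_iff, hp.ne_zero]
    have hB0 : B.eval (-(p : ℤ) ^ i) ≠ 0 := by
      rw [hB, Polynomial.eval_mul, Polynomial.eval_prod]
      refine mul_ne_zero (by simp [hp.ne_zero]) (Finset.prod_ne_zero_iff.2 fun j hj => ?_)
      have := hinj (Finset.ne_of_mem_erase hj)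
      simp only [Polynomial.eval_pow, Polynomial.eval_add, Polynomial.eval_X, Polynomial.eval_C]
      refine pow_ne_zero _ fun h => this ?_
      linarith
    have hT0 : T.eval 0 = ((p : ℤ) ^ (q1 + 1)) ^ (q2 * q3) := by simp [hT]
    have hTi : T.eval (-(p : ℤ) ^ i) = ((p : ℤ) ^ i * (p ^ (q1 + 1 - i) - 1)) ^ (q2 * q3) := by
      have : q1 + 1 = i + (q1 + 1 - i) := by omega
      simp only [hT, Polynomial.eval_pow, Polynomial.eval_add, Polynomial.eval_X, Polynomial.eval_C]
      congr 1
      rw [mul_sub, ← pow_add, ← this]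
      ring
    have hunit : ((p : ℚ_[p]) ^ (q1 + 1 - i) - 1) ≠ 0 := by
      have := hinj (i := q1 + 1 - i) (j := 0) (by omega)
      rw [sub_ne_zero]
      exact_mod_cast this
    have hunitv : ((p : ℚ_[p]) ^ (q1 + 1 - i) - 1).valuation = 0 := by
      have hco : IsCoprime ((p : ℤ) ^ (q1 + 1 - i) - 1) (p : ℤ) := by
        refine ⟨-1, (p : ℤ) ^ (q1 - i), ?_⟩
        rw [← pow_succ, show q1 - i + 1 = q1 + 1 - i by omega]
        ring
      have h := Padic.norm_intCast_eq_one_iff.2 hco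
      push_cast at h
      rw [Padic.norm_eq_zpow_neg_valuation hunit] at h
      have hp1 : (1 : ℝ) < p := by exact_mod_cast hp.one_lt
      have := zpow_right_injective₀ (zero_lt_one.trans hp1) hp1.ne' (h.trans (zpow_zero _).symm)
      linarith
    have hAQ : ((A.eval 0 : ℤ) : ℚ_[p]) ≠ 0 := by exact_mod_cast hA0
    have hBQ : ((B.eval (-(p : ℤ) ^ i) : ℤ) : ℚ_[p]) ≠ 0 := by exact_mod_cast hB0
    have hTi' : ((p : ℤ) ^ i * (p ^ (q1 + 1 - i) - 1)) ^ (q2 * q3) ≠ 0 := by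
      refine pow_ne_zero _ (mul_ne_zero (pow_ne_zero _ hpZ) ?_)
      exact_mod_cast hunit
    have hgval : (((A ^ q1 * T).eval 0 : ℤ) : ℚ_[p]).valuation =
        q1 * ((A.eval 0 : ℤ) : ℚ_[p]).valuation + (q2 * q3) * (q1 + 1) := by
      rw [Polynomial.eval_mul, Polynomial.eval_pow, hT0]
      push_cast
      rw [Padic.valuation_mul (pow_ne_zero _ hAQ) (pow_ne_zero _ (pow_ne_zero _ hpQ)),
        Padic.valuation_pow, Padic.valuation_pow, Padic.valuation_pow, Padic.valuation_p]
      push_cast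
      ring
    have hhval : (((B ^ q1 * T).eval (-(p : ℤ) ^ i) : ℤ) : ℚ_[p]).valuation =
        q1 * ((B.eval (-(p : ℤ) ^ i) : ℤ) : ℚ_[p]).valuation + (q2 * q3) * i := by
      rw [Polynomial.eval_mul, Polynomial.eval_pow, hTi]
      push_cast
      rw [Padic.valuation_mul (pow_ne_zero _ hBQ)
          (pow_ne_zero _ (mul_ne_zero (pow_ne_zero _ hpQ) hunit)),
        Padic.valuation_pow, Padic.valuation_pow, Padic.valuation_mul (pow_ne_zero _ hpQ) hunit,
        Padic.valuation_pow, Padic.valuation_p, hunitv]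
      push_cast
      ring
    set a := ((A.eval 0 : ℤ) : ℚ_[p]).valuation
    set b := ((B.eval (-(p : ℤ) ^ i) : ℤ) : ℚ_[p]).valuation
    set c : ℤ := y * v + q2 * q3 * d - q2 * q3 - a + b with hc
    refine mem_closure_ratioSetPoly_of_roots (Nat.mul_pos h1.pos h2.pos) (Nat.mul_pos h1.pos h3.pos)
      hfA hfB ?_ ?_ hcop.coprime_mul_right ht (c * z) (-(c * w)) ?_
    · rw [Polynomial.eval_mul, Polynomial.eval_pow, hT0]
      exact mul_ne_zero (pow_ne_zero _ hA0) (pow_ne_zero _ (pow_ne_zero _ hpZ))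
    · rw [Polynomial.eval_mul, Polynomial.eval_pow, hTi]
      exact mul_ne_zero (pow_ne_zero _ hB0) hTi'
    · rw [hgval, hhval, hid, ← hv]
      push_cast at hxy ⊢
      linear_combination (-v) * hxy - q1 * c * hzw - q1 * hc
  rw [← dense_closure]
  exact (dense_compl_singleton (0 : ℚ_[p])).mono fun t ht => hmain t ht
end

section
/- Let p be a prime and let q_1 < q_2 < q_3 be primes such that q_1 q_2 q_3 is coprime to p(p−1). Define the polynomial f(x) = x^{q_1 q_2} · ∏_{i=1}^{q_1} (x + p^i)^{q_1 q_3} · (x + p^{q_1+1})^{q_2 q_3} ∈ ℤ[x]. Then for every prime q > p^{q_1+1}, R(f) is NOT dense in ℚ_q. -/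
/-- If at most one of the nonzero integers `A`, `B`, `C` is divisible by `q`, then the `q`-adic
valuation of `A ^ k * B ^ l * C ^ m` is a multiple of one of the exponents. -/
theorem dvd_padicValInt_mul_pow {q : ℕ} [Fact q.Prime] {A B C : ℤ} {k l m : ℕ}
    (hA : A ≠ 0) (hB : B ≠ 0) (hC : C ≠ 0)
    (hAB : ¬ ((q : ℤ) ∣ A ∧ (q : ℤ) ∣ B)) (hAC : ¬ ((q : ℤ) ∣ A ∧ (q : ℤ) ∣ C))
    (hBC : ¬ ((q : ℤ) ∣ B ∧ (q : ℤ) ∣ C)) :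
    k ∣ padicValInt q (A ^ k * B ^ l * C ^ m) ∨ l ∣ padicValInt q (A ^ k * B ^ l * C ^ m) ∨
      m ∣ padicValInt q (A ^ k * B ^ l * C ^ m) := by
  have hval : padicValInt q (A ^ k * B ^ l * C ^ m) =
      k * padicValInt q A + l * padicValInt q B + m * padicValInt q C := by
    rw [padicValInt.mul (mul_ne_zero (pow_ne_zero _ hA) (pow_ne_zero _ hB)) (pow_ne_zero _ hC),
      padicValInt.mul (pow_ne_zero _ hA) (pow_ne_zero _ hB)]
    simp only [padicValInt, Int.natAbs_pow]
    rw [padicValNat.pow, padicValNat.pow, padicValNat.pow]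
  rw [hval]
  have hzero : ∀ n : ℤ, ¬ (q : ℤ) ∣ n → padicValInt q n = 0 :=
    fun n hn ↦ padicValInt.eq_zero_of_not_dvd hn
  by_cases hqA : (q : ℤ) ∣ A
  · left
    simp [hzero B (fun h ↦ hAB ⟨hqA, h⟩), hzero C (fun h ↦ hAC ⟨hqA, h⟩)]
  · by_cases hqB : (q : ℤ) ∣ B
    · right; left
      simp [hzero A hqA, hzero C (fun h ↦ hBC ⟨hqB, h⟩)]
    · right; right
      simp [hzero A hqA, hzero B hqB]

/-- A number `q > p ^ n` does not divide `p ^ n - p ^ i` for `i < n`. -/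
theorem not_dvd_pow_sub_pow {p q i n : ℕ} (hp : 1 < p) (hq : p ^ n < q) (hi : i < n) :
    ¬ (q : ℤ) ∣ (p : ℤ) ^ n - (p : ℤ) ^ i := by
  intro h
  have hlt : (p : ℤ) ^ i < (p : ℤ) ^ n := by exact_mod_cast Nat.pow_lt_pow_right hp hi
  have hle := Int.le_of_dvd (by linarith) h
  have hq' : (p : ℤ) ^ n < q := by exact_mod_cast hq
  have : (0 : ℤ) ≤ (p : ℤ) ^ i := by positivity
  linarith

/-- A polynomial whose nonzero values never have `q`-adic valuations differing by one has a ratio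
set that is not dense in `ℚ_[q]`. -/
theorem not_dense_ratioSetPoly {q : ℕ} [Fact q.Prime] {f : Polynomial ℤ}
    (h : ∀ a b : ℤ, f.eval a ≠ 0 → f.eval b ≠ 0 →
      padicValInt q (f.eval a) ≠ padicValInt q (f.eval b) + 1) :
    ¬ Dense (ratioSetPoly q f) := by
  intro hd
  have hq0 : (q : ℚ_[q]) ≠ 0 := by exact_mod_cast (Fact.out : q.Prime).ne_zero
  obtain ⟨t, ⟨a, b, hb, rfl⟩, ht⟩ := hd.exists_dist_lt (q : ℚ_[q]) (norm_pos_iff.mpr hq0)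
  set t : ℚ_[q] := ((f.eval a : ℤ) : ℚ_[q]) / ((f.eval b : ℤ) : ℚ_[q]) with ht_def
  rw [dist_eq_norm] at ht
  have hnorm : ‖t‖ = ‖(q : ℚ_[q])‖ := (Padic.norm_eq_of_norm_sub_lt_left ht).symm
  have ht0 : t ≠ 0 := by
    rw [← norm_pos_iff, hnorm]
    exact norm_pos_iff.mpr hq0
  have hb' : ((f.eval b : ℤ) : ℚ_[q]) ≠ 0 := by exact_mod_cast hb
  have ha' : ((f.eval a : ℤ) : ℚ_[q]) ≠ 0 := by
    intro h0
    exact ht0 (by rw [ht_def, h0, zero_div])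
  have hval : t.valuation = 1 := by
    rw [Padic.norm_eq_zpow_neg_valuation ht0, Padic.norm_p, ← zpow_neg_one] at hnorm
    have hq1 : (1 : ℝ) < q := by exact_mod_cast (Fact.out : q.Prime).one_lt
    have := zpow_right_injective₀ (by linarith) hq1.ne' hnorm
    omega
  have hmul := Padic.valuation_mul ht0 hb'
  rw [ht_def, div_mul_cancel₀ _ hb', ← ht_def, hval, Padic.valuation_intCast,
    Padic.valuation_intCast] at hmul
  exact h a b (by exact_mod_cast ha') hb (by omega)

/-- Let `p` be a prime and `q₁ < q₂ < q₃` primes with `q₁q₂q₃` coprime to `p(p-1)`. For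
`f(x) = x^{q₁q₂} ∏_{i=1}^{q₁} (x + p^i)^{q₁q₃} · (x + p^{q₁+1})^{q₂q₃}` and every prime
`q > p^{q₁+1}`, the ratio set `R(f)` is not dense in `ℚ_q`. -/
theorem stmt6 (p q1 q2 q3 : ℕ) [Fact p.Prime]
    (h1 : q1.Prime) (h2 : q2.Prime) (h3 : q3.Prime)
    (h12 : q1 < q2) (h23 : q2 < q3)
    (hcop : Nat.Coprime (q1 * q2 * q3) (p * (p - 1)))
    (f : Polynomial ℤ)
    (hf : f = Polynomial.X ^ (q1 * q2) *
      (∏ i ∈ Finset.Icc 1 q1, (Polynomial.X + Polynomial.C ((p : ℤ) ^ i)) ^ (q1 * q3)) *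
      (Polynomial.X + Polynomial.C ((p : ℤ) ^ (q1 + 1))) ^ (q2 * q3)) :
    ∀ q : ℕ, ∀ _ : Fact q.Prime, p ^ (q1 + 1) < q → ¬ Dense (ratioSetPoly q f) := by
  intro q _ hq
  have hp : 1 < p := (Fact.out : p.Prime).one_lt
  have hqp : ∀ i : ℕ, ¬ (q : ℤ) ∣ (p : ℤ) ^ i := by
    intro i h
    have hdvd : q ∣ p := (Fact.out : q.Prime).dvd_of_dvd_pow (by exact_mod_cast h)
    exact absurd ((Nat.le_of_dvd (by omega) hdvd).trans (Nat.le_self_pow (by omega) p))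
      (not_le.mpr hq)
  have heval : ∀ a : ℤ, f.eval a = a ^ (q1 * q2) *
      (∏ i ∈ Finset.Icc 1 q1, (a + (p : ℤ) ^ i)) ^ (q1 * q3) *
        (a + (p : ℤ) ^ (q1 + 1)) ^ (q2 * q3) := by
    intro a
    simp [hf, Polynomial.eval_prod, Finset.prod_pow]
  have hdvd : ∀ a : ℤ, f.eval a ≠ 0 → q1 * q2 ∣ padicValInt q (f.eval a) ∨
      q1 * q3 ∣ padicValInt q (f.eval a) ∨ q2 * q3 ∣ padicValInt q (f.eval a) := by
    intro a ha
    rw [heval] at ha ⊢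
    have hqZ : Prime (q : ℤ) := Nat.prime_iff_prime_int.mp Fact.out
    refine dvd_padicValInt_mul_pow ?_ ?_ ?_ ?_ ?_ ?_
    · rintro rfl
      simp [h1.ne_zero, h2.ne_zero] at ha
    · intro h0
      simp [h0, h1.ne_zero, h3.ne_zero] at ha
    · intro h0
      simp [h0, h2.ne_zero, h3.ne_zero] at ha
    · rintro ⟨hA, hB⟩
      obtain ⟨i, -, hi⟩ := hqZ.exists_mem_finset_dvd hB
      exact hqp i ((dvd_add_right hA).mp hi)
    · rintro ⟨hA, hC⟩
      exact hqp _ ((dvd_add_right hA).mp hC)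
    · rintro ⟨hB, hC⟩
      obtain ⟨i, hmem, hi⟩ := hqZ.exists_mem_finset_dvd hB
      have hlt : i < q1 + 1 := Nat.lt_succ_of_le (Finset.mem_Icc.mp hmem).2
      refine not_dvd_pow_sub_pow hp hq hlt ?_
      simpa using dvd_sub hC hi
  refine not_dense_ratioSetPoly fun a b ha hb hab ↦ ?_
  have hcommon : ∀ r : ℕ, r.Prime → r ∣ padicValInt q (f.eval a) →
      ¬ r ∣ padicValInt q (f.eval b) := by
    intro r hr hra hrb
    rw [hab] at hra
    exact hr.one_lt.ne' (Nat.dvd_one.mp ((Nat.dvd_add_right hrb).mp hra))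
  have hc1 := hcommon q1 h1
  have hc2 := hcommon q2 h2
  have hc3 := hcommon q3 h3
  have hl : ∀ {x y z : ℕ}, x * y ∣ z → x ∣ z := fun h ↦ dvd_of_mul_right_dvd h
  have hr : ∀ {x y z : ℕ}, x * y ∣ z → y ∣ z := fun h ↦ dvd_of_mul_left_dvd h
  rcases hdvd a ha with h | h | h <;> rcases hdvd b hb with h' | h' | h' <;>
    first
      | exact hc1 (hl h) (hl h')
      | exact hc2 (hr h) (hl h')
      | exact hc2 (hl h) (hr h')
      | exact hc3 (hr h) (hr h')
end

section
/- Let p be a prime and let q_1 < q_2 < q_3 be primes such that q_1 q_2 q_3 is coprime to p(p−1). Define the binary form g_2(x_1,x_2) = x_1^{q_1 q_2} · ∏_{i=1}^{q_1} (x_1 + p^i x_2)^{q_1 q_3} · (x_1 + p^{q_1+1} x_2)^{q_2 q_3} · ∏_{i=1}^{q_3−1} (p^i x_1 + x_2)^{q_1 q_2} · ∏_{i=q_3}^{q_3+q_2−q_1−1} (p^i x_1 + x_2)^{q_1 q_3} · ∏_{i=q_3+q_2−q_1}^{q_3+q_2−2} (p^i x_1 + x_2)^{q_2 q_3} ∈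 ℤ[x_1,x_2]. Then R(g_2) is dense in ℚ_p. -/
open MvPolynomial

open Filter Topology

lemma PadicInt.exists_pow_eq_of_coprime {p q : ℕ} [Fact p.Prime]
    (hq : q.Coprime (p * (p - 1))) {u : ℤ_[p]} (hu : IsUnit u) : ∃ v : ℤ_[p], v ^ q = u := by
  have hqp : q.Coprime p := Nat.Coprime.coprime_mul_right_right hq
  have hq1 : q.Coprime (p - 1) := Nat.Coprime.coprime_mul_left_right hq
  obtain ⟨w, hw⟩ : ∃ w : (ZMod p)ˣ,
      w ^ q = Units.map (PadicInt.toZMod (p := p)).toMonoidHom hu.unit := by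
    have hc : (Nat.card (ZMod p)ˣ).Coprime q := by
      rw [Nat.card_eq_fintype_card, ZMod.card_units]
      exact hq1.symm
    exact (powCoprime hc).surjective _
  have hw' : (w : ZMod p) ^ q = PadicInt.toZMod u := by
    have := congrArg Units.val hw
    simpa using this
  obtain ⟨a, ha⟩ := ZMod.ringHom_surjective (PadicInt.toZMod (p := p)) (w : ZMod p)
  have hlt {x : ℤ_[p]} : ‖x‖ < 1 ↔ PadicInt.toZMod x = 0 := by
    rw [← PadicInt.mem_nonunits, ← IsLocalRing.mem_maximalIdeal, ← PadicInt.ker_toZMod,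
      RingHom.mem_ker]
  have hone {x : ℤ_[p]} (hx : PadicInt.toZMod x ≠ 0) : ‖x‖ = 1 :=
    le_antisymm (PadicInt.norm_le_one x) (not_lt.1 fun h => hx (hlt.1 h))
  have hna : ‖a‖ = 1 := hone (by rw [ha]; exact w.ne_zero)
  have hnq : ‖(q : ℤ_[p])‖ = 1 := by
    refine hone ?_
    rw [map_natCast, Ne, ZMod.natCast_eq_zero_iff]
    exact (Nat.Prime.coprime_iff_not_dvd Fact.out).1 hqp.symm
  obtain ⟨z, hz, -⟩ := hensels_lemma (p := p) (R := ℤ_[p])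
    (F := (Polynomial.X ^ q - Polynomial.C u : Polynomial ℤ_[p])) (a := a) (by
      have h : ‖a ^ q - u‖ < 1 := by rw [hlt, map_sub, map_pow, ha, hw', sub_self]
      simpa [Polynomial.derivative_X_pow, hna, hnq] using h)
  refine ⟨z, ?_⟩
  simpa [sub_eq_zero] using hz

lemma Padic.exists_pow_eq_of_norm_eq {p q : ℕ} [Fact p.Prime]
    (hq : q.Coprime (p * (p - 1))) {z : ℚ_[p]} {k : ℤ} (hz : ‖z‖ = (p : ℝ) ^ ((q : ℤ) * k)) :
    ∃ a : ℚ_[p], a ^ q = z := by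
  have hp : (p : ℚ_[p]) ≠ 0 := by exact_mod_cast (Fact.out : p.Prime).ne_zero
  have hpr : (p : ℝ) ≠ 0 := by exact_mod_cast (Fact.out : p.Prime).ne_zero
  have hn : ‖z * (p : ℚ_[p]) ^ ((q : ℤ) * k)‖ = 1 := by
    rw [norm_mul, hz, Padic.norm_p_zpow, ← zpow_add₀ hpr]
    simp
  obtain ⟨v, hv⟩ := PadicInt.exists_pow_eq_of_coprime hq
    (u := ⟨z * (p : ℚ_[p]) ^ ((q : ℤ) * k), hn.le⟩) (PadicInt.isUnit_iff.2 hn)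
  have hv' : (v : ℚ_[p]) ^ q = z * (p : ℚ_[p]) ^ ((q : ℤ) * k) := by
    simpa using congrArg (Subtype.val) hv
  refine ⟨v * (p : ℚ_[p]) ^ (-k), ?_⟩
  rw [mul_pow, hv', ← zpow_natCast, ← zpow_mul, mul_assoc, ← zpow_add₀ hp]
  have : (q : ℤ) * k + -k * q = 0 := by ring
  rw [this, zpow_zero, mul_one]

lemma Padic.exists_tendsto_zero_pow_eq_mul_pow {p m n : ℕ} [Fact p.Prime] (hmn : m.Coprime n)
    (hm : m ≠ 0) (hn : n ≠ 0) {c : ℚ_[p]} (hc : c ≠ 0) :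
    ∃ s t : ℕ → ℚ_[p], Tendsto s atTop (𝓝 0) ∧ Tendsto t atTop (𝓝 0) ∧ (∀ j, t j ≠ 0) ∧
      ∀ j, s j ^ m = c * t j ^ n := by
  have hp : (p : ℚ_[p]) ≠ 0 := by exact_mod_cast (Fact.out : p.Prime).ne_zero
  have key (x : ℚ_[p]) {k : ℕ} (hk : k ≠ 0) :
      Tendsto (fun j : ℕ => x * ((p : ℚ_[p]) ^ k) ^ j) atTop (𝓝 0) := by
    have h : ‖(p : ℚ_[p]) ^ k‖ < 1 := by
      rw [norm_pow]
      exact pow_lt_one₀ (norm_nonneg _) Padic.norm_p_lt_one hk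
    simpa using (tendsto_pow_atTop_nhds_zero_of_norm_lt_one h).const_mul x
  have hb : (1 : ℤ) = m * m.gcdA n + n * m.gcdB n := by
    rw [← Nat.gcd_eq_gcd_ab, hmn.gcd_eq_one, Nat.cast_one]
  refine ⟨_, _, key (c ^ m.gcdA n) hn, key (c ^ (-m.gcdB n)) hm, fun j => ?_, fun j => ?_⟩
  · exact mul_ne_zero (zpow_ne_zero _ hc) (pow_ne_zero _ (pow_ne_zero _ hp))
  · have e : (c ^ m.gcdA n) ^ m = c * (c ^ (-m.gcdB n)) ^ n := by
      rw [← zpow_natCast, ← zpow_natCast, ← zpow_mul, ← zpow_mul, ← zpow_one_add₀ hc]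
      congr 1
      linarith
    rw [mul_pow, mul_pow, e]
    ring

lemma Padic.pow_mul_div_pow_mem_of_isClosed {p l m n M : ℕ} [Fact p.Prime] (hmn : m.Coprime n)
    (hm : m ≠ 0) (hn : n ≠ 0) {S : Set ℚ_[p]} (hS : IsClosed S) {f A₁ A₂ B : ℚ_[p] → ℚ_[p]}
    {r : ℚ_[p]} (hr : ‖r‖ ≤ 1)
    (hf : ∀ s t : ℚ_[p], ‖s‖ ≤ 1 → ‖t‖ ≤ 1 → f t ≠ 0 → f s / f t ∈ S)
    (hA₁ : Continuous A₁) (hA₂ : Continuous A₂) (hB : Continuous B)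
    (hA₁0 : A₁ 0 ≠ 0) (hA₂0 : A₂ 0 ≠ 0) (hBr : B r ≠ 0)
    (hf₁ : ∀ s, f s = (s ^ m * A₁ s) ^ l * B s ^ M)
    (hf₂ : ∀ t, f (r + t) = (t ^ n * A₂ t) ^ l * B (r + t) ^ M)
    {a : ℚ_[p]} (ha : a ≠ 0) : a ^ l * (B 0 / B r) ^ M ∈ S := by
  obtain ⟨s, t, hs, ht, ht0, hst⟩ := Padic.exists_tendsto_zero_pow_eq_mul_pow (p := p) hmn hm hn
    (c := a * A₂ 0 / A₁ 0) (by positivity)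
  have hrt : Tendsto (fun j => r + t j) atTop (𝓝 r) := by simpa using ht.const_add r
  have h₁ := (hA₁.tendsto 0).comp hs
  have h₂ := (hA₂.tendsto 0).comp ht
  have hB0 := (hB.tendsto 0).comp hs
  have hB1 := (hB.tendsto r).comp hrt
  have hlim : Tendsto (fun j => (a * A₂ 0 / A₁ 0 * (A₁ (s j) / A₂ (t j))) ^ l *
      (B (s j) / B (r + t j)) ^ M) atTop (𝓝 (a ^ l * (B 0 / B r) ^ M)) := by
    have h := (((h₁.div h₂ hA₂0).const_mul (a * A₂ 0 / A₁ 0)).pow l).mul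
      ((hB0.div hB1 hBr).pow M)
    have e : a * A₂ 0 / A₁ 0 * (A₁ 0 / A₂ 0) = a := by field_simp
    rwa [e] at h
  refine hS.mem_of_tendsto hlim ?_
  have hnorm {u : ℕ → ℚ_[p]} (hu : Tendsto u atTop (𝓝 0)) : ∀ᶠ j in atTop, ‖u j‖ ≤ 1 := by
    have := hu.norm
    rw [norm_zero] at this
    exact this.eventually_le_const one_pos
  filter_upwards [hnorm hs, hnorm ht, h₂.eventually_ne hA₂0, hB1.eventually_ne hBr]
    with j hsj htj hA hBj
  simp only [Function.comp_apply] at hA hBj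
  have htj0 := ht0 j
  have hft : f (r + t j) ≠ 0 := by
    rw [hf₂]
    exact mul_ne_zero (pow_ne_zero _ (mul_ne_zero (pow_ne_zero _ htj0) hA)) (pow_ne_zero _ hBj)
  have hmem := hf (s j) (r + t j) hsj ((Padic.nonarchimedean _ _).trans (max_le hr htj)) hft
  rw [hf₁, hf₂, hst, mul_div_mul_comm, ← div_pow, ← div_pow] at hmem
  convert hmem using 3
  field_simp

lemma div_mem_closure_ratioSet {p : ℕ} [Fact p.Prime] {F : MvPolynomial (Fin 2) ℤ}
    {f : ℚ_[p] → ℚ_[p]} (hf : Continuous f)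
    (hF : ∀ k : ℤ, ((MvPolynomial.eval ![k, 1] F : ℤ) : ℚ_[p]) = f k)
    {s t : ℚ_[p]} (hs : ‖s‖ ≤ 1) (ht : ‖t‖ ≤ 1) (hft : f t ≠ 0) :
    f s / f t ∈ closure (ratioSet p F) := by
  obtain ⟨s, rfl⟩ : ∃ x : ℤ_[p], (x : ℚ_[p]) = s := ⟨⟨s, hs⟩, rfl⟩
  obtain ⟨t, rfl⟩ : ∃ x : ℤ_[p], (x : ℚ_[p]) = t := ⟨⟨t, ht⟩, rfl⟩
  have hd : DenseRange (Prod.map (Int.cast : ℤ → ℤ_[p]) (Int.cast : ℤ → ℤ_[p])) :=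
    PadicInt.denseRange_intCast.prodMap PadicInt.denseRange_intCast
  have hfc : Continuous fun x : ℤ_[p] => f x := hf.comp continuous_subtype_val
  have h₁ : Tendsto (fun x : ℤ_[p] × ℤ_[p] => f x.1) (𝓝 (s, t)) (𝓝 (f s)) :=
    (hfc.comp continuous_fst).tendsto (s, t)
  have h₂ : Tendsto (fun x : ℤ_[p] × ℤ_[p] => f x.2) (𝓝 (s, t)) (𝓝 (f t)) :=
    (hfc.comp continuous_snd).tendsto (s, t)
  have hfreq := mem_closure_iff_frequently.1 (hd (s, t))
  refine mem_closure_iff_frequently.2 ((h₁.div h₂ hft).frequently ?_)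
  refine (hfreq.and_eventually (h₂.eventually_ne hft)).mono ?_
  rintro _ ⟨⟨⟨a, b⟩, rfl⟩, hb⟩
  refine ⟨![a, 1], ![b, 1], fun h => hb ?_, ?_⟩
  · simpa [h] using (hF b).symm
  · simp [hF]

lemma Padic.norm_one_sub_p_pow {p : ℕ} [Fact p.Prime] {k : ℕ} (hk : k ≠ 0) :
    ‖1 - (p : ℚ_[p]) ^ k‖ = 1 := by
  have h : ‖-(p : ℚ_[p]) ^ k‖ < 1 := by
    rw [norm_neg, norm_pow]
    exact pow_lt_one₀ (norm_nonneg _) Padic.norm_p_lt_one hk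
  rw [sub_eq_add_neg, Padic.add_eq_max_of_ne (by rw [norm_one]; exact h.ne'), norm_one,
    max_eq_left h.le]

lemma exists_int_mul_sub_add_eq {q M : ℕ} (hq : q ≠ 0) (hM : M.Coprime q) (v : ℤ) :
    ∃ r < q, ∃ k : ℤ, (M : ℤ) * (q - r) + v = q * k := by
  have hq' : (0 : ℤ) < q := by positivity
  have hb : (1 : ℤ) = M * M.gcdA q + q * M.gcdB q := by
    rw [← Nat.gcd_eq_gcd_ab, hM.gcd_eq_one, Nat.cast_one]
  obtain ⟨r, hr⟩ := Int.eq_ofNat_of_zero_le (Int.emod_nonneg (v * M.gcdA q) hq'.ne')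
  have hlt := Int.emod_lt_of_pos (v * M.gcdA q) hq'
  have hdm := Int.emod_add_mul_ediv (v * M.gcdA q) q
  rw [hr] at hlt hdm
  refine ⟨r, by exact_mod_cast hlt,
    M + M * ((v * M.gcdA q) / q) + v * M.gcdB q, ?_⟩
  linear_combination v * hb - M * hdm

/-- Let `p` be a prime and `q₁ < q₂ < q₃` primes with `q₁q₂q₃` coprime to `p(p-1)`. For the
binary form `g₂` of the paper, `R(g₂)` is dense in `ℚ_p`. -/
theorem stmt7 (p q1 q2 q3 : ℕ) [Fact p.Prime]
    (h1 : q1.Prime) (h2 : q2.Prime) (h3 : q3.Prime)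
    (h12 : q1 < q2) (h23 : q2 < q3)
    (hcop : Nat.Coprime (q1 * q2 * q3) (p * (p - 1)))
    (g2 : MvPolynomial (Fin 2) ℤ)
    (hg2 : g2 = X 0 ^ (q1 * q2) *
      (∏ i ∈ Finset.Icc 1 q1, (X 0 + C ((p : ℤ) ^ i) * X 1) ^ (q1 * q3)) *
      (X 0 + C ((p : ℤ) ^ (q1 + 1)) * X 1) ^ (q2 * q3) *
      (∏ i ∈ Finset.Icc 1 (q3 - 1), (C ((p : ℤ) ^ i) * X 0 + X 1) ^ (q1 * q2)) *
      (∏ i ∈ Finset.Icc q3 (q3 + q2 - q1 - 1), (C ((p : ℤ) ^ i) * X 0 + X 1) ^ (q1 * q3)) *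
      (∏ i ∈ Finset.Icc (q3 + q2 - q1) (q3 + q2 - 2), (C ((p : ℤ) ^ i) * X 0 + X 1) ^ (q2 * q3))) :
    Dense (ratioSet p g2) := by
  have hp0 : (p : ℚ_[p]) ≠ 0 := by exact_mod_cast (Fact.out : p.Prime).ne_zero
  have hpr : (p : ℝ) ≠ 0 := by exact_mod_cast (Fact.out : p.Prime).ne_zero
  have hcop1 : q1.Coprime (p * (p - 1)) := (hcop.coprime_mul_right).coprime_mul_right
  have hM : (q2 * q3).Coprime q1 :=
    Nat.Coprime.mul_left ((Nat.coprime_primes h2 h1).2 h12.ne')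
      ((Nat.coprime_primes h3 h1).2 (h12.trans h23).ne')
  let P : Finset ℕ → ℚ_[p] → ℚ_[p] := fun I t => ∏ i ∈ I, ((p : ℚ_[p]) ^ i * t + 1)
  let Q : Finset ℕ → ℚ_[p] → ℚ_[p] := fun I t => ∏ i ∈ I, (t + (p : ℚ_[p]) ^ i)
  have hPc (I) : Continuous (P I) := by fun_prop
  have hQc (I) : Continuous (Q I) := by fun_prop
  have hP0 (I) : P I 0 = 1 := by simp [P]
  have hPn (I : Finset ℕ) (i : ℕ) (hi : i ≠ 0) : ‖P I (-(p : ℚ_[p]) ^ i)‖ = 1 := by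
    simp only [P, norm_prod]
    refine Finset.prod_eq_one fun j _ => ?_
    rw [← Padic.norm_one_sub_p_pow (p := p) (k := j + i) (by omega)]
    ring_nf
  have hP1 (I : Finset ℕ) (i : ℕ) (hi : i ≠ 0) : P I (-(p : ℚ_[p]) ^ i) ≠ 0 :=
    norm_ne_zero_iff.1 (by rw [hPn I i hi]; exact one_ne_zero)
  set I₁ := Finset.Icc 1 (q3 - 1)
  set I₂ := Finset.Icc q3 (q3 + q2 - q1 - 1)
  set I₃ := Finset.Icc (q3 + q2 - q1) (q3 + q2 - 2)
  set J := Finset.Icc 1 q1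
  let B : ℚ_[p] → ℚ_[p] := fun t => (t + (p : ℚ_[p]) ^ (q1 + 1)) * P I₃ t
  let A₁ : ℚ_[p] → ℚ_[p] := fun t => Q J t ^ q3 * P I₁ t ^ q2 * P I₂ t ^ q3
  let f : ℚ_[p] → ℚ_[p] := fun t => (t ^ q2 * A₁ t) ^ q1 * B t ^ (q2 * q3)
  have hBc : Continuous B := by fun_prop
  have hA₁c : Continuous A₁ := by fun_prop
  have hF (k : ℤ) : ((MvPolynomial.eval ![k, 1] g2 : ℤ) : ℚ_[p]) = f k := by
    simp only [hg2, f, A₁, B, P, Q, map_mul, map_prod, map_pow, map_add, eval_X, eval_C,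
      Matrix.cons_val_zero, Matrix.cons_val_one, Finset.prod_pow, mul_pow, mul_one]
    push_cast
    ring
  have hmem : ∀ s t : ℚ_[p], ‖s‖ ≤ 1 → ‖t‖ ≤ 1 → f t ≠ 0 →
      f s / f t ∈ closure (ratioSet p g2) := fun s t hs ht hft =>
    div_mem_closure_ratioSet (by fun_prop) hF hs ht hft
  suffices h : ∀ z : ℚ_[p], z ≠ 0 → z ∈ closure (ratioSet p g2) by
    have hd : Dense ({0}ᶜ : Set ℚ_[p]) := dense_compl_singleton 0
    exact dense_closure.1 (hd.mono h)
  intro z hz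
  obtain ⟨r, hr, k, hk⟩ := exists_int_mul_sub_add_eq h1.ne_zero hM (-z.valuation)
  set i := r + 1 with hi
  have hi0 : i ≠ 0 := by omega
  have hpow {j l : ℕ} (hjl : j ≠ l) : (p : ℚ_[p]) ^ j - (p : ℚ_[p]) ^ l ≠ 0 := fun h =>
    hjl (Nat.pow_right_injective (Fact.out : p.Prime).two_le (by exact_mod_cast sub_eq_zero.1 h))
  have hB0 : B 0 = (p : ℚ_[p]) ^ (q1 + 1) := by simp [B, hP0]
  have hBn : ‖B (-(p : ℚ_[p]) ^ i)‖ = (p : ℝ) ^ (-i : ℤ) := by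
    have e : -(p : ℚ_[p]) ^ i + (p : ℚ_[p]) ^ (q1 + 1) =
        -((p : ℚ_[p]) ^ i * (1 - (p : ℚ_[p]) ^ (q1 - r))) := by
      rw [mul_sub, ← pow_add, show i + (q1 - r) = q1 + 1 by omega]
      ring
    simp only [B]
    rw [norm_mul, hPn _ i hi0, e, norm_neg, norm_mul, Padic.norm_one_sub_p_pow (by omega),
      Padic.norm_p_pow, mul_one, mul_one]
  have hBi : B (-(p : ℚ_[p]) ^ i) ≠ 0 := norm_ne_zero_iff.1 (by rw [hBn]; positivity)
  have hb : (B 0 / B (-(p : ℚ_[p]) ^ i)) ^ (q2 * q3) ≠ 0 := by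
    rw [hB0]
    positivity
  obtain ⟨a, ha⟩ := Padic.exists_pow_eq_of_norm_eq hcop1 (k := k)
    (z := z / (B 0 / B (-(p : ℚ_[p]) ^ i)) ^ (q2 * q3)) (by
      rw [norm_div, norm_pow, norm_div, hBn, hB0, Padic.norm_p_pow,
        Padic.norm_eq_zpow_neg_valuation hz, ← zpow_sub₀ hpr, ← zpow_natCast, ← zpow_mul,
        ← zpow_sub₀ hpr, ← hk]
      congr 1
      rw [hi]
      push_cast
      ring)
  have ha0 : a ≠ 0 := by
    rintro rfl
    rw [zero_pow h1.ne_zero] at ha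
    exact div_ne_zero hz hb ha.symm
  let A₂ : ℚ_[p] → ℚ_[p] := fun t => (-(p : ℚ_[p]) ^ i + t) ^ q2 *
    (Q (J.erase i) (-(p : ℚ_[p]) ^ i + t) ^ q3 * P I₁ (-(p : ℚ_[p]) ^ i + t) ^ q2 *
      P I₂ (-(p : ℚ_[p]) ^ i + t) ^ q3)
  have hQJ (t : ℚ_[p]) : Q J (-(p : ℚ_[p]) ^ i + t) = t * Q (J.erase i) (-(p : ℚ_[p]) ^ i + t) := by
    simp only [Q]
    rw [← Finset.mul_prod_erase J _ (Finset.mem_Icc.2 ⟨by omega, by omega⟩ : i ∈ J)]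
    ring
  have hmain := Padic.pow_mul_div_pow_mem_of_isClosed (r := -(p : ℚ_[p]) ^ i) (A₁ := A₁)
    (A₂ := A₂) (B := B) (f := f) (l := q1) (M := q2 * q3)
    ((Nat.coprime_primes h2 h3).2 h23.ne) h2.ne_zero h3.ne_zero isClosed_closure
    (by rw [norm_neg, norm_pow]; exact pow_le_one₀ (norm_nonneg _) Padic.norm_p_lt_one.le) hmem
    hA₁c (by fun_prop) hBc ?_ ?_ hBi (fun _ => rfl) (fun t => ?_) ha0
  · rwa [ha, div_mul_cancel₀ _ hb] at hmain
  · simp only [A₁, hP0, one_pow, mul_one]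
    refine pow_ne_zero _ (Finset.prod_ne_zero_iff.2 fun j _ => ?_)
    rw [zero_add]
    exact pow_ne_zero _ hp0
  · simp only [A₂, add_zero]
    refine mul_ne_zero (pow_ne_zero _ (neg_ne_zero.2 (pow_ne_zero _ hp0))) (mul_ne_zero
      (mul_ne_zero (pow_ne_zero _ (Finset.prod_ne_zero_iff.2 fun j hj => ?_))
        (pow_ne_zero _ (hP1 _ i hi0))) (pow_ne_zero _ (hP1 _ i hi0)))
    rw [neg_add_eq_sub]
    exact hpow (Finset.ne_of_mem_erase hj)
  · simp only [f, A₁, A₂, hQJ]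
    ring
end
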